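/- Let m > 1 with smallest prime divisor p, and let Q(X) ∈ ℚ[X] have at least k simple roots in ℚ̄, where k = 5 if p = 2, k = 4 if p = 3, and k = 2 if p ≥ 5. Then for all but finitely many rational numbers α, the polynomial X^m − Q(α) is irreducible over ℚ; equivalently, Q(α)^{1/m} has degree m over ℚ. -/

import Mathlib

namespace VojtaCurve

section Quadratic

variable {A : Type*} [AddCommGroup A]

theorem exists_canonical_height (h : A → ℝ) (h0 : ∀ P, 0 ≤ h P)
    (hC : ∃ C, ∀ P Q, |h (P + Q) + h (P - Q) - 2 * (h P + h Q)| ≤ C) :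
    ∃ q : A → ℝ, (∀ P, 0 ≤ q P) ∧ (∀ P Q, q (P + Q) + q (P - Q) = 2 * (q P + q Q)) ∧
      ∃ C, ∀ P, |q P - h P| ≤ C := by
  obtain ⟨C, hC⟩ := hC
  have hC0 : 0 ≤ C := (abs_nonneg _).trans (hC 0 0)
  set D := C + |h 0| with hD
  have hdbl (P : A) : |h ((2 : ℕ) • P) - 4 * h P| ≤ D := by
    have h1 := hC P P
    rw [sub_self, ← two_nsmul] at h1
    have h2 : h ((2 : ℕ) • P) - 4 * h P
        = (h ((2 : ℕ) • P) + h 0 - 2 * (h P + h P)) - h 0 := by ring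
    rw [h2]
    exact (abs_sub _ _).trans (by linarith)
  let a : A → ℕ → ℝ := fun P m => h ((2 ^ m : ℕ) • P) / 4 ^ m
  have hstep (P : A) (m : ℕ) : dist (a P m) (a P (m + 1)) ≤ D * (1 / 4) ^ m := by
    rw [dist_comm, Real.dist_eq]
    have e : a P (m + 1) - a P m
        = (h ((2 : ℕ) • ((2 ^ m : ℕ) • P)) - 4 * h ((2 ^ m : ℕ) • P)) / 4 ^ (m + 1) := by
      simp only [a, ← mul_nsmul', pow_succ, mul_comm]
      field_simp
    rw [e, abs_div, abs_of_pos (by positivity : (0 : ℝ) < 4 ^ (m + 1)), div_pow, one_pow,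
      mul_one_div]
    have := hdbl ((2 ^ m : ℕ) • P)
    have hD0 : 0 ≤ D := by positivity
    apply div_le_div₀ hD0 this (by positivity)
    exact pow_le_pow_right₀ (by norm_num) (by omega)
  have hcau (P : A) := cauchySeq_of_le_geometric (1 / 4) D (by norm_num) (hstep P)
  choose q hq using fun P => cauchySeq_tendsto_of_complete (hcau P)
  have hnn (P : A) (m : ℕ) : 0 ≤ a P m := div_nonneg (h0 _) (by positivity)
  refine ⟨q, fun P => ge_of_tendsto' (hq P) (hnn P), fun P Q => ?_, D / (1 - 1 / 4), fun P => ?_⟩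
  · have ht : Filter.Tendsto (fun m => a (P + Q) m + a (P - Q) m - 2 * (a P m + a Q m))
        Filter.atTop (nhds (q (P + Q) + q (P - Q) - 2 * (q P + q Q))) :=
      ((hq _).add (hq _)).sub (((hq _).add (hq _)).const_mul 2)
    have hz : Filter.Tendsto (fun m => a (P + Q) m + a (P - Q) m - 2 * (a P m + a Q m))
        Filter.atTop (nhds 0) := by
      have hb : Filter.Tendsto (fun m : ℕ => C * (1 / 4 : ℝ) ^ m) Filter.atTop (nhds 0) := by
        simpa using (tendsto_pow_atTop_nhds_zero_of_lt_one (r := (1 / 4 : ℝ))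
          (by norm_num) (by norm_num)).const_mul C
      refine squeeze_zero_norm (fun m => ?_) hb
      have e : a (P + Q) m + a (P - Q) m - 2 * (a P m + a Q m)
          = (h ((2 ^ m : ℕ) • P + (2 ^ m : ℕ) • Q) + h ((2 ^ m : ℕ) • P - (2 ^ m : ℕ) • Q)
            - 2 * (h ((2 ^ m : ℕ) • P) + h ((2 ^ m : ℕ) • Q))) / 4 ^ m := by
        simp only [a, nsmul_add, nsmul_sub]
        ring
      rw [e, Real.norm_eq_abs, abs_div, abs_of_pos (by positivity : (0 : ℝ) < 4 ^ m), div_pow,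
        one_pow, mul_one_div]
      exact div_le_div_of_nonneg_right (hC _ _) (by positivity)
    have := tendsto_nhds_unique ht hz
    linarith
  · have := dist_le_of_le_geometric_of_tendsto₀ (1 / 4) D (by norm_num) (hstep P) (hq P)
    rw [dist_comm, Real.dist_eq] at this
    simpa [a] using this

variable {q : A → ℝ} (hq : ∀ P Q, q (P + Q) + q (P - Q) = 2 * (q P + q Q))
include hq

theorem parallelogram_zero : q 0 = 0 := by
  have := hq 0 0
  simp only [add_zero, sub_zero] at this
  linarith

theorem parallelogram_nsmul_add (P Q : A) (m : ℕ) :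
    q (m • P + Q) = q Q + m * (q (P + Q) - q P - q Q) + m ^ 2 * q P := by
  induction m using Nat.strong_induction_on with
  | _ m ih =>
    match m with
    | 0 => simp
    | 1 => simp
    | m + 2 =>
      have h1 := ih (m + 1) (by omega)
      have h2 := ih m (by omega)
      have h3 := hq ((m + 1) • P + Q) P
      have e1 : (m + 1) • P + Q + P = (m + 2) • P + Q := by
        simp only [add_nsmul, one_nsmul, two_nsmul]
        abel
      have e2 : (m + 1) • P + Q - P = m • P + Q := by
        simp only [add_nsmul, one_nsmul]
        abel
      rw [e1, e2, h1, h2] at h3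
      push_cast at h3 ⊢
      linarith

theorem parallelogram_nsmul (P : A) (m : ℕ) : q (m • P) = m ^ 2 * q P := by
  have := parallelogram_nsmul_add hq P 0 m
  simp only [add_zero, parallelogram_zero hq] at this
  linarith

theorem parallelogram_neg (P : A) : q (-P) = q P := by
  have h0 := parallelogram_zero hq
  have := hq 0 P
  rw [zero_add, zero_sub] at this
  linarith

theorem parallelogram_nsmul_add_nsmul (P Q : A) (m n : ℕ) :
    q (m • P + n • Q) = m ^ 2 * q P + m * n * (q (P + Q) - q P - q Q) + n ^ 2 * q Q := by
  have h1 := parallelogram_nsmul_add hq P (n • Q) m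
  have h2 := parallelogram_nsmul_add hq Q P n
  rw [add_comm P (n • Q), h2, parallelogram_nsmul hq] at h1
  rw [h1, add_comm Q P]
  ring

theorem parallelogram_triangle (hnn : ∀ P, 0 ≤ q P) (P Q : A) :
    √(q (P + Q)) ≤ √(q P) + √(q Q) := by
  set β := q (P + Q) - q P - q Q with hβ
  have key (P Q : A) (h : 0 < q (P + Q) - q P - q Q) :
      (q (P + Q) - q P - q Q) ^ 2 ≤ 4 * q P * q Q := by
    set β := q (P + Q) - q P - q Q with hβ
    have h1 (m n : ℕ) : m * n * β ≤ m ^ 2 * q P + n ^ 2 * q Q := by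
      have h2 := hnn (m • P + n • (-Q))
      rw [parallelogram_nsmul_add_nsmul hq, parallelogram_neg hq] at h2
      have h3 := hq P Q
      rw [← sub_eq_add_neg] at h2
      have h4 : q (P - Q) - q P - q Q = -β := by linarith
      rw [h4] at h2
      linarith
    have h2 (t : ℝ) (ht : 0 < t) : t * β ≤ t ^ 2 * q P + q Q := by
      have hcl : t ∈ closure (Set.range ((↑) : ℚ → ℝ) ∩ Set.Ioi 0) := by
        rw [Set.inter_comm]
        have hd : Dense (Set.range ((↑) : ℚ → ℝ)) := Rat.denseRange_cast
        exact hd.open_subset_closure_inter isOpen_Ioi ht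
      have hclosed : IsClosed {t : ℝ | t * β ≤ t ^ 2 * q P + q Q} :=
        isClosed_le (by fun_prop) (by fun_prop)
      refine closure_minimal ?_ hclosed hcl
      rintro _ ⟨⟨r, rfl⟩, hr⟩
      simp only [Set.mem_Ioi, Rat.cast_pos] at hr
      have hden : (0 : ℝ) < r.den := by exact_mod_cast r.den_pos
      have hnum : ((r.num.toNat : ℕ) : ℝ) = (r : ℝ) * r.den := by
        have : ((r.num.toNat : ℤ)) = r.num := Int.toNat_of_nonneg (Rat.num_nonneg.mpr hr.le)
        have h3 : (r : ℝ) * r.den = r.num := by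
          exact_mod_cast Rat.mul_den_eq_num r
        rw [h3]
        exact_mod_cast this
      have h4 := h1 r.num.toNat r.den
      rw [hnum] at h4
      have h5 : (r.den : ℝ) ^ 2 * ((r : ℝ) * β) ≤ (r.den : ℝ) ^ 2 * ((r : ℝ) ^ 2 * q P + q Q) := by
        linarith
      exact le_of_mul_le_mul_left h5 (by positivity)
    rcases (hnn P).eq_or_lt with hP | hP
    · exfalso
      have := h2 ((q Q + 1) / β) (div_pos (by linarith [hnn Q]) h)
      rw [← hP, div_mul_cancel₀ _ h.ne'] at this
      linarith
    · have := h2 (β / (2 * q P)) (by positivity)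
      have e : β / (2 * q P) * β - (β / (2 * q P)) ^ 2 * q P = β ^ 2 / (4 * q P) := by
        field_simp; ring
      have h3 : β ^ 2 / (4 * q P) ≤ q Q := by linarith
      rw [div_le_iff₀ (by positivity)] at h3
      linarith
  rw [Real.sqrt_le_left (by positivity), add_sq, Real.sq_sqrt (hnn P), Real.sq_sqrt (hnn Q)]
  rcases le_or_gt β 0 with h | h
  · have : 0 ≤ 2 * √(q P) * √(q Q) := by positivity
    linarith
  · have h1 : β ≤ 2 * √(q P) * √(q Q) := by
      apply le_of_sq_le_sq ?_ (by positivity)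
      rw [mul_pow, mul_pow, Real.sq_sqrt (hnn P), Real.sq_sqrt (hnn Q)]
      linarith [key P Q h]
    linarith

theorem exists_sub_two_pow_nsmul_le (hnn : ∀ P, 0 ≤ q P) (hfin : ∀ B, {P | q P ≤ B}.Finite)
    (R : Set A) (hR : R.Finite) (hrep : ∀ P, ∃ P', P - (2 : ℕ) • P' ∈ R)
    (Z : Set A) (hZ : Z.Infinite) (ε B : ℝ) (hε : 0 < ε) (k₀ : ℕ) :
    ∃ P ∈ Z, ∃ Q ∈ Z, ∃ k, k₀ ≤ k ∧ B ≤ q P ∧ q (Q - (2 ^ k : ℕ) • P) ≤ ε * q Q := by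
  set nm : A → ℝ := fun P => √(q P) with hnm
  have tri (P Q : A) : nm (P + Q) ≤ nm P + nm Q := parallelogram_triangle hq hnn P Q
  have nm0 (P : A) : 0 ≤ nm P := Real.sqrt_nonneg _
  have nmneg (P : A) : nm (-P) = nm P := by simp only [hnm, parallelogram_neg hq]
  have nmsmul (m : ℕ) (P : A) : nm (m • P) = m * nm P := by
    simp only [hnm, parallelogram_nsmul hq]
    rw [Real.sqrt_mul (by positivity), Real.sqrt_sq (by positivity)]
  have nmfin (b : ℝ) : {P | nm P ≤ b}.Finite := by
    refine (hfin (b ^ 2)).subset fun P hP => ?_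
    have h1 : nm P ≤ b := hP
    calc q P = nm P ^ 2 := (Real.sq_sqrt (hnn P)).symm
      _ ≤ b ^ 2 := pow_le_pow_left₀ (nm0 P) h1 2
  obtain ⟨ρ, hρ⟩ : ∃ ρ, ∀ r ∈ R, nm r ≤ ρ := by
    obtain ⟨ρ, hρ⟩ := (hR.image nm).bddAbove
    exact ⟨ρ, fun r hr => hρ ⟨r, hr, rfl⟩⟩
  have hρ0 : 0 ≤ ρ := by
    obtain ⟨P', h⟩ := hrep 0
    exact (nm0 _).trans (hρ _ h)
  obtain ⟨Λ, hΛ1, hΛρ, hΛε⟩ : ∃ Λ : ℝ, 1 ≤ Λ ∧ ρ ≤ Λ ∧ 2 * ρ ≤ √ε * (Λ - ρ) := by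
    have hs : 0 < √ε := Real.sqrt_pos.mpr hε
    refine ⟨1 + ρ + 2 * ρ / √ε, ?_, ?_, ?_⟩
    · have : 0 ≤ 2 * ρ / √ε := by positivity
      linarith
    · have : 0 ≤ 2 * ρ / √ε := by positivity
      linarith
    · have : √ε * (1 + ρ + 2 * ρ / √ε - ρ) = √ε + 2 * ρ := by field_simp; ring
      rw [this]; linarith
  have digits (m : ℕ) : ∀ Q, nm Q ≤ m → Λ < nm Q → ∃ T j, Λ < nm T ∧ nm T ≤ 2 * Λ + ρ ∧
      nm (Q - (2 ^ j : ℕ) • T) ≤ (2 ^ j - 1) * ρ := by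
    induction m with
    | zero => intro Q h1 h2; push_cast at h1; linarith
    | succ m ih =>
      intro Q h1 h2
      by_cases h3 : nm Q ≤ 2 * Λ + ρ
      · refine ⟨Q, 0, h2, h3, ?_⟩
        simp [hnm, parallelogram_zero hq]
      · push Not at h3
        obtain ⟨Q', hQ'⟩ := hrep Q
        have h4 := hρ _ hQ'
        have h5 : nm Q ≤ 2 * nm Q' + ρ := by
          have := tri ((2 : ℕ) • Q') (Q - (2 : ℕ) • Q')
          rw [add_sub_cancel, nmsmul] at this
          push_cast at this; linarith
        have h6 : 2 * nm Q' ≤ nm Q + ρ := by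
          have := tri Q (-(Q - (2 : ℕ) • Q'))
          rw [nmneg, ← sub_eq_add_neg, sub_sub_cancel, nmsmul] at this
          push_cast at this; linarith
        push_cast at h1
        obtain ⟨T, j, hT1, hT2, hT3⟩ := ih Q' (by linarith) (by linarith)
        refine ⟨T, j + 1, hT1, hT2, ?_⟩
        have e : Q - (2 ^ (j + 1) : ℕ) • T
            = (2 : ℕ) • (Q' - (2 ^ j : ℕ) • T) + (Q - (2 : ℕ) • Q') := by
          rw [nsmul_sub, ← mul_nsmul', pow_succ']; abel
        rw [e]
        refine (tri _ _).trans ?_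
        rw [nmsmul, pow_succ]
        push_cast
        linarith
  have hZ' : (Z \ {P | nm P ≤ Λ}).Infinite := hZ.sdiff (nmfin _)
  have hdig (Q : A) (hQ : Q ∈ Z \ {P | nm P ≤ Λ}) : ∃ T j, Λ < nm T ∧ nm T ≤ 2 * Λ + ρ ∧
      nm (Q - (2 ^ j : ℕ) • T) ≤ (2 ^ j - 1) * ρ := by
    obtain ⟨m, hm⟩ := exists_nat_ge (nm Q)
    exact digits m Q hm (not_le.mp hQ.2)
  choose! T j hT1 hT2 hT3 using hdig
  obtain ⟨T₀, -, hT₀⟩ : ∃ T₀ ∈ {P | nm P ≤ 2 * Λ + ρ},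
      ((Z \ {P | nm P ≤ Λ}) ∩ T ⁻¹' {T₀}).Infinite := by
    by_contra! hcon
    refine hZ' (((nmfin (2 * Λ + ρ)).biUnion fun T₀ h => hcon T₀ h).subset ?_)
    intro Q hQ
    exact Set.mem_iUnion₂.mpr ⟨T Q, hT2 Q hQ, hQ, rfl⟩
  obtain ⟨P, ⟨hPZ, hPT⟩, hPB⟩ := (hT₀.sdiff (hfin B)).nonempty
  have hj : {Q | nm Q ≤ 2 ^ (j P + k₀) * (2 * Λ + 2 * ρ)}.Finite := nmfin _
  obtain ⟨Q, ⟨hQZ, hQT⟩, hQB⟩ := (hT₀.sdiff hj).nonempty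
  simp only [Set.mem_preimage, Set.mem_singleton_iff] at hPT hQT
  have hP3 := hT3 P hPZ
  have hQ3 := hT3 Q hQZ
  have hT1' := hT1 Q hQZ
  have hT2' := hT2 Q hQZ
  rw [hPT] at hP3
  rw [hQT] at hQ3 hT1' hT2'
  have hjlt : j P + k₀ ≤ j Q := by
    by_contra! hlt
    apply hQB
    have h1 := tri (Q - (2 ^ j Q : ℕ) • T₀) ((2 ^ j Q : ℕ) • T₀)
    rw [sub_add_cancel, nmsmul] at h1
    push_cast at h1
    have h2 : (2 : ℝ) ^ j Q ≤ 2 ^ (j P + k₀) := pow_le_pow_right₀ (by norm_num) hlt.le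
    have h3 : (0 : ℝ) < 2 ^ j Q := by positivity
    calc nm Q ≤ 2 ^ j Q * (2 * Λ + 2 * ρ) := by nlinarith
      _ ≤ _ := mul_le_mul_of_nonneg_right h2 (by linarith)
  refine ⟨P, hPZ.1, Q, hQZ.1, j Q - j P, by omega, (not_le.mp hPB).le, ?_⟩
  have e : Q - (2 ^ (j Q - j P) : ℕ) • P = (Q - (2 ^ j Q : ℕ) • T₀)
      + (2 ^ (j Q - j P) : ℕ) • (-(P - (2 ^ j P : ℕ) • T₀)) := by
    rw [smul_neg, nsmul_sub, ← mul_nsmul', ← pow_add, Nat.sub_add_cancel (by omega)]; abel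
  have h1 : nm (Q - (2 ^ (j Q - j P) : ℕ) • P) ≤ 2 ^ j Q * (2 * ρ) := by
    rw [e]
    refine (tri _ _).trans ?_
    rw [nmsmul, nmneg]
    have h2 : (2 : ℝ) ^ j Q = 2 ^ (j Q - j P) * 2 ^ j P := by
      rw [← pow_add, Nat.sub_add_cancel (by omega)]
    have h3 : (0 : ℝ) < 2 ^ (j Q - j P) := by positivity
    push_cast
    rw [h2] at hQ3 ⊢
    have h4 := mul_le_mul_of_nonneg_left hP3 h3.le
    nlinarith
  have h2 : 2 ^ j Q * (Λ - ρ) ≤ nm Q := by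
    have := tri Q (-(Q - (2 ^ j Q : ℕ) • T₀))
    rw [nmneg, ← sub_eq_add_neg, sub_sub_cancel, nmsmul] at this
    push_cast at this
    have h3 : (0 : ℝ) < 2 ^ j Q := by positivity
    nlinarith
  have h3 : nm (Q - (2 ^ (j Q - j P) : ℕ) • P) ≤ √ε * nm Q := by
    have h4 : (0 : ℝ) < 2 ^ j Q := by positivity
    have h5 := mul_le_mul_of_nonneg_left hΛε h4.le
    have h6 := mul_le_mul_of_nonneg_left h2 (Real.sqrt_nonneg ε)
    linarith
  have h4 := pow_le_pow_left₀ (nm0 _) h3 2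
  rw [mul_pow, Real.sq_sqrt hε.le] at h4
  simp only [hnm] at h4
  rwa [Real.sq_sqrt (hnn _), Real.sq_sqrt (hnn _)] at h4

end Quadratic

end VojtaCurve

namespace VojtaCurve

open Polynomial IntermediateField

universe u

section Capelli

variable {K : Type u} [Field K]

theorem norm_pow_of_minpoly_eq {E : Type u} [Field E] [Algebra K E] {n : ℕ} (hn : 0 < n) {a : K}
    {x : E} (hx : minpoly K x = X ^ n - C a) {r : ℕ} {b : K⟮x⟯} {c : K}
    (hb : b ^ r = algebraMap K K⟮x⟯ c * AdjoinSimple.gen K x) :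
    (Algebra.norm K b) ^ r = c ^ n * ((-1) ^ n * -a) := by
  have hxi : IsIntegral K x := not_not.mp fun h ↦ by
    simpa only [degree_zero, degree_X_pow_sub_C hn,
      WithBot.natCast_ne_bot] using congr_arg degree (hx.symm.trans (dif_neg h))
  have hrank : Module.finrank K K⟮x⟯ = n := by
    rw [adjoin.finrank hxi, hx, natDegree_X_pow_sub_C]
  rw [← map_pow, hb, map_mul, Algebra.norm_algebraMap, hrank]
  congr 1
  rw [← adjoin.powerBasis_gen hxi, Algebra.PowerBasis.norm_gen_eq_coeff_zero_minpoly]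
  simp [minpoly_gen, hx, hn.ne]

theorem X_pow_two_pow_sub_C_irreducible (k : ℕ) {a : K} (ha : ∀ b : K, b ^ 2 ≠ a)
    (ha' : ∀ b : K, b ^ 2 ≠ -a) : Irreducible (X ^ (2 ^ k) - C a) := by
  induction k generalizing K a with
  | zero => simpa using irreducible_X_sub_C a
  | succ k ih =>
    rw [pow_succ]
    refine X_pow_mul_sub_C_irreducible (X_pow_sub_C_irreducible_of_prime Nat.prime_two ha) ?_
    intro E _ _ x hx
    apply ih
    · intro b hb
      have := norm_pow_of_minpoly_eq (r := 2) (b := b) (c := 1) two_pos hx (by simpa using hb)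
      exact ha' _ (by simpa using this)
    · intro b hb
      have := norm_pow_of_minpoly_eq (r := 2) (b := b) (c := -1) two_pos hx (by simpa using hb)
      exact ha' _ (by simpa using this)

/-- A form of the criterion of Capelli. -/
theorem X_pow_sub_C_irreducible_of_forall_prime {m : ℕ} (hm : m ≠ 0) {a : K}
    (ha : ∀ p : ℕ, p.Prime → p ∣ m → ∀ b : K, b ^ p ≠ a)
    (ha' : 2 ∣ m → ∀ b : K, b ^ 2 ≠ -a) : Irreducible (X ^ m - C a) := by
  obtain ⟨k, n, hn, rfl⟩ := Nat.exists_eq_two_pow_mul_odd hm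
  rcases Nat.eq_zero_or_pos k with rfl | hk
  · rw [pow_zero, one_mul] at ha ⊢
    exact X_pow_sub_C_irreducible_of_odd hn ha
  have h2 : 2 ∣ 2 ^ k * n := (dvd_pow_self 2 hk.ne').mul_right n
  rw [mul_comm]
  refine X_pow_mul_sub_C_irreducible
    (X_pow_two_pow_sub_C_irreducible k (ha 2 Nat.prime_two h2) (ha' h2)) ?_
  intro E _ _ x hx
  refine X_pow_sub_C_irreducible_of_odd hn fun q hq hqn b hb => ?_
  have hodd : Odd q := hn.of_dvd_nat hqn
  have := norm_pow_of_minpoly_eq (r := q) (b := b) (c := 1) (by positivity) hx (by simpa using hb)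
  rw [one_pow, one_mul, (even_two.pow_of_ne_zero hk.ne').neg_one_pow, one_mul] at this
  refine ha q hq (hqn.mul_left _) (-Algebra.norm K b) ?_
  rw [hodd.neg_pow, this, neg_neg]

end Capelli

end VojtaCurve

namespace VojtaCurve

open Polynomial

section Seminorms

variable {R : Type*} [CommRing R]

theorem RingSeminorm.sum_le {ι : Type*} (ν : RingSeminorm R) (s : Finset ι) (f : ι → R) :
    ν (∑ i ∈ s, f i) ≤ ∑ i ∈ s, ν (f i) :=
  Finset.le_sum_of_subadditive ν (map_zero ν).le (map_add_le_add ν) s f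

theorem RingSeminorm.pow_le (ν : RingSeminorm R) (h1 : ν 1 ≤ 1) (x : R) (n : ℕ) :
    ν (x ^ n) ≤ ν x ^ n := by
  induction n with
  | zero => simpa using h1
  | succ n ih =>
    rw [pow_succ, pow_succ]
    exact (map_mul_le_mul ν _ _).trans (mul_le_mul_of_nonneg_right ih (apply_nonneg ν _))

theorem RingSeminorm.natCast_le (ν : RingSeminorm R) (h1 : ν 1 ≤ 1) (n : ℕ) :
    ν (n : R) ≤ n := by
  induction n with
  | zero => simp
  | succ n ih =>
    push_cast
    exact (map_add_le_add ν _ _).trans (add_le_add ih h1)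

theorem RingSeminorm.mul_le_of_le (ν : RingSeminorm R) {x y : R} {a b : ℝ} (hx : ν x ≤ a)
    (hy : ν y ≤ b) : ν (x * y) ≤ a * b :=
  (map_mul_le_mul ν x y).trans
    (mul_le_mul hx hy (apply_nonneg ν _) ((apply_nonneg ν _).trans hx))

theorem RingSeminorm.pow_le_of_le (ν : RingSeminorm R) (h1 : ν 1 ≤ 1) {x : R} {a : ℝ}
    (hx : ν x ≤ a) (n : ℕ) : ν (x ^ n) ≤ a ^ n :=
  (RingSeminorm.pow_le ν h1 x n).trans (pow_le_pow_left₀ (apply_nonneg ν _) hx n)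

theorem RingSeminorm.add_le_of_le (ν : RingSeminorm R) {x y : R} {a b : ℝ} (hx : ν x ≤ a)
    (hy : ν y ≤ b) : ν (x + y) ≤ a + b :=
  (map_add_le_add ν x y).trans (add_le_add hx hy)

theorem RingSeminorm.sub_le_of_le (ν : RingSeminorm R) {x y : R} {a b : ℝ} (hx : ν x ≤ a)
    (hy : ν y ≤ b) : ν (x - y) ≤ a + b :=
  (map_sub_le_add ν x y).trans (add_le_add hx hy)

theorem polySum_add_le (ν : RingSeminorm R) (κ : NNReal) (p q : R[X]) :
    ((p + q).sum fun i a => ν a * (κ : ℝ) ^ i) ≤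
      (p.sum fun i a => ν a * (κ : ℝ) ^ i) + q.sum fun i a => ν a * (κ : ℝ) ^ i := by
  have key (f : R[X]) {s : Finset ℕ} (hs : f.support ⊆ s) :
      (f.sum fun i a => ν a * (κ : ℝ) ^ i) = ∑ i ∈ s, ν (f.coeff i) * (κ : ℝ) ^ i := by
    rw [Polynomial.sum_def]
    refine Finset.sum_subset hs fun i _ hi => ?_
    rw [notMem_support_iff.mp hi]
    simp
  rw [key p (s := p.support ∪ q.support) Finset.subset_union_left,
    key q (s := p.support ∪ q.support) Finset.subset_union_right,
    key (p + q) (s := p.support ∪ q.support) support_add, ← Finset.sum_add_distrib]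
  refine Finset.sum_le_sum fun i _ => ?_
  rw [coeff_add, ← add_mul]
  exact mul_le_mul_of_nonneg_right (map_add_le_add ν _ _) (by positivity)

/-- The seminorm `∑ ν(aᵢ) κ^i` on polynomials. -/
noncomputable def polySeminorm (ν : RingSeminorm R) (κ : NNReal) : RingSeminorm R[X] where
  toFun p := p.sum fun i a => ν a * (κ : ℝ) ^ i
  map_zero' := by simp
  neg' p := by
    rw [Polynomial.sum_def, Polynomial.sum_def, support_neg]
    simp
  add_le' := polySum_add_le ν κ
  mul_le' p q := by
    set f : R[X] → ℝ := fun p => p.sum fun i a => ν a * (κ : ℝ) ^ i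
    have hadd : ∀ p q : R[X], f (p + q) ≤ f p + f q := polySum_add_le ν κ
    have h0 : f 0 = 0 := by simp [f]
    have hmon (i : ℕ) (a : R) : f (monomial i a) = ν a * (κ : ℝ) ^ i := by
      simp only [f]
      rw [sum_monomial_index]
      simp
    change f (p * q) ≤ f p * f q
    rw [mul_eq_sum_sum]
    refine (Finset.le_sum_of_subadditive f h0.le hadd _ _).trans ?_
    have : f p * f q = ∑ i ∈ p.support, ∑ j ∈ q.support,
        (ν (p.coeff i) * (κ : ℝ) ^ i) * (ν (q.coeff j) * (κ : ℝ) ^ j) := by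
      rw [← Finset.sum_mul_sum]; rfl
    rw [this]
    refine Finset.sum_le_sum fun i _ => ?_
    rw [Polynomial.sum_def]
    refine (Finset.le_sum_of_subadditive f h0.le hadd _ _).trans ?_
    refine Finset.sum_le_sum fun j _ => ?_
    rw [hmon, pow_add]
    calc _ ≤ (ν (p.coeff i) * ν (q.coeff j)) * ((κ : ℝ) ^ i * (κ : ℝ) ^ j) :=
          mul_le_mul_of_nonneg_right (map_mul_le_mul ν _ _) (by positivity)
      _ = _ := by ring

variable (ν : RingSeminorm R) (κ : NNReal)

theorem polySeminorm_def (p : R[X]) :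
    polySeminorm ν κ p = p.sum fun i a => ν a * (κ : ℝ) ^ i := rfl

@[simp] theorem polySeminorm_C (a : R) : polySeminorm ν κ (C a) = ν a := by
  rw [polySeminorm_def, sum_C_index] <;> simp

theorem polySeminorm_X_le (h1 : ν 1 ≤ 1) : polySeminorm ν κ X ≤ κ := by
  rw [polySeminorm_def, sum_X_index (by simp)]
  simpa using mul_le_mul_of_nonneg_right h1 κ.2

theorem polySeminorm_one_le (h1 : ν 1 ≤ 1) : polySeminorm ν κ 1 ≤ 1 := by
  rw [← C_1, polySeminorm_C]; exact h1

theorem coeff_le_polySeminorm (p : R[X]) (i : ℕ) : ν (p.coeff i) * κ ^ i ≤ polySeminorm ν κ p := by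
  by_cases h : i ∈ p.support
  · rw [polySeminorm_def, Polynomial.sum_def]
    exact Finset.single_le_sum (f := fun i => ν (p.coeff i) * (κ : ℝ) ^ i)
      (fun i _ => mul_nonneg (apply_nonneg ν _) (by positivity)) h
  · rw [notMem_support_iff.mp h]
    simp

/-- The seminorm `ν(a) + κ ν(b)` on elements `a + b ω` with `ω² = g`. -/
noncomputable def quadSeminorm (ν : RingSeminorm R) (κ : NNReal) {g : R} (hg : ν g ≤ κ ^ 2) :
    RingSeminorm (QuadraticAlgebra R g 0) where
  toFun z := ν z.re + κ * ν z.im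
  map_zero' := by simp
  neg' z := by simp
  add_le' z w := by
    have h1 := map_add_le_add ν z.re w.re
    have h2 := mul_le_mul_of_nonneg_left (map_add_le_add ν z.im w.im) κ.coe_nonneg
    simp only [QuadraticAlgebra.re_add, QuadraticAlgebra.im_add]
    linarith
  mul_le' z w := by
    simp only [QuadraticAlgebra.re_mul, QuadraticAlgebra.im_mul, zero_mul, add_zero]
    have h1 : ν (z.re * w.re + g * z.im * w.im) ≤
        ν z.re * ν w.re + κ ^ 2 * ν z.im * ν w.im :=
      RingSeminorm.add_le_of_le ν (map_mul_le_mul ν _ _) (RingSeminorm.mul_le_of_le ν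
        (RingSeminorm.mul_le_of_le ν hg le_rfl) le_rfl)
    have h2 : ν (z.re * w.im + z.im * w.re) ≤ ν z.re * ν w.im + ν z.im * ν w.re :=
      RingSeminorm.add_le_of_le ν (map_mul_le_mul ν _ _) (map_mul_le_mul ν _ _)
    have h3 := mul_le_mul_of_nonneg_left h2 κ.coe_nonneg
    linarith

theorem quadSeminorm_def {g : R} (hg : ν g ≤ κ ^ 2) (z : QuadraticAlgebra R g 0) :
    quadSeminorm ν κ hg z = ν z.re + κ * ν z.im := rfl

@[simp] theorem quadSeminorm_C {g : R} (hg : ν g ≤ κ ^ 2) (a : R) :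
    quadSeminorm ν κ hg (.C a) = ν a := by
  simp [quadSeminorm_def]

/-- The ring homomorphism from `R[ω]`, `ω² = g`, determined by the image of `ω`. -/
def quadHom {S : Type*} [CommRing S] {g : R} (f : R →+* S) (s : S) (hs : s * s = f g) :
    QuadraticAlgebra R g 0 →+* S where
  toFun z := f z.re + f z.im * s
  map_one' := by
    change f 1 + f 0 * s = 1
    simp
  map_mul' z w := by
    simp only [QuadraticAlgebra.re_mul, QuadraticAlgebra.im_mul, zero_mul, add_zero, map_add,
      map_mul]
    linear_combination (-(f z.im * f w.im)) * hs
  map_zero' := by simp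
  map_add' z w := by
    simp only [QuadraticAlgebra.re_add, QuadraticAlgebra.im_add, map_add]
    ring

theorem quadHom_apply {S : Type*} [CommRing S] {g : R} (f : R →+* S) (s : S) (hs : s * s = f g)
    (z : QuadraticAlgebra R g 0) : quadHom f s hs z = f z.re + f z.im * s := rfl

/-- The seminorm `∑_{i ≤ w} ν(aᵢ) ρ^i` on power series. -/
noncomputable def truncSeminorm (ν : RingSeminorm R) (ρ : NNReal) (w : ℕ) :
    RingSeminorm (PowerSeries R) where
  toFun p := ∑ i ∈ Finset.range (w + 1), ν (PowerSeries.coeff i p) * (ρ : ℝ) ^ i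
  map_zero' := by simp
  neg' p := by simp
  add_le' p q := by
    rw [← Finset.sum_add_distrib]
    refine Finset.sum_le_sum fun i _ => ?_
    rw [map_add, ← add_mul]
    exact mul_le_mul_of_nonneg_right (map_add_le_add ν _ _) (by positivity)
  mul_le' p q := by
    rw [Finset.sum_mul_sum, ← Finset.sum_product']
    have h1 (i : ℕ) : ν (PowerSeries.coeff i (p * q)) * (ρ : ℝ) ^ i ≤
        ∑ x ∈ Finset.HasAntidiagonal.antidiagonal i, (ν (PowerSeries.coeff x.1 p) * (ρ : ℝ) ^ x.1) *
          (ν (PowerSeries.coeff x.2 q) * (ρ : ℝ) ^ x.2) := by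
      rw [PowerSeries.coeff_mul]
      refine (mul_le_mul_of_nonneg_right (RingSeminorm.sum_le ν _ _) (by positivity)).trans ?_
      rw [Finset.sum_mul]
      refine Finset.sum_le_sum fun x hx => ?_
      rw [← Finset.HasAntidiagonal.mem_antidiagonal.mp hx, pow_add]
      calc _ ≤ (ν (PowerSeries.coeff x.1 p) * ν (PowerSeries.coeff x.2 q)) * _ :=
            mul_le_mul_of_nonneg_right (map_mul_le_mul ν _ _) (by positivity)
        _ = _ := by ring
    refine (Finset.sum_le_sum fun i _ => h1 i).trans ?_
    have h2 : ∑ i ∈ Finset.range (w + 1), ∑ x ∈ Finset.HasAntidiagonal.antidiagonal i,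
        (ν (PowerSeries.coeff x.1 p) * (ρ : ℝ) ^ x.1) *
          (ν (PowerSeries.coeff x.2 q) * (ρ : ℝ) ^ x.2) =
        ∑ x ∈ (Finset.range (w + 1) ×ˢ Finset.range (w + 1)).filter fun x => x.1 + x.2 ≤ w,
          (ν (PowerSeries.coeff x.1 p) * (ρ : ℝ) ^ x.1) *
          (ν (PowerSeries.coeff x.2 q) * (ρ : ℝ) ^ x.2) := by
      rw [← Finset.sum_fiberwise_of_maps_to (g := fun x : ℕ × ℕ => x.1 + x.2)
        (t := Finset.range (w + 1))]
      · refine Finset.sum_congr rfl fun i hi => Finset.sum_congr ?_ fun _ _ => rfl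
        ext x
        simp only [Finset.HasAntidiagonal.mem_antidiagonal, Finset.mem_filter, Finset.mem_product,
          Finset.mem_range] at hi ⊢
        omega
      · intro x hx
        simp only [Finset.mem_filter, Finset.mem_range] at hx ⊢
        omega
    rw [h2]
    exact Finset.sum_le_sum_of_subset_of_nonneg (Finset.filter_subset _ _) fun x _ _ =>
      mul_nonneg (mul_nonneg (apply_nonneg ν _) (by positivity))
        (mul_nonneg (apply_nonneg ν _) (by positivity))

theorem truncSeminorm_def (w : ℕ) (p : PowerSeries R) : truncSeminorm ν κ w p =
    ∑ i ∈ Finset.range (w + 1), ν (PowerSeries.coeff i p) * (κ : ℝ) ^ i := rfl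

theorem coeff_le_truncSeminorm (w : ℕ) (p : PowerSeries R) :
    ν (PowerSeries.coeff w p) * (κ : ℝ) ^ w ≤ truncSeminorm ν κ w p :=
  Finset.single_le_sum (f := fun i => ν (PowerSeries.coeff i p) * (κ : ℝ) ^ i)
    (fun _ _ => mul_nonneg (apply_nonneg ν _) (by positivity))
    (Finset.mem_range.mpr w.lt_succ_self)

end Seminorms

end VojtaCurve

namespace VojtaCurve

open Polynomial

section Duplication

variable {R : Type*} [CommRing R]

/-- The polynomials `(A, B, G)` with `x(2 ^ k P) = A(x) / B(x)` and `y(2 ^ k P) = y G(x) / B(x) ^ 2`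
on the curve `y² = x³ + α x² + β x`. -/
noncomputable def dupl (α β : R) : ℕ → R[X] × R[X] × R[X]
  | 0 => (X, 1, 1)
  | k + 1 =>
    let A := (dupl α β k).1
    let B := (dupl α β k).2.1
    let G := (dupl α β k).2.2
    ((A ^ 2 - C β * B ^ 2) ^ 2, 4 * A * B * (A ^ 2 + C α * A * B + C β * B ^ 2),
      2 * (A ^ 2 - C β * B ^ 2) * (A ^ 4 + 2 * C α * A ^ 3 * B + 6 * C β * A ^ 2 * B ^ 2 +
        2 * C α * C β * A * B ^ 3 + C β ^ 2 * B ^ 4) * G)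

noncomputable def duplA (α β : R) (k : ℕ) : R[X] := (dupl α β k).1
noncomputable def duplB (α β : R) (k : ℕ) : R[X] := (dupl α β k).2.1
noncomputable def duplG (α β : R) (k : ℕ) : R[X] := (dupl α β k).2.2

variable (α β : R)

@[simp] theorem duplA_zero : duplA α β 0 = X := rfl
@[simp] theorem duplB_zero : duplB α β 0 = 1 := rfl
@[simp] theorem duplG_zero : duplG α β 0 = 1 := rfl

theorem duplA_succ (k : ℕ) :
    duplA α β (k + 1) = (duplA α β k ^ 2 - C β * duplB α β k ^ 2) ^ 2 := rfl

theorem duplB_succ (k : ℕ) : duplB α β (k + 1) = 4 * duplA α β k * duplB α β k *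
    (duplA α β k ^ 2 + C α * duplA α β k * duplB α β k + C β * duplB α β k ^ 2) := rfl

theorem duplG_succ (k : ℕ) : duplG α β (k + 1) =
    2 * (duplA α β k ^ 2 - C β * duplB α β k ^ 2) *
      (duplA α β k ^ 4 + 2 * C α * duplA α β k ^ 3 * duplB α β k +
        6 * C β * duplA α β k ^ 2 * duplB α β k ^ 2 +
        2 * C α * C β * duplA α β k * duplB α β k ^ 3 + C β ^ 2 * duplB α β k ^ 4) *
      duplG α β k := rfl

/-- The cubic `x³ + α x² + β x`. -/
noncomputable def cubic : R[X] := X ^ 3 + C α * X ^ 2 + C β * X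

theorem duplB_curve (k : ℕ) : duplA α β k * duplB α β k *
    (duplA α β k ^ 2 + C α * duplA α β k * duplB α β k + C β * duplB α β k ^ 2) =
    cubic α β * duplG α β k ^ 2 := by
  induction k with
  | zero => simp [cubic]; ring
  | succ k ih =>
    rw [duplA_succ, duplB_succ, duplG_succ]
    linear_combination (4 * (duplA α β k ^ 2 - C β * duplB α β k ^ 2) ^ 2 *
      (duplA α β k ^ 4 + 2 * C α * duplA α β k ^ 3 * duplB α β k +
        6 * C β * duplA α β k ^ 2 * duplB α β k ^ 2 +
        2 * C α * C β * duplA α β k * duplB α β k ^ 3 + C β ^ 2 * duplB α β k ^ 4) ^ 2) * ih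

theorem duplB_succ' (k : ℕ) : duplB α β (k + 1) = 4 * cubic α β * duplG α β k ^ 2 := by
  rw [duplB_succ]
  linear_combination 4 * duplB_curve α β k

theorem cubic_natDegree_le : (cubic α β).natDegree ≤ 3 := by
  unfold cubic
  compute_degree

theorem cubic_monic : (cubic α β).Monic := by
  unfold cubic
  monicity!

theorem cubic_natDegree [Nontrivial R] : (cubic α β).natDegree = 3 := by
  unfold cubic
  compute_degree!

theorem dupl_degree [Nontrivial R] (k : ℕ) :
    (duplA α β k).Monic ∧ (duplA α β k).natDegree = 4 ^ k ∧
      (duplB α β k).natDegree < 4 ^ k ∧ (duplG α β k).natDegree + 2 ≤ 2 * 4 ^ k := by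
  induction k with
  | zero => simp [monic_X]
  | succ k ih =>
    obtain ⟨hA, hAd, hB, hG⟩ := ih
    set A := duplA α β k with hAdef
    set B := duplB α β k with hBdef
    set n := 4 ^ k with hn
    have hsq : (A ^ 2 - C β * B ^ 2).Monic ∧ (A ^ 2 - C β * B ^ 2).natDegree = 2 * n := by
      have h2 : (A ^ 2).Monic := hA.pow 2
      have h3 : (A ^ 2).natDegree = 2 * n := by rw [hA.natDegree_pow, hAd]
      have h4 : (C β * B ^ 2).natDegree < (A ^ 2).natDegree := by
        refine (natDegree_C_mul_le _ _).trans_lt (natDegree_pow_le.trans_lt ?_)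
        omega
      have h5 := degree_lt_degree h4
      exact ⟨h2.sub_of_left h5, by rw [natDegree_sub_eq_left_of_natDegree_lt h4, h3]⟩
    have hC (c : R) : (C c).natDegree ≤ 0 := (natDegree_C c).le
    have hB' : B.natDegree ≤ n - 1 := by omega
    have hA' : A.natDegree ≤ n := hAd.le
    have hn1 : 1 ≤ n := Nat.one_le_pow _ _ (by norm_num)
    refine ⟨?_, ?_, ?_, ?_⟩
    · rw [duplA_succ]; exact hsq.1.pow 2
    · rw [duplA_succ, hsq.1.natDegree_pow, hsq.2]; ring
    · rw [duplB_succ']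
      have : (4 * cubic α β * duplG α β k ^ 2).natDegree ≤ 0 + 3 + 2 * (2 * n - 2) := by
        refine natDegree_mul_le_of_le (natDegree_mul_le_of_le ?_ (cubic_natDegree_le α β))
          (natDegree_pow_le_of_le 2 (by omega))
        exact (natDegree_ofNat 4).le
      rw [pow_succ 4 k]
      omega
    · rw [duplG_succ, ← hAdef, ← hBdef]
      have h6 : ∀ i j, i + j = 4 → ∀ c : R[X], c.natDegree ≤ 0 →
          (c * A ^ i * B ^ j).natDegree ≤ 4 * n := by
        intro i j hij c hc
        have : (c * A ^ i * B ^ j).natDegree ≤ 0 + i * n + j * (n - 1) :=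
          natDegree_mul_le_of_le (natDegree_mul_le_of_le hc (natDegree_pow_le_of_le i hA'))
            (natDegree_pow_le_of_le j hB')
        refine this.trans ?_
        have : j * (n - 1) ≤ j * n := Nat.mul_le_mul_left _ (by omega)
        calc 0 + i * n + j * (n - 1) ≤ (i + j) * n := by rw [add_mul]; omega
          _ = 4 * n := by rw [hij]
      have h7 : (A ^ 4 + 2 * C α * A ^ 3 * B + 6 * C β * A ^ 2 * B ^ 2 +
          2 * C α * C β * A * B ^ 3 + C β ^ 2 * B ^ 4).natDegree ≤ 4 * n := by
        refine natDegree_add_le_of_degree_le (natDegree_add_le_of_degree_le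
          (natDegree_add_le_of_degree_le (natDegree_add_le_of_degree_le ?_ ?_) ?_) ?_) ?_
        · simpa using h6 4 0 rfl 1 (by simp)
        · simpa using h6 3 1 rfl (2 * C α) (by compute_degree)
        · exact h6 2 2 rfl (6 * C β) (by compute_degree)
        · simpa using h6 1 3 rfl (2 * C α * C β) (by compute_degree)
        · simpa using h6 0 4 rfl (C β ^ 2) (by compute_degree)
      have : (2 * (A ^ 2 - C β * B ^ 2) * (A ^ 4 + 2 * C α * A ^ 3 * B +
          6 * C β * A ^ 2 * B ^ 2 + 2 * C α * C β * A * B ^ 3 + C β ^ 2 * B ^ 4) *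
          duplG α β k).natDegree ≤ 0 + 2 * n + 4 * n + (2 * n - 2) :=
        natDegree_mul_le_of_le (natDegree_mul_le_of_le (natDegree_mul_le_of_le
          (natDegree_ofNat 2).le hsq.2.le) h7) (by omega)
      rw [pow_succ 4 k]
      omega

theorem duplG_ne_zero [IsDomain R] [CharZero R] (k : ℕ) : duplG α β k ≠ 0 := by
  induction k with
  | zero => simp
  | succ k ih =>
    obtain ⟨hA, hAd, hB, hG⟩ := dupl_degree α β k
    obtain ⟨hA1, -⟩ := dupl_degree α β (k + 1)
    rw [duplA_succ] at hA1
    rw [duplG_succ]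
    refine mul_ne_zero (mul_ne_zero (mul_ne_zero two_ne_zero fun h => ?_) fun h => ?_) ih
    · rw [h] at hA1
      simp at hA1
    · set A := duplA α β k
      set B := duplB α β k
      set n := 4 ^ k
      have h1 : A ^ 4 = B * -(2 * C α * A ^ 3 + 6 * C β * A ^ 2 * B +
        2 * C α * C β * A * B ^ 2 + C β ^ 2 * B ^ 3) := by linear_combination h
      have h2 : (A ^ 4).natDegree = 4 * n := by rw [hA.natDegree_pow, hAd]
      have hA' : A.natDegree ≤ n := hAd.le
      have hB' : B.natDegree ≤ n := hB.le
      have h6 : ∀ i j, i + j = 3 → ∀ c : R[X], c.natDegree ≤ 0 →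
          (c * A ^ i * B ^ j).natDegree ≤ 3 * n := by
        intro i j hij c hc
        have : (c * A ^ i * B ^ j).natDegree ≤ 0 + i * n + j * n :=
          natDegree_mul_le_of_le (natDegree_mul_le_of_le hc (natDegree_pow_le_of_le i hA'))
            (natDegree_pow_le_of_le j hB')
        refine this.trans ?_
        rw [zero_add, ← add_mul, hij]
      have h7 : (-(2 * C α * A ^ 3 + 6 * C β * A ^ 2 * B +
        2 * C α * C β * A * B ^ 2 + C β ^ 2 * B ^ 3)).natDegree ≤ 3 * n := by
        rw [natDegree_neg]
        refine natDegree_add_le_of_degree_le (natDegree_add_le_of_degree_le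
          (natDegree_add_le_of_degree_le ?_ ?_) ?_) ?_
        · simpa using h6 3 0 rfl (2 * C α) (by compute_degree)
        · simpa using h6 2 1 rfl (6 * C β) (by compute_degree)
        · simpa using h6 1 2 rfl (2 * C α * C β) (by compute_degree)
        · simpa using h6 0 3 rfl (C β ^ 2) (by compute_degree)
      have h8 := natDegree_mul_le_of_le hB.le h7
      have h9 : (B * -(2 * C α * A ^ 3 + 6 * C β * A ^ 2 * B +
        2 * C α * C β * A * B ^ 2 + C β ^ 2 * B ^ 3)).natDegree ≤ B.natDegree + 3 * n :=
        natDegree_mul_le_of_le le_rfl h7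
      rw [← h1, h2] at h9
      omega

theorem duplB_ne_zero [IsDomain R] [CharZero R] (k : ℕ) : duplB α β k ≠ 0 := by
  cases k with
  | zero => simp
  | succ k =>
    rw [duplB_succ']
    exact mul_ne_zero (mul_ne_zero (OfNat.ofNat_ne_zero 4) (cubic_monic α β).ne_zero)
      (pow_ne_zero _ (duplG_ne_zero α β k))

theorem dupl_no_common_zero {L : Type*} [Field L] [CharZero L] (φ : R →+* L)
    (hβ : φ β ≠ 0) (hd : φ α ^ 2 ≠ 4 * φ β) (z : L) (k : ℕ) :
    ¬ ((duplA α β k).eval₂ φ z = 0 ∧ (duplB α β k).eval₂ φ z = 0) := by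
  induction k with
  | zero => simp
  | succ k ih =>
    rintro ⟨h1, h2⟩
    apply ih
    rw [duplA_succ] at h1
    rw [duplB_succ] at h2
    simp only [eval₂_mul, eval₂_add, eval₂_sub, eval₂_pow, eval₂_C, eval₂_ofNat] at h1 h2
    set a := (duplA α β k).eval₂ φ z
    set b := (duplB α β k).eval₂ φ z
    have h1' : a ^ 2 = φ β * b ^ 2 := by
      have := pow_eq_zero_iff (two_ne_zero) |>.mp h1
      linear_combination this
    by_cases hb : b = 0
    · rw [hb] at h1'
      refine ⟨?_, hb⟩
      have : a ^ 2 = 0 := by rw [h1']; ring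
      exact pow_eq_zero_iff two_ne_zero |>.mp this
    · exfalso
      have ha : a ≠ 0 := by
        rintro ha
        rw [ha] at h1'
        have : φ β * b ^ 2 ≠ 0 := mul_ne_zero hβ (pow_ne_zero _ hb)
        exact this (by rw [← h1']; ring)
      have h3 : a ^ 2 + φ α * a * b + φ β * b ^ 2 = 0 := by
        rcases mul_eq_zero.mp h2 with h | h
        · exact absurd h (mul_ne_zero (mul_ne_zero (OfNat.ofNat_ne_zero 4) ha) hb)
        · exact h
      have h4 : φ α * a = - 2 * φ β * b := by
        apply mul_right_cancel₀ hb
        linear_combination h3 - h1'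
      apply hd
      have h5 : φ β * b ^ 2 ≠ 0 := mul_ne_zero hβ (pow_ne_zero _ hb)
      apply mul_right_cancel₀ h5
      linear_combination -φ α ^ 2 * h1' + (φ α * a - 2 * φ β * b) * h4

theorem dupl_seminorm_le (ν : RingSeminorm R[X]) (h1 : ν 1 ≤ 1) {c : ℝ} (hc : 1 ≤ c)
    (hα : ν (C α) ≤ c) (hβ : ν (C β) ≤ c) (hX : ν X ≤ c) (k : ℕ) :
    4 * c * ν (duplA α β k) ≤ (4 * c ^ 2) ^ 4 ^ k ∧ 4 * c * ν (duplB α β k) ≤ (4 * c ^ 2) ^ 4 ^ k ∧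
      ν (duplG α β k) ≤ (4 * c ^ 2) ^ (2 * 4 ^ k) := by
  have h2 : ν (2 : R[X]) ≤ 2 := mod_cast RingSeminorm.natCast_le ν h1 2
  have h4 : ν (4 : R[X]) ≤ 4 := mod_cast RingSeminorm.natCast_le ν h1 4
  have h6 : ν (6 : R[X]) ≤ 6 := mod_cast RingSeminorm.natCast_le ν h1 6
  induction k with
  | zero =>
    simp only [duplA_zero, duplB_zero, duplG_zero, pow_zero, pow_one, mul_one]
    refine ⟨by nlinarith, by nlinarith, h1.trans ?_⟩
    exact one_le_pow₀ (by nlinarith)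
  | succ k ih =>
    obtain ⟨hA, hB, hG⟩ := ih
    set T := (4 * c ^ 2) ^ 4 ^ k with hT
    set τ := T / (4 * c) with hτ
    have hc4 : 0 < 4 * c := by linarith
    have hτT : 4 * c * τ = T := by rw [hτ]; field_simp
    have hA' : ν (duplA α β k) ≤ τ := by rw [hτ, le_div_iff₀ hc4]; linarith
    have hB' : ν (duplB α β k) ≤ τ := by rw [hτ, le_div_iff₀ hc4]; linarith
    have hG' : ν (duplG α β k) ≤ T ^ 2 := by
      rwa [hT, ← pow_mul, mul_comm (4 ^ k)]
    have hτ0 : 0 ≤ τ := (apply_nonneg ν _).trans hA'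
    set A := duplA α β k
    set B := duplB α β k
    have sq : ν (A ^ 2 - C β * B ^ 2) ≤ τ ^ 2 + c * τ ^ 2 :=
      RingSeminorm.sub_le_of_le ν (RingSeminorm.pow_le_of_le ν h1 hA' 2)
        (RingSeminorm.mul_le_of_le ν hβ (RingSeminorm.pow_le_of_le ν h1 hB' 2))
    have p (x : R[X]) {y : ℝ} (h : ν x ≤ y) (m : ℕ) := RingSeminorm.pow_le_of_le ν h1 h m
    have m {x y : R[X]} {a b : ℝ} (hx : ν x ≤ a) (hy : ν y ≤ b) :=
      RingSeminorm.mul_le_of_le ν hx hy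
    have a {x y : R[X]} {a b : ℝ} (hx : ν x ≤ a) (hy : ν y ≤ b) :=
      RingSeminorm.add_le_of_le ν hx hy
    have e1 : (4 * c ^ 2) ^ 4 ^ (k + 1) = T ^ 4 := by rw [hT, ← pow_mul, pow_succ 4 k]
    have e2 : (4 * c ^ 2) ^ (2 * 4 ^ (k + 1)) = T ^ 8 := by
      rw [hT, ← pow_mul]; congr 1; ring
    rw [e1, e2, ← hτT, duplA_succ, duplB_succ, duplG_succ]
    have c2 : c ≤ c ^ 2 := by nlinarith
    refine ⟨?_, ?_, ?_⟩
    · have := p _ sq 2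
      have h3 : (τ ^ 2 + c * τ ^ 2) ^ 2 ≤ 4 * c ^ 2 * τ ^ 4 := by
        have : τ ^ 2 + c * τ ^ 2 ≤ 2 * c * τ ^ 2 := by nlinarith [sq_nonneg τ]
        calc _ ≤ (2 * c * τ ^ 2) ^ 2 := pow_le_pow_left₀ (by positivity) this 2
          _ = _ := by ring
      calc _ ≤ 4 * c * (4 * c ^ 2 * τ ^ 4) := by gcongr; exact this.trans h3
        _ = 16 * c ^ 3 * τ ^ 4 := by ring
        _ ≤ 256 * c ^ 4 * τ ^ 4 := by
          gcongr ?_ * _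
          have : c ^ 3 ≤ c ^ 4 := pow_le_pow_right₀ hc (by norm_num)
          have : 0 ≤ c ^ 3 := by positivity
          linarith
        _ = _ := by ring
    · have := m (m (m h4 hA') hB') (a (a (p _ hA' 2) (m (m hα hA') hB')) (m hβ (p _ hB' 2)))
      have h3 : τ ^ 2 + c * τ * τ + c * τ ^ 2 ≤ 3 * c * τ ^ 2 := by nlinarith [sq_nonneg τ]
      calc _ ≤ 4 * c * (4 * τ * τ * (3 * c * τ ^ 2)) := by
            gcongr
            exact this.trans (by gcongr)
        _ = 48 * c ^ 2 * τ ^ 4 := by ring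
        _ ≤ 256 * c ^ 4 * τ ^ 4 := by
          gcongr ?_ * _
          have : c ^ 2 ≤ c ^ 4 := pow_le_pow_right₀ hc (by norm_num)
          have : 0 ≤ c ^ 2 := by positivity
          linarith
        _ = _ := by ring
    · have := m (m (m h2 sq) (a (a (a (a (p _ hA' 4) (m (m (m h2 hα) (p _ hA' 3)) hB'))
        (m (m (m h6 hβ) (p _ hA' 2)) (p _ hB' 2))) (m (m (m (m h2 hα) hβ) hA') (p _ hB' 3)))
        (m (p _ hβ 2) (p _ hB' 4)))) hG'
      have h3 : τ ^ 2 + c * τ ^ 2 ≤ 2 * c * τ ^ 2 := by nlinarith [sq_nonneg τ]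
      have h5 : τ ^ 4 + 2 * c * τ ^ 3 * τ + 6 * c * τ ^ 2 * τ ^ 2 + 2 * c * c * τ * τ ^ 3 +
          c ^ 2 * τ ^ 4 ≤ 12 * c ^ 2 * τ ^ 4 := by
        have : 0 ≤ τ ^ 4 := by positivity
        have h1c : 1 ≤ c ^ 2 := one_le_pow₀ hc
        nlinarith
      refine this.trans ?_
      rw [← hτT]
      calc _ ≤ 2 * (2 * c * τ ^ 2) * (12 * c ^ 2 * τ ^ 4) * (4 * c * τ) ^ 2 := by gcongr
        _ = 48 * c ^ 3 * (τ ^ 6 * (4 * c * τ) ^ 2) := by ring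
        _ ≤ 4096 * c ^ 6 * (τ ^ 6 * (4 * c * τ) ^ 2) := by
          gcongr ?_ * _
          have : c ^ 3 ≤ c ^ 6 := pow_le_pow_right₀ hc (by norm_num)
          have : 0 ≤ c ^ 3 := by positivity
          linarith
        _ = _ := by ring

end Duplication

end VojtaCurve

namespace VojtaCurve

open Polynomial WeierstrassCurve

section Curve

variable {K : Type*} [Field K]

/-- The Weierstrass curve `y² = x³ + α x² + β x`. -/
def ell (α β : K) : WeierstrassCurve.Affine K := ⟨0, α, 0, β, 0⟩

variable {α β : K}

theorem ell_Δ : (ell α β).Δ = 16 * β ^ 2 * (α ^ 2 - 4 * β) := by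
  simp only [WeierstrassCurve.Δ, WeierstrassCurve.b₂, WeierstrassCurve.b₄, WeierstrassCurve.b₆,
    WeierstrassCurve.b₈, ell]
  ring

theorem ell_equation_iff {x y : K} :
    (ell α β).Equation x y ↔ y ^ 2 = x ^ 3 + α * x ^ 2 + β * x := by
  rw [Affine.equation_iff]
  simp [ell]

theorem ell_nonsingular_equation {x y : K} (h : (ell α β).Nonsingular x y) :
    y ^ 2 = x ^ 3 + α * x ^ 2 + β * x := ell_equation_iff.mp h.1

@[simp] theorem ell_negY (x y : K) : (ell α β).negY x y = -y := by
  simp [Affine.negY, ell]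

theorem exists_some_congr {P : (ell α β).Point} {a b a' b' : K}
    (h : ∃ h, P = .some a b h) (ha : a = a') (hb : b = b') : ∃ h, P = .some a' b' h := by
  subst ha hb
  exact h

variable [CharZero K]

theorem ell_isElliptic (hβ : β ≠ 0) (hd : α ^ 2 ≠ 4 * β) : (ell α β).IsElliptic := by
  rw [WeierstrassCurve.isElliptic_iff, ell_Δ, isUnit_iff_ne_zero]
  exact mul_ne_zero (mul_ne_zero (by norm_num) (pow_ne_zero _ hβ)) (sub_ne_zero.mpr hd)

theorem ell_nonsingular (hβ : β ≠ 0) (hd : α ^ 2 ≠ 4 * β) {x y : K}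
    (h : y ^ 2 = x ^ 3 + α * x ^ 2 + β * x) : (ell α β).Nonsingular x y := by
  have := ell_isElliptic hβ hd
  exact Affine.equation_iff_nonsingular.mp (ell_equation_iff.mpr h)

variable [DecidableEq K]

omit [CharZero K] in
theorem ell_add_of_X_ne {x₁ y₁ x₂ y₂ : K} {h₁ : (ell α β).Nonsingular x₁ y₁}
    {h₂ : (ell α β).Nonsingular x₂ y₂} (hx : x₁ ≠ x₂) :
    ∃ h, Affine.Point.some x₁ y₁ h₁ + .some x₂ y₂ h₂ = .some
      (((y₁ - y₂) / (x₁ - x₂)) ^ 2 - α - x₁ - x₂)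
      (-((y₁ - y₂) / (x₁ - x₂) * (((y₁ - y₂) / (x₁ - x₂)) ^ 2 - α - x₁ - x₂ - x₁) + y₁)) h := by
  have hs := Affine.slope_of_X_ne (W := ell α β) (y₁ := y₁) (y₂ := y₂) hx
  have e1 : (ell α β).addX x₁ x₂ ((ell α β).slope x₁ x₂ y₁ y₂) =
      ((y₁ - y₂) / (x₁ - x₂)) ^ 2 - α - x₁ - x₂ := by
    rw [hs]; simp [Affine.addX, ell]
  have e2 : (ell α β).addY x₁ x₂ y₁ ((ell α β).slope x₁ x₂ y₁ y₂) =
      -((y₁ - y₂) / (x₁ - x₂) * (((y₁ - y₂) / (x₁ - x₂)) ^ 2 - α - x₁ - x₂ - x₁) + y₁) := by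
    rw [Affine.addY, Affine.negAddY, e1, hs, ell_negY]
  have := Affine.Point.add_of_X_ne (h₁ := h₁) (h₂ := h₂) hx
  exact exists_some_congr ⟨_, this⟩ e1 e2

theorem ell_add_self_of_Y_ne {x y : K} {h : (ell α β).Nonsingular x y} (hy : y ≠ 0) :
    ∃ h', Affine.Point.some x y h + .some x y h = .some
      (((3 * x ^ 2 + 2 * α * x + β) / (2 * y)) ^ 2 - α - x - x)
      (-((3 * x ^ 2 + 2 * α * x + β) / (2 * y) *
        (((3 * x ^ 2 + 2 * α * x + β) / (2 * y)) ^ 2 - α - x - x - x) + y)) h' := by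
  have hy' : y ≠ (ell α β).negY x y := by
    rw [ell_negY]
    intro h
    apply hy
    have : 2 * y = 0 := by linear_combination h
    simpa using this
  have hs : (ell α β).slope x x y y = (3 * x ^ 2 + 2 * α * x + β) / (2 * y) := by
    rw [Affine.slope_of_Y_ne rfl hy', ell_negY]
    simp [ell]
    ring
  have e1 : (ell α β).addX x x ((ell α β).slope x x y y) =
      ((3 * x ^ 2 + 2 * α * x + β) / (2 * y)) ^ 2 - α - x - x := by
    rw [hs]; simp [Affine.addX, ell]
  have e2 : (ell α β).addY x x y ((ell α β).slope x x y y) =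
      (-((3 * x ^ 2 + 2 * α * x + β) / (2 * y) *
        (((3 * x ^ 2 + 2 * α * x + β) / (2 * y)) ^ 2 - α - x - x - x) + y)) := by
    rw [Affine.addY, Affine.negAddY, e1, hs, ell_negY]
  have := Affine.Point.add_self_of_Y_ne (h₁ := h) hy'
  exact exists_some_congr ⟨_, this⟩ e1 e2

omit [CharZero K] in
theorem ell_add_self_of_Y_eq {x : K} {h : (ell α β).Nonsingular x 0} :
    Affine.Point.some x 0 h + .some x 0 h = 0 :=
  Affine.Point.add_self_of_Y_eq (by rw [ell_negY, neg_zero])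

omit [DecidableEq K] [CharZero K] in
theorem ell_neg_some {x y : K} (h : (ell α β).Nonsingular x y) :
    ∃ h', -Affine.Point.some x y h = .some x (-y) h' := by
  have := Affine.Point.neg_some h
  exact exists_some_congr ⟨_, this⟩ rfl (ell_negY _ _)

/-- Duplication in terms of the coordinates. -/
theorem ell_double {x y : K} {h : (ell α β).Nonsingular x y} (hy : y ≠ 0) :
    ∃ h', Affine.Point.some x y h + .some x y h = .some ((x ^ 2 - β) ^ 2 / (4 * y ^ 2))
      ((x ^ 2 - β) * (x ^ 4 + 2 * α * x ^ 3 + 6 * β * x ^ 2 + 2 * α * β * x + β ^ 2) /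
        (8 * y ^ 3)) h' := by
  obtain ⟨h', e⟩ := ell_add_self_of_Y_ne (h := h) hy
  have hE := ell_nonsingular_equation h
  have e1 : ((3 * x ^ 2 + 2 * α * x + β) / (2 * y)) ^ 2 - α - x - x =
      (x ^ 2 - β) ^ 2 / (4 * y ^ 2) := by
    field_simp
    linear_combination (-16 * α - 32 * x) * hE
  have e2 : (-((3 * x ^ 2 + 2 * α * x + β) / (2 * y) *
        (((3 * x ^ 2 + 2 * α * x + β) / (2 * y)) ^ 2 - α - x - x - x) + y)) =
      ((x ^ 2 - β) * (x ^ 4 + 2 * α * x ^ 3 + 6 * β * x ^ 2 + 2 * α * β * x + β ^ 2) /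
        (8 * y ^ 3)) := by
    rw [e1]
    field_simp
    linear_combination 32 * (x ^ 3 - β * x - 2 * y ^ 2) * hE
  exact exists_some_congr ⟨_, e⟩ e1 e2

theorem ell_two_pow_nsmul {x y : K} (h : (ell α β).Nonsingular x y) (k : ℕ) :
    ((duplB α β k).eval x = 0 → (2 ^ k) • Affine.Point.some x y h = 0) ∧
    ((duplB α β k).eval x ≠ 0 → ∃ h', (2 ^ k) • Affine.Point.some x y h =
      .some ((duplA α β k).eval x / (duplB α β k).eval x)
        (y * (duplG α β k).eval x / (duplB α β k).eval x ^ 2) h') := by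
  induction k with
  | zero => simp [h]
  | succ k ih =>
    have hE := ell_nonsingular_equation h
    have hcurve := congrArg (eval x) (duplB_curve α β k)
    simp only [cubic, eval_mul, eval_add, eval_pow, eval_C, eval_X] at hcurve
    rw [← hE] at hcurve
    have eA := congrArg (eval x) (duplA_succ α β k)
    have eB := congrArg (eval x) (duplB_succ α β k)
    have eG := congrArg (eval x) (duplG_succ α β k)
    simp only [eval_mul, eval_add, eval_sub, eval_pow, eval_C, eval_ofNat] at eA eB eG
    have hdbl : 2 ^ (k + 1) • Affine.Point.some x y h =
        2 ^ k • Affine.Point.some x y h + 2 ^ k • Affine.Point.some x y h := by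
      rw [pow_succ, mul_nsmul, two_nsmul]
    rw [hdbl]
    set a := (duplA α β k).eval x
    set b := (duplB α β k).eval x
    set g := (duplG α β k).eval x
    obtain ⟨ih0, ih1⟩ := ih
    have hb' : eval x (duplB α β (k + 1)) = 4 * (y * g) ^ 2 := by
      rw [eB]
      linear_combination 4 * hcurve
    by_cases hb : b = 0
    · refine ⟨fun _ => by rw [ih0 hb, add_zero], fun h => (h ?_).elim⟩
      rw [eB, hb]; ring
    · obtain ⟨h', e⟩ := ih1 hb
      rw [e]
      by_cases hg : y * g = 0
      · refine ⟨fun _ => ?_, fun h => (h (by rw [hb', hg]; ring)).elim⟩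
        have : y * g / b ^ 2 = 0 := by rw [hg, zero_div]
        generalize_proofs at *
        revert h'
        rw [this]
        intro h' _
        exact ell_add_self_of_Y_eq
      · refine ⟨fun h => (hg (by simpa [hb'] using h)).elim, fun _ => ?_⟩
        obtain ⟨h'', e'⟩ := ell_double (h := h') (div_ne_zero hg (pow_ne_zero _ hb))
        have hy : y ≠ 0 := left_ne_zero_of_mul hg
        have hg' : g ≠ 0 := right_ne_zero_of_mul hg
        have e1 : ((a / b) ^ 2 - β) ^ 2 / (4 * (y * g / b ^ 2) ^ 2) =
            (a ^ 2 - β * b ^ 2) ^ 2 / (4 * (y * g) ^ 2) := by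
          field_simp
        have e2 : ((a / b) ^ 2 - β) * ((a / b) ^ 4 + 2 * α * (a / b) ^ 3 + 6 * β * (a / b) ^ 2 +
            2 * α * β * (a / b) + β ^ 2) / (8 * (y * g / b ^ 2) ^ 3) =
            y * (2 * (a ^ 2 - β * b ^ 2) * (a ^ 4 + 2 * α * a ^ 3 * b + 6 * β * a ^ 2 * b ^ 2 +
              2 * α * β * a * b ^ 3 + β ^ 2 * b ^ 4) * g) / (4 * (y * g) ^ 2) ^ 2 := by
          field_simp
          ring
        exact exists_some_congr ⟨_, e'⟩ (e1.trans (by rw [eA, hb'])) (e2.trans (by rw [hb', eG]))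

end Curve

end VojtaCurve

namespace VojtaCurve

open Polynomial WeierstrassCurve Height

section EllHeight

variable {K : Type*} [Field K] [DecidableEq K] {α β : K}

omit [DecidableEq K] in
theorem ell_addSubMap_eval (x : Fin 3 → K) :
    (fun i => (addSubMap (ell α β) i).eval x) = ![(x 0 - β * x 2) ^ 2,
      2 * x 1 * x 0 + 4 * α * x 0 * x 2 + 2 * β * x 1 * x 2, x 1 ^ 2 - 4 * x 0 * x 2] := by
  ext i
  (fin_cases i) <;>
    simp [addSubMap, WeierstrassCurve.b₂, WeierstrassCurve.b₄, WeierstrassCurve.b₆,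
    WeierstrassCurve.b₈, ell] <;> ring

theorem ell_sym2x_add_sub [CharZero K] (hβ : β ≠ 0) (hd : α ^ 2 ≠ 4 * β)
    (P Q : (ell α β).Point) : ∃ c : K, c ≠ 0 ∧
      (fun i => (addSubMap (ell α β) i).eval (P.sym2x Q)) = c • (P + Q).sym2x (P - Q) := by
  rw [ell_addSubMap_eval]
  rcases P with _ | ⟨x₁, y₁, h₁⟩
  · rw [← Affine.Point.zero_def, zero_add, zero_sub, Affine.Point.sym2x_neg_right]
    rcases Q with _ | ⟨x₂, y₂, h₂⟩
    · refine ⟨1, one_ne_zero, ?_⟩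
      rw [← Affine.Point.zero_def]
      simp
    · refine ⟨1, one_ne_zero, ?_⟩
      simp
      ring_nf
      simp
  rcases Q with _ | ⟨x₂, y₂, h₂⟩
  · refine ⟨1, one_ne_zero, ?_⟩
    rw [← Affine.Point.zero_def, add_zero, sub_zero]
    simp
    ring_nf
    simp
  have hE₁ := ell_nonsingular_equation h₁
  have hE₂ := ell_nonsingular_equation h₂
  by_cases hx : x₁ = x₂
  · subst hx
    have key : ∃ c : K, c ≠ 0 ∧ ![(x₁ ^ 2 - β) ^ 2, 4 * y₁ ^ 2, 0] =
        c • (Affine.Point.some x₁ y₁ h₁ + .some x₁ y₁ h₁).sym2x 0 := by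
      by_cases hy : y₁ = 0
      · subst hy
        rw [ell_add_self_of_Y_eq]
        refine ⟨(x₁ ^ 2 - β) ^ 2, pow_ne_zero _ fun h => ?_, by simp⟩
        have hx0 : x₁ ≠ 0 := by
          rintro rfl
          apply hβ
          linear_combination -h
        have h3 : α * x₁ = -2 * β := by
          apply mul_left_cancel₀ hx0
          linear_combination -hE₁ - x₁ * h
        apply hd
        apply mul_right_cancel₀ hβ
        linear_combination -α ^ 2 * h + (α * x₁ - 2 * β) * h3
      · obtain ⟨h', e⟩ := ell_double (h := h₁) hy
        rw [e]
        refine ⟨4 * y₁ ^ 2, mul_ne_zero (by norm_num) (pow_ne_zero _ hy), ?_⟩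
        have : 4 * y₁ ^ 2 * ((x₁ ^ 2 - β) ^ 2 / (4 * y₁ ^ 2)) = (x₁ ^ 2 - β) ^ 2 := by
          field_simp
        simp [this]
    have e1 : ![((Affine.Point.some x₁ y₁ h₁).sym2x (.some x₁ y₂ h₂) 0 -
        β * (Affine.Point.some x₁ y₁ h₁).sym2x (.some x₁ y₂ h₂) 2) ^ 2,
        2 * (Affine.Point.some x₁ y₁ h₁).sym2x (.some x₁ y₂ h₂) 1 *
          (Affine.Point.some x₁ y₁ h₁).sym2x (.some x₁ y₂ h₂) 0 +
        4 * α * (Affine.Point.some x₁ y₁ h₁).sym2x (.some x₁ y₂ h₂) 0 *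
          (Affine.Point.some x₁ y₁ h₁).sym2x (.some x₁ y₂ h₂) 2 +
        2 * β * (Affine.Point.some x₁ y₁ h₁).sym2x (.some x₁ y₂ h₂) 1 *
          (Affine.Point.some x₁ y₁ h₁).sym2x (.some x₁ y₂ h₂) 2,
        (Affine.Point.some x₁ y₁ h₁).sym2x (.some x₁ y₂ h₂) 1 ^ 2 -
          4 * (Affine.Point.some x₁ y₁ h₁).sym2x (.some x₁ y₂ h₂) 0 *
          (Affine.Point.some x₁ y₁ h₁).sym2x (.some x₁ y₂ h₂) 2] =
        ![(x₁ ^ 2 - β) ^ 2, 4 * y₁ ^ 2, 0] := by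
      ext i
      fin_cases i
      · simp; ring
      · simp only [Affine.Point.sym2x_some_some]
        simp
        linear_combination -4 * hE₁
      · simp; ring
    rw [e1]
    obtain ⟨c, hc, e⟩ := key
    refine ⟨c, hc, ?_⟩
    rw [e]
    congr 1
    rcases Affine.Point.X_eq_iff (h₁ := h₁) (h₂ := h₂) |>.mp rfl with h | h
    · rw [← h, sub_self]
    · rw [h, neg_add_cancel, Affine.Point.sym2x_comm, ← neg_add', Affine.Point.sym2x_neg_right,
        ← neg_add, Affine.Point.sym2x_neg_right]
  · have hx' : x₁ - x₂ ≠ 0 := sub_ne_zero.mpr hx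
    obtain ⟨h₃, e₃⟩ := ell_add_of_X_ne (h₁ := h₁) (h₂ := h₂) hx
    obtain ⟨h₂', e₂⟩ := ell_neg_some h₂
    obtain ⟨h₄, e₄⟩ := ell_add_of_X_ne (h₁ := h₁) (h₂ := h₂') hx
    have hsub : Affine.Point.some x₁ y₁ h₁ - Affine.Point.some x₂ y₂ h₂ =
        .some x₁ y₁ h₁ + -.some x₂ y₂ h₂ := sub_eq_add_neg _ _
    rw [hsub, e₂, e₃, e₄]
    refine ⟨(x₁ - x₂) ^ 2, pow_ne_zero _ hx', ?_⟩
    ext i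
    fin_cases i
    · simp
      field_simp
      have : ((y₁ - y₂) ^ 2 - (α + x₁ + x₂) * (x₁ - x₂) ^ 2) *
          ((y₁ + y₂) ^ 2 - (α + x₁ + x₂) * (x₁ - x₂) ^ 2) =
          (x₁ * x₂ - β) ^ 2 * (x₁ - x₂) ^ 2 := by
        have : ((y₁ - y₂) ^ 2 - (α + x₁ + x₂) * (x₁ - x₂) ^ 2) *
          ((y₁ + y₂) ^ 2 - (α + x₁ + x₂) * (x₁ - x₂) ^ 2) = (y₁ ^ 2 - y₂ ^ 2) ^ 2 -
          2 * (y₁ ^ 2 + y₂ ^ 2) * ((α + x₁ + x₂) * (x₁ - x₂) ^ 2) +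
          ((α + x₁ + x₂) * (x₁ - x₂) ^ 2) ^ 2 := by ring
        rw [this, hE₁, hE₂]
        ring
      linear_combination -this
    · simp
      field_simp
      linear_combination -2 * hE₁ - 2 * hE₂
    · simp
      ring

end EllHeight

section NumberField

variable {K : Type*} [Field K] [NumberField K] [DecidableEq K] {α β : K}

omit [DecidableEq K] in
theorem finite_ell_logHeight_le (B : ℝ) :
    {P : (ell α β).Point | logHeight P.xRep ≤ B}.Finite := by
  have h := NumberField.finite_setOfPred_logHeight₁_le (K := K) B
  have hfin : ((fun P : (ell α β).Point => P.xRep) ⁻¹'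
      (insert ![1, 0] ((fun x : K => ![x, 1]) '' {x | logHeight₁ x ≤ B}))).Finite := by
    refine Set.Finite.preimage' ((h.image _).insert _) fun v _ => ?_
    by_cases hv : ∃ P : (ell α β).Point, P.xRep = v
    · obtain ⟨P, rfl⟩ := hv
      refine (Set.toFinite {P, -P}).subset fun Q hQ => ?_
      simpa [Affine.Point.xRep_eq_xRep_iff] using hQ
    · convert Set.finite_empty
      ext P
      simp only [Set.mem_preimage, Set.mem_singleton_iff, Set.mem_empty_iff_false, iff_false]
      exact fun h => hv ⟨P, h⟩
  refine hfin.subset fun P hP => ?_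
  rcases P with _ | ⟨x, y, h⟩
  · left; rfl
  · right
    refine ⟨x, ?_, by simp⟩
    simpa [logHeight₁_eq_logHeight] using hP

theorem exists_ell_height (hβ : β ≠ 0) (hd : α ^ 2 ≠ 4 * β) :
    ∃ q : (ell α β).Point → ℝ, (∀ P, 0 ≤ q P) ∧
      (∀ P Q, q (P + Q) + q (P - Q) = 2 * (q P + q Q)) ∧
      ∃ C, ∀ P, |q P - logHeight P.xRep| ≤ C := by
  have := ell_isElliptic hβ hd
  apply exists_canonical_height
  · intro P
    exact logHeight_nonneg _
  · obtain ⟨C₁, h₁⟩ := abs_logHeight_addSubMap_sub_two_mul_logHeight_le (K := K) (ell α β)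
    obtain ⟨C₂, h₂⟩ := abs_logHeight_sym2_sub_le K
    have h₂' (P Q : (ell α β).Point) :
        |logHeight (P.sym2x Q) - (logHeight P.xRep + logHeight Q.xRep)| ≤ C₂ := by
      have e (P : (ell α β).Point) : P.xRep = ![P.xRep 0, P.xRep 1] := by
        ext i; fin_cases i <;> rfl
      have := h₂ (a := P.xRep 0) (b := P.xRep 1) (c := Q.xRep 0) (d := Q.xRep 1)
        (by rw [← e]; exact P.xRep_ne_zero) (by rw [← e]; exact Q.xRep_ne_zero)
      rwa [← e, ← e] at this
    refine ⟨C₁ + 3 * C₂, fun P Q => ?_⟩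
    obtain ⟨c, hc, e⟩ := ell_sym2x_add_sub hβ hd P Q
    have a1 := h₁ (P.sym2x Q)
    rw [e, logHeight_smul_eq_logHeight _ hc] at a1
    have a2 := h₂' P Q
    have a3 := h₂' (P + Q) (P - Q)
    rw [abs_le] at *
    constructor <;> linarith [a1.1, a1.2, a2.1, a2.2, a3.1, a3.2]

end NumberField

end VojtaCurve

namespace VojtaCurve

open NumberField IsDedekindDomain

theorem exists_finite_reps {G ι : Type*} [Finite ι] (A : Set G) (f : G → ι) (r : G → G → Prop)
    (h : ∀ a ∈ A, ∀ b ∈ A, f a = f b → r a b) :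
    ∃ R : Set G, R.Finite ∧ R ⊆ A ∧ ∀ b ∈ A, ∃ a ∈ R, r a b := by
  classical
  have hc (i : ι) : ∃ a : Set G, a.Finite ∧ a ⊆ A ∧ ∀ b ∈ A, f b = i → ∃ c ∈ a, f c = i := by
    by_cases hi : ∃ b ∈ A, f b = i
    · obtain ⟨b, hb, e⟩ := hi
      exact ⟨{b}, Set.finite_singleton b, by simpa using hb, fun _ _ _ => ⟨b, rfl, e⟩⟩
    · exact ⟨∅, Set.finite_empty, Set.empty_subset _, fun b hb e => (hi ⟨b, hb, e⟩).elim⟩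
  choose a ha hA hb using hc
  refine ⟨⋃ i, a i, Set.finite_iUnion ha, Set.iUnion_subset hA, fun b hbA => ?_⟩
  obtain ⟨c, hc, e⟩ := hb (f b) b hbA rfl
  exact ⟨c, Set.mem_iUnion.mpr ⟨_, hc⟩, h c (hA _ hc) b hbA e⟩

variable {K : Type*} [Field K] [NumberField K]

theorem exists_finite_units_pow_classes {n : ℕ} (hn : n ≠ 0) :
    ∃ R : Set (𝓞 K)ˣ, R.Finite ∧ ∀ u, ∃ r ∈ R, ∃ t, u = r * t ^ n := by
  let H : Subgroup (𝓞 K)ˣ := (powMonoidHom n : (𝓞 K)ˣ →* (𝓞 K)ˣ).range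
  have : Finite ((𝓞 K)ˣ ⧸ H) := by
    have : Group.FG ((𝓞 K)ˣ) := Group.fg_iff_monoid_fg.mpr inferInstance
    apply CommGroup.finite_of_fg_isMulTorsion
    intro x
    obtain ⟨x, rfl⟩ := QuotientGroup.mk_surjective x
    rw [isOfFinOrder_iff_pow_eq_one]
    refine ⟨n, Nat.pos_of_ne_zero hn, ?_⟩
    rw [← QuotientGroup.mk_pow, QuotientGroup.eq_one_iff]
    exact ⟨x, rfl⟩
  obtain ⟨R, hR, -, h⟩ := exists_finite_reps (Set.univ : Set (𝓞 K)ˣ)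
    (fun u => (u : (𝓞 K)ˣ ⧸ H))
    (fun a b => ∃ t, b = a * t ^ n) fun a _ b _ hab => by
      obtain ⟨t, ht⟩ := QuotientGroup.eq.mp hab
      exact ⟨t, by rw [← inv_mul_eq_iff_eq_mul, ← ht]; rfl⟩
  exact ⟨R, hR, fun u => h u trivial⟩

theorem exists_pow_ideal_eq {n : ℕ} {b : 𝓞 K} (hb : b ≠ 0)
    (h : ∀ v : HeightOneSpectrum (𝓞 K), ∃ γ, v.valuation K b = γ ^ n) :
    ∃ J : Ideal (𝓞 K), J ≠ 0 ∧ Ideal.span {b} = J ^ n := by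
  classical
  have hb' : Ideal.span {b} ≠ (0 : Ideal (𝓞 K)) := by simpa using hb
  have key : ∀ I ∈ UniqueFactorizationMonoid.normalizedFactors (Ideal.span {b}),
      n ∣ Multiset.count I (UniqueFactorizationMonoid.normalizedFactors (Ideal.span {b})) := by
    intro I hI
    have hp := UniqueFactorizationMonoid.prime_of_normalized_factor I hI
    let v : HeightOneSpectrum (𝓞 K) := ⟨I, Ideal.isPrime_of_prime hp, hp.ne_zero⟩
    obtain ⟨γ, hγ⟩ := h v
    rw [HeightOneSpectrum.valuation_of_algebraMap, v.intValuation_if_neg hb] at hγ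
    have hc : (Associates.mk v.asIdeal).count (Associates.mk (Ideal.span {b})).factors =
        Multiset.count I (UniqueFactorizationMonoid.normalizedFactors (Ideal.span {b})) :=
      Ideal.count_associates_factors_eq hb' v.isPrime v.ne_bot
    rw [hc] at hγ
    have h2 := congrArg WithZero.log hγ
    rw [WithZero.log_exp, WithZero.log_pow] at h2
    have : (n : ℤ) ∣ Multiset.count I
        (UniqueFactorizationMonoid.normalizedFactors (Ideal.span {b})) :=
      ⟨-WithZero.log γ, by simp only [nsmul_eq_mul] at h2; linarith⟩
    exact_mod_cast this
  obtain ⟨u, hu⟩ := Multiset.exists_smul_of_dvd_count _ key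
  have e : Ideal.span {b} = u.prod ^ n := by
    rw [← Multiset.prod_nsmul, ← hu,
      Ideal.prod_normalizedFactors_eq_self hb']
  by_cases hn : n = 0
  · subst hn
    exact ⟨1, one_ne_zero, by simpa using e⟩
  · refine ⟨u.prod, fun h0 => hb' ?_, e⟩
    rw [e, h0, zero_pow hn]

theorem exists_finite_pow_classes {n : ℕ} (hn : n ≠ 0) {S : Set (HeightOneSpectrum (𝓞 K))}
    (hS : S.Finite) : ∃ R : Set K, R.Finite ∧ (∀ r ∈ R, r ≠ 0) ∧
      ∀ β : K, β ≠ 0 → (∀ v ∉ S, ∃ γ, v.valuation K β = γ ^ n) →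
        ∃ r ∈ R, ∃ t : K, t ≠ 0 ∧ β = r * t ^ n := by
  have : Finite S := hS
  have : NeZero n := ⟨hn⟩
  obtain ⟨R₁, hR₁, hR₁A, h₁⟩ := exists_finite_reps
    (A := {β : K | β ≠ 0 ∧ ∀ v ∉ S, ∃ γ, v.valuation K β = γ ^ n})
    (f := fun β => fun v : S => ((WithZero.log (v.1.valuation K β) : ℤ) : ZMod n))
    (r := fun a b => ∀ v : HeightOneSpectrum (𝓞 K), ∃ γ, v.valuation K (b / a) = γ ^ n) (by
      rintro a ⟨ha, ha'⟩ b ⟨hb, hb'⟩ hab v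
      rw [map_div₀]
      by_cases hv : v ∈ S
      · have h2 := congrFun hab ⟨v, hv⟩
        simp only at h2
        rw [ZMod.intCast_eq_intCast_iff_dvd_sub] at h2
        obtain ⟨c, hc⟩ := h2
        have ha2 : v.valuation K a ≠ 0 := by simpa using ha
        have hb2 : v.valuation K b ≠ 0 := by simpa using hb
        refine ⟨WithZero.exp c, ?_⟩
        rw [← WithZero.exp_nsmul, nsmul_eq_mul, ← hc, WithZero.exp_sub, WithZero.exp_log ha2,
          WithZero.exp_log hb2]
      · obtain ⟨γ, hγ⟩ := ha' v hv
        obtain ⟨δ, hδ⟩ := hb' v hv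
        exact ⟨δ / γ, by rw [hγ, hδ, div_pow]⟩)
  have hJ (β : K) (hβ : β ≠ 0 ∧ ∀ v : HeightOneSpectrum (𝓞 K), ∃ γ, v.valuation K β = γ ^ n) :
      ∃ J : (nonZeroDivisors (Ideal (𝓞 K))), ∃ d : K, d ≠ 0 ∧ ∃ b : 𝓞 K, b ≠ 0 ∧ β * d ^ n = b ∧
        Ideal.span {b} = (J : Ideal (𝓞 K)) ^ n := by
    obtain ⟨a, s, hs, e⟩ := IsFractionRing.div_surjective (A := 𝓞 K) β
    have hs0 : (algebraMap (𝓞 K) K s) ≠ 0 := by simpa using nonZeroDivisors.ne_zero hs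
    have ha0 : a ≠ 0 := by
      rintro rfl
      apply hβ.1
      rw [← e]
      simp
    have hsn : s ≠ 0 := nonZeroDivisors.ne_zero hs
    have e2 : β * (algebraMap (𝓞 K) K s) ^ n = ((a * s ^ (n - 1) : 𝓞 K) : K) := by
      rw [← e]
      obtain ⟨m, rfl⟩ := Nat.exists_eq_succ_of_ne_zero hn
      simp only [Nat.succ_eq_add_one, Nat.add_sub_cancel, map_mul, map_pow]
      field_simp
      ring
    obtain ⟨J, hJ0, hJ⟩ := exists_pow_ideal_eq (K := K) (n := n) (b := a * s ^ (n - 1))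
      (mul_ne_zero ha0 (pow_ne_zero _ hsn)) (by
        intro v
        obtain ⟨γ, hγ⟩ := hβ.2 v
        exact ⟨γ * v.valuation K (algebraMap (𝓞 K) K s), by rw [← e2, map_mul, map_pow, hγ,
          mul_pow]⟩)
    exact ⟨⟨J, mem_nonZeroDivisors_of_ne_zero hJ0⟩, _, hs0, _,
      mul_ne_zero ha0 (pow_ne_zero _ hsn), e2, hJ⟩
  choose! J d hd b hb hdb hbJ using hJ
  obtain ⟨R₂, hR₂, hR₂A, h₂⟩ := exists_finite_reps
    (A := {β : K | β ≠ 0 ∧ ∀ v : HeightOneSpectrum (𝓞 K), ∃ γ, v.valuation K β = γ ^ n})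
    (f := fun β => ClassGroup.mk0 (J β))
    (r := fun a c => ∃ u : (𝓞 K)ˣ, ∃ t : K, t ≠ 0 ∧ c = a * ((u : 𝓞 K) : K) * t ^ n) (by
      rintro β hβ β' hβ' e
      obtain ⟨x, y, hx, hy, hxy⟩ := ClassGroup.mk0_eq_mk0_iff.mp e
      have e2 : Ideal.span {x ^ n * b β} = Ideal.span {y ^ n * b β'} := by
        rw [← Ideal.span_singleton_mul_span_singleton, ← Ideal.span_singleton_mul_span_singleton,
          ← Ideal.span_singleton_pow, ← Ideal.span_singleton_pow, hbJ β hβ, hbJ β' hβ', ← mul_pow,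
          ← mul_pow, hxy]
      obtain ⟨u, hu⟩ := Ideal.span_singleton_eq_span_singleton.mp e2
      have e3 := congrArg (algebraMap (𝓞 K) K) hu
      have h1 := hdb β hβ
      have h2 := hdb β' hβ'
      have hx' : algebraMap (𝓞 K) K x ≠ 0 := by simpa using hx
      have hy' : algebraMap (𝓞 K) K y ≠ 0 := by simpa using hy
      refine ⟨u, algebraMap (𝓞 K) K x * d β / (algebraMap (𝓞 K) K y * d β'),
        div_ne_zero (mul_ne_zero hx' (hd β hβ)) (mul_ne_zero hy' (hd β' hβ')), ?_⟩
      have h3 := hd β hβ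
      have h4 := hd β' hβ'
      simp only [map_mul, map_pow] at e3
      change _ * ((b β : 𝓞 K) : K) * _ = _ * ((b β' : 𝓞 K) : K) at e3
      rw [← h1, ← h2] at e3
      rw [div_pow, mul_pow, mul_pow]
      field_simp
      linear_combination -e3)
  obtain ⟨R₃, hR₃, h₃⟩ := exists_finite_units_pow_classes (K := K) hn
  refine ⟨Set.image2 (· * ·) R₁ (Set.image2 (fun (a : K) (u : (𝓞 K)ˣ) => a * ((u : 𝓞 K) : K))
    R₂ R₃),
    hR₁.image2 _ (hR₂.image2 _ hR₃), ?_, ?_⟩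
  · rintro _ ⟨r₁, hr₁, _, ⟨r₂, hr₂, r₃, hr₃, rfl⟩, rfl⟩
    exact mul_ne_zero (hR₁A hr₁).1 (mul_ne_zero (hR₂A hr₂).1 (by simp))
  · intro β hβ hv
    obtain ⟨r₁, hr₁, e₁⟩ := h₁ β ⟨hβ, hv⟩
    have hr₁0 := (hR₁A hr₁).1
    obtain ⟨r₂, hr₂, u, t, ht, e₂⟩ := h₂ (β / r₁) ⟨div_ne_zero hβ hr₁0, e₁⟩
    obtain ⟨r₃, hr₃, s, e₃⟩ := h₃ u
    refine ⟨_, ⟨r₁, hr₁, _, ⟨r₂, hr₂, r₃, hr₃, rfl⟩, rfl⟩,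
      t * ((s : 𝓞 K) : K), mul_ne_zero ht (by simp), ?_⟩
    rw [div_eq_iff hr₁0] at e₂
    rw [e₂, e₃]
    simp only [Units.val_mul, Units.val_pow_eq_pow_val, map_mul, map_pow]
    ring

theorem finite_valuation_ne_one {x : K} (hx : x ≠ 0) :
    {v : HeightOneSpectrum (𝓞 K) | v.valuation K x ≠ 1}.Finite := by
  have h1 := HeightOneSpectrum.Support.finite (𝓞 K) x
  have h2 := HeightOneSpectrum.Support.finite (𝓞 K) x⁻¹
  refine (h1.union h2).subset fun v hv => ?_
  rcases lt_or_gt_of_ne hv with h | h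
  · right
    simp only [HeightOneSpectrum.Support, Set.mem_ofPred_eq, map_inv₀]
    exact (one_lt_inv₀ (by rw [zero_lt_iff]; simpa using hx)).mpr h
  · left
    exact h

end VojtaCurve

namespace VojtaCurve

open NumberField IsDedekindDomain WeierstrassCurve

section Valuation

variable {K Γ : Type*} [Field K] [LinearOrderedCommGroupWithZero Γ] (v : Valuation K Γ)

theorem valuation_sub_eq_one_of_lt {x e e' : K} (h : v (e - e') = 1) (hx : v (x - e) < 1) :
    v (x - e') = 1 := by
  have : x - e' = (x - e) + (e - e') := by ring
  rw [this, Valuation.map_add_eq_of_lt_right v (by rwa [h]), h]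

theorem exists_valuation_eq_sq {x y e e' e'' : K} (h : y ^ 2 = (x - e) * (x - e') * (x - e''))
    (he : v e ≤ 1) (he' : v e' ≤ 1) (he'' : v e'' ≤ 1) (h1 : v (e - e') = 1)
    (h2 : v (e - e'') = 1) : ∃ γ, v (x - e) = γ ^ 2 := by
  have hv := congrArg v h
  simp only [map_pow, map_mul] at hv
  rcases le_or_gt (v x) 1 with hx | hx
  · have hle : v (x - e) ≤ 1 := (v.map_sub x e).trans (max_le hx he)
    rcases hle.lt_or_eq with hlt | heq
    · rw [valuation_sub_eq_one_of_lt v h1 hlt, valuation_sub_eq_one_of_lt v h2 hlt, mul_one,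
        mul_one] at hv
      exact ⟨_, hv.symm⟩
    · exact ⟨1, by rw [heq, one_pow]⟩
  · rw [v.map_sub_eq_of_lt_left (he.trans_lt hx), v.map_sub_eq_of_lt_left (he'.trans_lt hx),
      v.map_sub_eq_of_lt_left (he''.trans_lt hx)] at hv
    rw [v.map_sub_eq_of_lt_left (he.trans_lt hx)]
    have h0 : v x ≠ 0 := (zero_lt_one.trans hx).ne'
    exact ⟨v y / v x, by rw [div_pow, hv]; field_simp⟩

end Valuation

section Halving

variable {K : Type*} [Field K] [CharZero K] [DecidableEq K]

omit [CharZero K] [DecidableEq K] in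
theorem ell_eq_or_eq_neg {α β x y y' : K} {h : (ell α β).Nonsingular x y}
    {h' : (ell α β).Nonsingular x y'} :
    Affine.Point.some x y h = .some x y' h' ∨ Affine.Point.some x y h = -.some x y' h' :=
  Affine.Point.X_eq_iff.mp rfl

theorem exists_two_nsmul_eq {b c : K} (hb : b ≠ 0) (hc : c ≠ 0) (hbc : b ≠ c) {x y : K}
    {h : (ell (-(b + c)) (b * c)).Nonsingular x y} {p q r : K} (hp : x = p ^ 2)
    (hq : x - b = q ^ 2) (hr : x - c = r ^ 2) :
    ∃ R : (ell (-(b + c)) (b * c)).Point, 2 • R = .some x y h := by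
  have hd : (-(b + c)) ^ 2 ≠ 4 * (b * c) := fun h => hbc (by
    have : (b - c) ^ 2 = 0 := by linear_combination h
    exact sub_eq_zero.mp (pow_eq_zero_iff two_ne_zero |>.mp this))
  have e1 : p + q ≠ 0 := fun h => hb (by linear_combination hp - hq + h * (p - q))
  have e2 : p + r ≠ 0 := fun h => hc (by linear_combination hp - hr + h * (p - r))
  have e3 : q + r ≠ 0 := fun h => hbc (by linear_combination hr - hq + h * (r - q))
  have hb' : b = p ^ 2 - q ^ 2 := by linear_combination hp - hq
  have hc' : c = p ^ 2 - r ^ 2 := by linear_combination hp - hr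
  have hR : ((p + q) * (q + r) * (r + p)) ^ 2 = (x + p * q + p * r + q * r) ^ 3 +
      (-(b + c)) * (x + p * q + p * r + q * r) ^ 2 +
      (b * c) * (x + p * q + p * r + q * r) := by
    rw [hb', hc', hp]
    ring
  have hy : (p + q) * (q + r) * (r + p) ≠ 0 :=
    mul_ne_zero (mul_ne_zero e1 e3) (by rwa [add_comm])
  let R : (ell (-(b + c)) (b * c)).Point :=
    .some _ _ (ell_nonsingular (mul_ne_zero hb hc) hd hR)
  obtain ⟨h', e⟩ := ell_double (h := ell_nonsingular (mul_ne_zero hb hc) hd hR) hy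
  have hx : ((x + p * q + p * r + q * r) ^ 2 - b * c) ^ 2 /
      (4 * ((p + q) * (q + r) * (r + p)) ^ 2) = x := by
    rw [div_eq_iff (by simpa using hy), hb', hc', hp]
    ring
  obtain ⟨h'', e'⟩ := exists_some_congr ⟨h', e⟩ hx rfl
  rcases ell_eq_or_eq_neg (h := h) (h' := h'') with h3 | h3
  · exact ⟨R, by rw [two_nsmul, h3, ← e']⟩
  · exact ⟨-R, by rw [two_nsmul, ← neg_add, h3, ← e']⟩

omit [CharZero K] [DecidableEq K] in
theorem ell_sub_X_sub {α β e l x₁ y₁ x₂ y₂ : K} (he : e ^ 3 + α * e ^ 2 + β * e = 0)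
    (h₁ : y₁ ^ 2 = x₁ ^ 3 + α * x₁ ^ 2 + β * x₁) (h₂ : y₂ ^ 2 = x₂ ^ 3 + α * x₂ ^ 2 + β * x₂)
    (hx : x₁ ≠ x₂) (hl : l * (x₁ - x₂) = y₁ - y₂) :
    (x₁ - e) * (x₂ - e) * (l ^ 2 - α - x₁ - x₂ - e) = (l * (e - x₁) + y₁) ^ 2 := by
  have A : l * (2 * y₁ - l * (x₁ - x₂)) = x₁ ^ 2 + x₁ * x₂ + x₂ ^ 2 + α * (x₁ + x₂) + β := by
    apply mul_left_cancel₀ (sub_ne_zero.mpr hx)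
    linear_combination (2 * y₁ - l * (x₁ - x₂)) * hl - (y₁ - y₂) * hl + h₁ - h₂
  linear_combination -(e - x₁) * A - h₁ - he

theorem exists_sub_eq_two_nsmul {b c : K} (hb : b ≠ 0) (hc : c ≠ 0) (hbc : b ≠ c)
    {x₁ y₁ x₂ y₂ : K} {h₁ : (ell (-(b + c)) (b * c)).Nonsingular x₁ y₁}
    {h₂ : (ell (-(b + c)) (b * c)).Nonsingular x₂ y₂} {p q r : K} (hy₁ : y₁ ≠ 0) (hy₂ : y₂ ≠ 0)
    (hp : x₂ = x₁ * p ^ 2) (hq : x₂ - b = (x₁ - b) * q ^ 2) (hr : x₂ - c = (x₁ - c) * r ^ 2) :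
    ∃ R, Affine.Point.some x₂ y₂ h₂ - .some x₁ y₁ h₁ = 2 • R := by
  have hE₁ := ell_nonsingular_equation h₁
  have hE₂ := ell_nonsingular_equation h₂
  by_cases hx : x₂ = x₁
  · subst hx
    rcases ell_eq_or_eq_neg (h := h₁) (h' := h₂) with h | h
    · exact ⟨0, by rw [h, smul_zero, sub_self]⟩
    · exact ⟨.some x₂ y₂ h₂, by rw [h, sub_neg_eq_add, two_nsmul]⟩
  · obtain ⟨h₁', e₁⟩ := ell_neg_some h₁
    obtain ⟨h₃, e₃⟩ := ell_add_of_X_ne (h₁ := h₂) (h₂ := h₁') hx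
    have hsub : Affine.Point.some x₂ y₂ h₂ - Affine.Point.some x₁ y₁ h₁ =
        .some x₂ y₂ h₂ + -.some x₁ y₁ h₁ := sub_eq_add_neg _ _
    rw [hsub, e₁, e₃]
    have hx' : x₂ - x₁ ≠ 0 := sub_ne_zero.mpr hx
    have key (e p : K) (he : e ^ 3 + (-(b + c)) * e ^ 2 + (b * c) * e = 0)
        (hne : x₁ - e ≠ 0) (hne₂ : x₂ - e ≠ 0) (h : x₂ - e = (x₁ - e) * p ^ 2) :
        ∃ s, ((y₂ - -y₁) / (x₂ - x₁)) ^ 2 - -(b + c) - x₂ - x₁ - e = s ^ 2 := by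
      have h3 := ell_sub_X_sub (l := (y₂ - -y₁) / (x₂ - x₁)) (y₂ := -y₁) he hE₂
        (by rw [neg_sq]; exact hE₁) hx (by rw [div_mul_cancel₀ _ hx'])
      refine ⟨((y₂ - -y₁) / (x₂ - x₁) * (e - x₂) + y₂) / ((x₁ - e) * p), ?_⟩
      have hp0 : p ≠ 0 := by
        rintro rfl
        exact hne₂ (by rw [h]; ring)
      rw [div_pow ((y₂ - -y₁) / (x₂ - x₁) * (e - x₂) + y₂), ← h3, h, eq_div_iff
        (pow_ne_zero 2 (mul_ne_zero hne hp0))]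
      ring
    have hprod₁ : y₁ ^ 2 = x₁ * (x₁ - b) * (x₁ - c) := by rw [hE₁]; ring
    have hprod₂ : y₂ ^ 2 = x₂ * (x₂ - b) * (x₂ - c) := by rw [hE₂]; ring
    have n₁ : x₁ * (x₁ - b) * (x₁ - c) ≠ 0 := hprod₁ ▸ pow_ne_zero 2 hy₁
    have n₂ : x₂ * (x₂ - b) * (x₂ - c) ≠ 0 := hprod₂ ▸ pow_ne_zero 2 hy₂
    simp only [ne_eq, mul_eq_zero, not_or] at n₁ n₂
    obtain ⟨s₁, hs₁⟩ := key 0 p (by ring) (by simpa using n₁.1.1) (by simpa using n₂.1.1)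
      (by simpa using hp)
    obtain ⟨s₂, hs₂⟩ := key b q (by ring) n₁.1.2 n₂.1.2 hq
    obtain ⟨s₃, hs₃⟩ := key c r (by ring) n₁.2 n₂.2 hr
    obtain ⟨R, hR⟩ := exists_two_nsmul_eq hb hc hbc (h := h₃) (by rw [← hs₁, sub_zero]) hs₂ hs₃
    exact ⟨R, hR.symm⟩

end Halving

section WeakMordellWeil

variable {K : Type*} [Field K] [NumberField K] [DecidableEq K]

theorem exists_finite_sub_two_nsmul_mem {b c : K} (hb : b ≠ 0) (hc : c ≠ 0) (hbc : b ≠ c) :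
    ∃ R : Set (ell (-(b + c)) (b * c)).Point, R.Finite ∧ ∀ P, ∃ P', P - 2 • P' ∈ R := by
  let S : Set (HeightOneSpectrum (𝓞 K)) := {v | v.valuation K b ≠ 1} ∪
    {v | v.valuation K c ≠ 1} ∪ {v | v.valuation K (b - c) ≠ 1}
  have hS : S.Finite := ((finite_valuation_ne_one hb).union (finite_valuation_ne_one hc)).union
    (finite_valuation_ne_one (sub_ne_zero.mpr hbc))
  obtain ⟨T, hT, hT0, hTc⟩ := exists_finite_pow_classes two_ne_zero hS
  have : Finite T := hT
  have hvS (v : HeightOneSpectrum (𝓞 K)) (hv : v ∉ S) :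
      v.valuation K b = 1 ∧ v.valuation K c = 1 ∧ v.valuation K (b - c) = 1 := by
    simpa [S, and_assoc] using hv
  have cl (x y : K) (hy : y ≠ 0) (h : y ^ 2 = x * (x - b) * (x - c)) :
      (∃ r ∈ T, ∃ t : K, t ≠ 0 ∧ x = r * t ^ 2) ∧ (∃ r ∈ T, ∃ t : K, t ≠ 0 ∧ x - b = r * t ^ 2) ∧
        (∃ r ∈ T, ∃ t : K, t ≠ 0 ∧ x - c = r * t ^ 2) := by
    have n : x * (x - b) * (x - c) ≠ 0 := h ▸ pow_ne_zero 2 hy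
    simp only [ne_eq, mul_eq_zero, not_or] at n
    refine ⟨hTc _ n.1.1 fun v hv => ?_, hTc _ n.1.2 fun v hv => ?_, hTc _ n.2 fun v hv => ?_⟩
    · obtain ⟨h1, h2, h3⟩ := hvS v hv
      simpa using exists_valuation_eq_sq (v.valuation K) (y := y) (x := x) (e := 0) (e' := b)
        (e'' := c) (by simpa using h) (by simp) h1.le h2.le (by simpa using h1) (by simpa using h2)
    · obtain ⟨h1, h2, h3⟩ := hvS v hv
      exact exists_valuation_eq_sq (v.valuation K) (y := y) (x := x) (e := b) (e' := 0)
        (e'' := c) (by rw [h]; ring) h1.le (by simp) h2.le (by simpa using h1) h3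
    · obtain ⟨h1, h2, h3⟩ := hvS v hv
      exact exists_valuation_eq_sq (v.valuation K) (y := y) (x := x) (e := c) (e' := 0)
        (e'' := b) (by rw [h]; ring) h2.le (by simp) h1.le (by simpa using h2)
        (by rwa [Valuation.map_sub_swap])
  let A : Set (ell (-(b + c)) (b * c)).Point := {P | ∃ x y h, P = .some x y h ∧ y ≠ 0}
  have hA (P : (ell (-(b + c)) (b * c)).Point) (hP : P ∈ A) : ∃ i : T × T × T, ∃ x y h,
      P = .some x y h ∧ y ≠ 0 ∧ (∃ t : K, t ≠ 0 ∧ x = i.1 * t ^ 2) ∧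
      (∃ t : K, t ≠ 0 ∧ x - b = i.2.1 * t ^ 2) ∧ ∃ t : K, t ≠ 0 ∧ x - c = i.2.2 * t ^ 2 := by
    obtain ⟨x, y, h, rfl, hy⟩ := hP
    obtain ⟨⟨r₁, h₁, e₁⟩, ⟨r₂, h₂, e₂⟩, ⟨r₃, h₃, e₃⟩⟩ := cl x y hy
      (by rw [ell_nonsingular_equation h]; ring)
    exact ⟨⟨⟨r₁, h₁⟩, ⟨r₂, h₂⟩, ⟨r₃, h₃⟩⟩, x, y, h, rfl, hy, e₁, e₂, e₃⟩
  have : Nonempty (T × T × T) := by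
    obtain ⟨r, hr, -⟩ := hTc 1 one_ne_zero fun v _ => ⟨1, by simp⟩
    exact ⟨⟨r, hr⟩, ⟨r, hr⟩, ⟨r, hr⟩⟩
  choose! f hf using hA
  obtain ⟨R, hR, -, hRA⟩ := exists_finite_reps A f (fun a b => ∃ R, b - a = 2 • R) (by
    intro P hP P' hP' e
    obtain ⟨x₁, y₁, h₁, e₁, n₁, ⟨t₁, ht₁, s₁⟩, ⟨t₂, ht₂, s₂⟩, ⟨t₃, ht₃, s₃⟩⟩ := hf P hP
    obtain ⟨x₂, y₂, h₂, e₂, n₂, ⟨t₁', ht₁', s₁'⟩, ⟨t₂', ht₂', s₂'⟩, ⟨t₃', ht₃', s₃'⟩⟩ := hf P' hP'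
    rw [← e] at s₁' s₂' s₃'
    rw [e₁, e₂]
    refine exists_sub_eq_two_nsmul hb hc hbc n₁ n₂ (p := t₁' / t₁) (q := t₂' / t₂)
      (r := t₃' / t₃) ?_ ?_ ?_
    · rw [s₁, s₁']; field_simp
    · rw [s₂, s₂']; field_simp
    · rw [s₃, s₃']; field_simp)
  have hfin : Aᶜ.Finite := by
    have : (({0} : Set (ell (-(b + c)) (b * c)).Point) ∪ ⋃ x ∈ ({0, b, c} : Set K),
        {P | ∃ h, P = .some x 0 h}).Finite := by
      refine (Set.finite_singleton _).union (Set.Finite.biUnion (Set.toFinite _) fun x _ => ?_)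
      refine Set.Subsingleton.finite ?_
      rintro _ ⟨_, rfl⟩ _ ⟨_, rfl⟩
      rfl
    refine this.subset fun P hP => ?_
    rcases P with _ | ⟨x, y, h⟩
    · left; rfl
    · right
      have hy : y = 0 := by
        by_contra hy
        exact hP ⟨x, y, h, rfl, hy⟩
      subst hy
      have hE := ell_nonsingular_equation h
      have hE' : x * (x - b) * (x - c) = 0 := by linear_combination -hE
      simp only [mul_eq_zero, sub_eq_zero, or_assoc] at hE'
      exact Set.mem_biUnion (by simpa using hE') ⟨h, rfl⟩
  refine ⟨R ∪ Aᶜ, hR.union hfin, fun P => ?_⟩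
  by_cases hP : P ∈ A
  · obtain ⟨a, ha, Q, hQ⟩ := hRA P hP
    exact ⟨Q, Or.inl (by rwa [← hQ, sub_sub_cancel])⟩
  · exact ⟨0, Or.inr (by rwa [smul_zero, sub_zero])⟩

end WeakMordellWeil

end VojtaCurve

namespace VojtaCurve

open Polynomial NumberField Height

section Heights

variable {K : Type*} [Field K] [NumberField K]

theorem finitePlace_le_one (v : FinitePlace K) (a : 𝓞 K) : v.1 (a : K) ≤ 1 := by
  have := FinitePlace.norm_embedding_eq v (a : K) ▸ FinitePlace.norm_le_one K v.maximalIdeal a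
  exact this

theorem hasFiniteMulSupport_iSup_finitePlace {ι : Type*} [Finite ι] {x : ι → K} (hx : x ≠ 0) :
    Function.HasFiniteMulSupport fun v : FinitePlace K => ⨆ i, v (x i) := by
  have : Nonempty {j // x j ≠ 0} := nonempty_subtype.mpr <| Function.ne_iff.mp hx
  suffices (fun v : FinitePlace K ↦ ⨆ i : {j // x j ≠ 0}, v (x i)).HasFiniteMulSupport by
    convert! this with v
    obtain ⟨i, hi⟩ : ∃ j, x j ≠ 0 := Function.ne_iff.mp hx
    have : Nonempty ι := ⟨i⟩
    refine le_antisymm (ciSup_le fun j ↦ ?_) (ciSup_le fun ⟨j, hj⟩ ↦ Finite.le_ciSup_of_le j le_rfl)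
    rcases eq_or_ne (x j) 0 with h | h
    · rw [h, map_zero]
      exact Real.iSup_nonneg' ⟨⟨i, hi⟩, apply_nonneg _ _⟩
    · exact Finite.le_ciSup_of_le (⟨j, h⟩ : {j // x j ≠ 0}) le_rfl
  exact .iSup fun i => FinitePlace.hasFiniteMulSupport i.2

/-- If all coordinates of a nonzero vector are bounded at every place in terms of two field
elements, its height is bounded in terms of the heights of those two elements. -/
theorem mulHeight_le_of_local {ι : Type*} [Finite ι] {x : ι → K} (hx : x ≠ 0) (s t : K) (a b : ℕ)
    {M : ℝ} (hM : 0 ≤ M)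
    (hfin : ∀ (v : FinitePlace K) (i), v (x i) ≤ max (v s) 1 ^ a * max (v t) 1 ^ b)
    (hinf : ∀ (v : InfinitePlace K) (i), v (x i) ≤ M * (max (v s) 1 ^ a * max (v t) 1 ^ b)) :
    mulHeight x ≤ M ^ Module.finrank ℚ K * (mulHeight₁ s ^ a * mulHeight₁ t ^ b) := by
  have : Nonempty ι := ⟨(Function.ne_iff.mp hx).choose⟩
  have hs (y : K) : Function.HasFiniteMulSupport fun v : FinitePlace K => max (v y) 1 := by
    fun_prop
  have hx' : Function.HasFiniteMulSupport fun v : FinitePlace K => ⨆ i, v (x i) :=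
    hasFiniteMulSupport_iSup_finitePlace hx
  have h1 : ∏ᶠ v : FinitePlace K, (max (v s) 1 ^ a * max (v t) 1 ^ b) =
      (∏ᶠ v : FinitePlace K, max (v s) 1) ^ a * (∏ᶠ v : FinitePlace K, max (v t) 1) ^ b := by
    rw [finprod_pow (hs s), finprod_pow (hs t)]
    exact finprod_mul_distrib ((hs s).pow a) ((hs t).pow b)
  have h2 : (∏ v : InfinitePlace K, (M * (max (v s) 1 ^ a * max (v t) 1 ^ b)) ^ v.mult) =
      M ^ Module.finrank ℚ K * ((∏ v : InfinitePlace K, max (v s) 1 ^ v.mult) ^ a *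
        (∏ v : InfinitePlace K, max (v t) 1 ^ v.mult) ^ b) := by
    rw [← InfinitePlace.sum_mult_eq, ← Finset.prod_pow_eq_pow_sum, ← Finset.prod_pow,
      ← Finset.prod_pow, ← Finset.prod_mul_distrib, ← Finset.prod_mul_distrib]
    refine Finset.prod_congr rfl fun v _ => ?_
    rw [mul_pow, mul_pow, ← pow_mul, ← pow_mul, ← pow_mul, ← pow_mul, mul_comm a, mul_comm b]
  rw [NumberField.mulHeight_eq hx, NumberField.mulHeight₁_eq, NumberField.mulHeight₁_eq, mul_pow,
    mul_pow]
  calc _ ≤ (∏ v : InfinitePlace K, (M * (max (v s) 1 ^ a * max (v t) 1 ^ b)) ^ v.mult) *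
        ∏ᶠ v : FinitePlace K, (max (v s) 1 ^ a * max (v t) 1 ^ b) := by
        refine mul_le_mul (Finset.prod_le_prod (fun v _ => pow_nonneg ?_ _) fun v _ =>
          pow_le_pow_left₀ ?_ (ciSup_le (hinf v)) _) (finprod_le_finprod hx' (fun v => ?_)
          (((hs s).pow a).mul ((hs t).pow b)) fun v => ciSup_le (hfin v))
          (finprod_nonneg fun v => ?_) (Finset.prod_nonneg fun v _ => by positivity)
        all_goals exact Real.iSup_nonneg fun i => apply_nonneg _ _
    _ = _ := by rw [h1, h2]; ring

/-- The restriction of an absolute value of `K` to the ring of integers. -/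
noncomputable def placeSeminorm (v : AbsoluteValue K ℝ) : RingSeminorm (𝓞 K) where
  toFun a := v (a : K)
  map_zero' := by simp
  add_le' a b := by simpa using v.add_le (a : K) b
  neg' a := by simp
  mul_le' a b := by simp

omit [NumberField K] in
theorem placeSeminorm_apply (v : AbsoluteValue K ℝ) (a : 𝓞 K) : placeSeminorm v a = v (a : K) := rfl

omit [NumberField K] in
theorem placeSeminorm_one_le (v : AbsoluteValue K ℝ) : placeSeminorm v 1 ≤ 1 := by
  simp [placeSeminorm_apply]

/-- The sum of the absolute values of the coefficients of a polynomial at an infinite place. -/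
noncomputable def polyNorm (v : InfinitePlace K) : RingSeminorm (𝓞 K)[X] :=
  polySeminorm (placeSeminorm v.1) 1

theorem max_pow_mul_leadingCoeff_le_gaussNorm (v : FinitePlace K) (g : (𝓞 K)[X]) (x : K) (w : ℕ)
    (h : K[X]) (hg : g.map (algebraMap (𝓞 K) K) = (X - C x) ^ w * h) :
    max (v x) 1 ^ w * v h.leadingCoeff ≤ 1 := by
  have hna : IsNonarchimedean v.1 := fun a b => map_add_le_max v a b
  have hmul (p q : K[X]) := gaussNorm_mul (v := v.1) hna one_pos p q
  have h1 : max (v x) 1 ≤ gaussNorm v.1 1 (X - C x) := by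
    refine max_le ?_ ?_
    · have := le_gaussNorm v.1 (X - C x) (zero_le_one (α := ℝ)) 0
      rwa [coeff_sub, coeff_X_zero, coeff_C_zero, zero_sub, one_pow, mul_one, map_neg_eq_map]
        at this
    · have := le_gaussNorm v.1 (X - C x) (zero_le_one (α := ℝ)) 1
      rwa [coeff_sub, coeff_X_one, coeff_C_of_ne_zero one_ne_zero, sub_zero, one_pow, mul_one,
        map_one] at this
  have h2 : v h.leadingCoeff ≤ gaussNorm v.1 1 h := by
    have := le_gaussNorm v.1 h (zero_le_one (α := ℝ)) h.natDegree
    rwa [one_pow, mul_one] at this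
  have hp (n : ℕ) : gaussNorm v.1 1 ((X - C x) ^ n) = gaussNorm v.1 1 (X - C x) ^ n := by
    induction n with
    | zero => simpa using gaussNorm_C v.1 1 (1 : K)
    | succ n ih => rw [pow_succ, hmul, ih, pow_succ]
  have h3 : gaussNorm v.1 1 (g.map (algebraMap (𝓞 K) K)) ≤ 1 := by
    obtain ⟨i, hi⟩ := exists_eq_gaussNorm v.1 1 (g.map (algebraMap (𝓞 K) K))
    rw [hi, coeff_map]
    simpa using finitePlace_le_one v (g.coeff i)
  rw [hg, hmul, hp] at h3
  exact (mul_le_mul (pow_le_pow_left₀ (by positivity) h1 w) h2 (apply_nonneg _ _)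
    (pow_nonneg ((by positivity : (0 : ℝ) ≤ max (v x) 1).trans h1) _)).trans h3

omit [NumberField K] in
theorem max_pow_mul_leadingCoeff_le_polyNorm (v : InfinitePlace K) (g : (𝓞 K)[X]) (x : K) (w : ℕ)
    (h : K[X]) (hg : g.map (algebraMap (𝓞 K) K) = (X - C x) ^ w * h) :
    max (v x) 1 ^ w * v h.leadingCoeff ≤ polyNorm v g := by
  have key := mahlerMeasure_le_sum_norm_coeff ((g.map (algebraMap (𝓞 K) K)).map v.embedding)
  have hp (n : ℕ) : mahlerMeasure ((X - C (v.embedding x)) ^ n) =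
      mahlerMeasure (X - C (v.embedding x)) ^ n := by
    induction n with
    | zero => simp
    | succ n ih => rw [pow_succ, mahlerMeasure_mul, ih, pow_succ]
  have h1 : (((g.map (algebraMap (𝓞 K) K)).map v.embedding).sum fun _ a => ‖a‖) = polyNorm v g := by
    rw [polyNorm, polySeminorm_def, Polynomial.map_map, sum_over_range' _ (by simp)
      (g.natDegree + 1)
      (Nat.lt_succ_of_le natDegree_map_le), sum_over_range' _ (by simp) (g.natDegree + 1)
      (Nat.lt_succ_self _)]
    refine Finset.sum_congr rfl fun i _ => ?_
    simp only [coeff_map, placeSeminorm_apply, NNReal.coe_one, one_pow, mul_one]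
    exact InfinitePlace.norm_embedding_eq v _
  rw [h1, hg, Polynomial.map_mul, Polynomial.map_pow, Polynomial.map_sub, map_X, map_C,
    mahlerMeasure_mul, hp, mahlerMeasure_X_sub_C, InfinitePlace.norm_embedding_eq, max_comm] at key
  refine le_trans (mul_le_mul_of_nonneg_left ?_ (by positivity)) key
  have := leadingCoeff_le_mahlerMeasure (h.map v.embedding)
  rwa [leadingCoeff_map, InfinitePlace.norm_embedding_eq] at this

/-- A root of multiplicity `w` of an integral polynomial with small coefficients has small
height. -/
theorem mulHeight₁_pow_le_of_dvd {g : (𝓞 K)[X]} (hg : g ≠ 0) {x : K} {w : ℕ}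
    (hdvd : (X - C x) ^ w ∣ g.map (algebraMap (𝓞 K) K)) {M : ℝ}
    (hM : ∀ v : InfinitePlace K, polyNorm v g ≤ M) :
    mulHeight₁ x ^ w ≤ M ^ Module.finrank ℚ K := by
  obtain ⟨h, hh⟩ := hdvd
  have hne : g.map (algebraMap (𝓞 K) K) ≠ 0 :=
    (Polynomial.map_ne_zero_iff (FaithfulSMul.algebraMap_injective _ _)).mpr hg
  have ha : h.leadingCoeff ≠ 0 := by
    rw [leadingCoeff_ne_zero]
    rintro rfl
    simp [hh] at hne
  have hM0 : 0 ≤ M :=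
    (apply_nonneg _ _).trans (hM (Classical.arbitrary _))
  have hvec : (h.leadingCoeff • ![x ^ w, 1] : Fin 2 → K) ≠ 0 := by
    intro h0
    simpa [ha] using congrFun h0 1
  have hle (v : AbsoluteValue K ℝ) (i : Fin 2) : v ((h.leadingCoeff • ![x ^ w, 1] : Fin 2 → K) i) ≤
      max (v x) 1 ^ w * v h.leadingCoeff := by
    fin_cases i
    · simp only [Pi.smul_apply, smul_eq_mul, map_mul, Fin.zero_eta, Matrix.cons_val_zero, map_pow]
      rw [mul_comm]
      gcongr
      exact le_max_left _ _
    · simp only [Pi.smul_apply, smul_eq_mul, Fin.mk_one, Matrix.cons_val_one, mul_one,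
        Matrix.cons_val_fin_one]
      exact le_mul_of_one_le_left (apply_nonneg _ _) (one_le_pow₀ (le_max_right _ _))
  have key := mulHeight_le_of_local hvec 1 1 0 0 hM0
    (fun v i => (hle v.1 i).trans ((max_pow_mul_leadingCoeff_le_gaussNorm v g x w h hh).trans
      (by simp)))
    (fun v i => (hle v.1 i).trans (((max_pow_mul_leadingCoeff_le_polyNorm v g x w h hh).trans
      (hM v)).trans (by simp)))
  rw [mulHeight_smul_eq_mulHeight _ ha, ← mulHeight₁_eq_mulHeight, mulHeight₁_pow] at key
  simpa using key

end Heights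

end VojtaCurve

namespace VojtaCurve

open Polynomial NumberField Height

section Wronskian

variable {R : Type*} [CommRing R]

/-- Differentiation of the coefficients of a polynomial over a polynomial ring. -/
noncomputable def coeffDeriv (F : R[X][X]) : R[X][X] :=
  F.sum fun j a => monomial j (derivative a)

theorem coeff_coeffDeriv (F : R[X][X]) (j : ℕ) :
    (coeffDeriv F).coeff j = derivative (F.coeff j) := by
  rw [coeffDeriv, Polynomial.sum_def, finsetSum_coeff]
  simp only [coeff_monomial]
  rw [Finset.sum_ite_eq' F.support j]
  split_ifs with h
  · rfl
  · rw [notMem_support_iff.mp h, derivative_zero]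

theorem eval₂_coeffDeriv {S : Type*} [CommRing S] (φ : R →+* S) (u : S) (F : R[X][X]) :
    (coeffDeriv F).eval₂ (mapRingHom φ) (C u) = derivative (F.eval₂ (mapRingHom φ) (C u)) := by
  have h : (coeffDeriv F).natDegree < F.natDegree + 1 := by
    refine Nat.lt_succ_of_le (natDegree_le_iff_coeff_eq_zero.mpr fun j hj => ?_)
    rw [coeff_coeffDeriv, coeff_eq_zero_of_natDegree_lt hj, derivative_zero]
  rw [eval₂_eq_sum_range' _ h, eval₂_eq_sum_range' _ (Nat.lt_succ_self F.natDegree), derivative_sum]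
  refine Finset.sum_congr rfl fun j _ => ?_
  rw [coeff_coeffDeriv, ← C_pow, coe_mapRingHom, ← derivative_map, mul_comm, ← smul_eq_C_mul,
    mul_comm, ← smul_eq_C_mul, derivative_smul]

theorem C_leadingCoeff_mul_eq [IsDomain R] [CharZero R] {p q : R[X]} (hq : q ≠ 0)
    (h : derivative p * q = derivative q * p) :
    C q.leadingCoeff * p = C (p.coeff q.natDegree) * q := by
  by_contra hne
  set r := C q.leadingCoeff * p - C (p.coeff q.natDegree) * q with hr
  have hr0 : r ≠ 0 := sub_ne_zero.mpr hne
  have hrn : r.coeff q.natDegree = 0 := by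
    rw [hr, coeff_sub, coeff_C_mul, coeff_C_mul, coeff_natDegree, mul_comm, sub_self]
  have h1 : X * derivative r * q = X * derivative q * r := by
    rw [hr, derivative_sub, derivative_C_mul, derivative_C_mul]
    linear_combination X * C q.leadingCoeff * h
  have hdeg (s : R[X]) : (X * derivative s).natDegree ≤ s.natDegree := by
    refine natDegree_le_iff_coeff_eq_zero.mpr fun j hj => ?_
    obtain ⟨j, rfl⟩ := Nat.exists_eq_succ_of_ne_zero (Nat.ne_zero_of_lt hj)
    rw [Nat.succ_eq_add_one, coeff_X_mul, coeff_derivative, coeff_eq_zero_of_natDegree_lt hj,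
      zero_mul]
  have hlc (s : R[X]) : (X * derivative s).coeff s.natDegree = s.natDegree * s.leadingCoeff := by
    rcases Nat.eq_zero_or_pos s.natDegree with h0 | h0
    · rw [h0]; simp
    · obtain ⟨j, hj⟩ := Nat.exists_eq_succ_of_ne_zero h0.ne'
      rw [leadingCoeff, hj, Nat.succ_eq_add_one, coeff_X_mul, coeff_derivative]
      push_cast
      ring
  have h2 := congrArg (fun s => coeff s (r.natDegree + q.natDegree)) h1
  rw [coeff_mul_add_eq_of_natDegree_le (hdeg r) le_rfl, mul_comm (X * derivative q),
    coeff_mul_add_eq_of_natDegree_le le_rfl (hdeg q), hlc, hlc, coeff_natDegree, coeff_natDegree]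
      at h2
  have h3 : (r.natDegree : R) = q.natDegree := by
    refine mul_right_cancel₀ (mul_ne_zero (leadingCoeff_ne_zero.mpr hr0)
      (leadingCoeff_ne_zero.mpr hq)) ?_
    linear_combination h2
  rw [← Nat.cast_injective h3, coeff_natDegree, leadingCoeff_eq_zero] at hrn
  exact hr0 hrn

end Wronskian

section Roth

variable {K : Type*} [Field K] [NumberField K]

omit [NumberField K] in
theorem polyNorm_derivative_le (v : InfinitePlace K) (a : (𝓞 K)[X]) {d : ℕ} (hd : a.natDegree ≤ d) :
    polyNorm v (derivative a) ≤ d * polyNorm v a := by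
  have hd' : (derivative a).natDegree < d + 1 :=
    Nat.lt_succ_of_le ((natDegree_derivative_le a).trans ((Nat.sub_le _ _).trans hd))
  rw [polyNorm, polySeminorm_def, polySeminorm_def, sum_over_range' _ (by simp) (d + 1) hd',
    sum_over_range' a (by simp) (d + 1 + 1) (by omega), Finset.mul_sum, Finset.sum_range_succ' _
      (d + 1)]
  simp only [NNReal.coe_one, one_pow, mul_one]
  refine le_add_of_le_of_nonneg (Finset.sum_le_sum fun i hi => ?_)
    (mul_nonneg (by positivity) (apply_nonneg _ _))
  rw [coeff_derivative]
  refine (map_mul_le_mul _ _ _).trans ?_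
  by_cases h : i + 1 ≤ d
  · rw [mul_comm]
    refine mul_le_mul_of_nonneg_right ?_ (apply_nonneg _ _)
    have := RingSeminorm.natCast_le _ (placeSeminorm_one_le v.1) (i + 1)
    push_cast at this
    refine this.trans ?_
    exact_mod_cast h
  · rw [coeff_eq_zero_of_natDegree_lt (by omega)]
    simp

/-- A two-variable polynomial of small height and bounded degree in the second variable cannot
vanish to high order at a point whose coordinates have large height. -/
theorem mulHeight₁_le_or_of_dvd (x u : K) (D : ℕ) : ∀ (F : (𝓞 K)[X][X]) (d w : ℕ) (M : ℝ), F ≠ 0 →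
    F.natDegree < D → (∀ j, (F.coeff j).natDegree ≤ d) →
    (∀ (v : InfinitePlace K) (j), polyNorm v (F.coeff j) ≤ M) → 2 ≤ M → 2 * d ≤ M → D ≤ M →
    (X - C x) ^ w ∣ F.eval₂ (mapRingHom (algebraMap (𝓞 K) K)) (C u) →
    mulHeight₁ u ≤ (M ^ 3 ^ D) ^ Module.finrank ℚ K ∨
      mulHeight₁ x ^ (w - D) ≤ (M ^ 3 ^ D) ^ Module.finrank ℚ K := by
  induction D with
  | zero => intro F d w M _ h; omega
  | succ D ih =>
    intro F d w M hF hD hd hM h2 hdM hDM hdvd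
    have hM1 : 1 ≤ M := by linarith
    set a := F.leadingCoeff with ha
    have ha0 : a ≠ 0 := leadingCoeff_ne_zero.mpr hF
    set F₁ := C a * coeffDeriv F - C (derivative a) * F with hF₁
    have hcoeff (j : ℕ) : F₁.coeff j = a * derivative (F.coeff j) - derivative a * F.coeff j := by
      rw [hF₁, coeff_sub, coeff_C_mul, coeff_C_mul, coeff_coeffDeriv]
    by_cases h0 : F₁ = 0
    · set n := a.natDegree with hn
      set g : (𝓞 K)[X] := ∑ j ∈ Finset.range (F.natDegree + 1),
        monomial j ((F.coeff j).coeff n) with hg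
      have hprop (j : ℕ) : C a.leadingCoeff * F.coeff j = C ((F.coeff j).coeff n) * a := by
        refine C_leadingCoeff_mul_eq ha0 ?_
        have := hcoeff j
        rw [h0, coeff_zero] at this
        linear_combination -this
      have hgN : g.coeff F.natDegree = a.leadingCoeff := by
        rw [hg, finsetSum_coeff]
        simp only [coeff_monomial]
        rw [Finset.sum_ite_eq' _ F.natDegree, if_pos (by simp), coeff_natDegree, hn,
          coeff_natDegree]
      have hg0 : g ≠ 0 := by
        intro h
        rw [h, coeff_zero] at hgN
        exact ha0 (leadingCoeff_eq_zero.mp hgN.symm)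
      have hgM (v : InfinitePlace K) : polyNorm v g ≤ M ^ 3 ^ (D + 1) := by
        calc polyNorm v g ≤ ∑ j ∈ Finset.range (F.natDegree + 1), M := by
              refine (RingSeminorm.sum_le _ _ _).trans (Finset.sum_le_sum fun j _ => ?_)
              rw [polyNorm, polySeminorm_def, sum_monomial_index _ _ (by simp)]
              simp only [NNReal.coe_one, one_pow, mul_one]
              refine le_trans ?_ (hM v j)
              have := coeff_le_polySeminorm (ν := placeSeminorm v.1) (κ := 1) (F.coeff j) n
              rwa [NNReal.coe_one, one_pow, mul_one] at this
          _ = (F.natDegree + 1 : ℕ) * M := by rw [Finset.sum_const, Finset.card_range, nsmul_eq_mul]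
          _ ≤ M * M := by
              refine mul_le_mul_of_nonneg_right ((Nat.cast_le.mpr ?_).trans hDM) (by linarith)
              omega
          _ = M ^ 2 := by ring
          _ ≤ M ^ 3 ^ (D + 1) := by
              refine pow_le_pow_right₀ hM1 ?_
              rw [pow_succ]
              have := Nat.one_le_pow D 3 (by norm_num)
              omega
      by_cases hroot : (g.map (algebraMap (𝓞 K) K)).eval u = 0
      · left
        have := mulHeight₁_pow_le_of_dvd hg0 (x := u) (w := 1)
          (by rw [pow_one]; exact dvd_iff_isRoot.mpr hroot) hgM
        rwa [pow_one] at this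
      · right
        have hev : C (algebraMap (𝓞 K) K a.leadingCoeff) *
            F.eval₂ (mapRingHom (algebraMap (𝓞 K) K)) (C u) =
            C ((g.map (algebraMap (𝓞 K) K)).eval u) * a.map (algebraMap (𝓞 K) K) := by
          rw [eval₂_eq_sum_range, hg, Polynomial.map_sum, eval_finsetSum, map_sum, Finset.mul_sum,
            Finset.sum_mul]
          refine Finset.sum_congr rfl fun j _ => ?_
          have := congrArg (mapRingHom (algebraMap (𝓞 K) K)) (hprop j)
          simp only [map_mul, coe_mapRingHom, map_C] at this ⊢
          rw [map_monomial, eval_monomial, map_mul, map_pow]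
          linear_combination (C u) ^ j * this
        have hdv : (X - C x) ^ w ∣ a.map (algebraMap (𝓞 K) K) := by
          have := hdvd.mul_left (C (algebraMap (𝓞 K) K a.leadingCoeff))
          rw [hev] at this
          exact (IsUnit.dvd_mul_left (isUnit_C.mpr (Ne.isUnit hroot))).mp this
        have key := mulHeight₁_pow_le_of_dvd ha0
          (dvd_trans (pow_dvd_pow _ (Nat.sub_le w (D + 1))) hdv)
          (M := M ^ 3 ^ (D + 1)) fun v => (hM v F.natDegree).trans
            (le_self_pow₀ hM1 (by positivity))
        exact key
    · have hdeg : F₁.natDegree < D := by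
        have hle : F₁.natDegree ≤ F.natDegree := by
          refine natDegree_le_iff_coeff_eq_zero.mpr fun j hj => ?_
          rw [hcoeff, coeff_eq_zero_of_natDegree_lt hj, derivative_zero, mul_zero, mul_zero,
            sub_zero]
        have hne : F₁.natDegree ≠ F.natDegree := by
          intro h
          apply h0
          rw [← leadingCoeff_eq_zero, leadingCoeff, h, hcoeff, coeff_natDegree]
          ring
        omega
      have hM3 : M * 4 ≤ M ^ 3 := by
        nlinarith [mul_nonneg (by linarith : 0 ≤ M) (by nlinarith : 0 ≤ M ^ 2 - 4)]
      have hM0 : M ≤ M ^ 3 := by linarith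
      have := ih F₁ (2 * d) (w - 1) (M ^ 3) h0 hdeg (fun j => ?_) (fun v j => ?_) (by linarith)
        (by push_cast; linarith) (by push_cast at hDM; linarith) ?_
      · rwa [← pow_mul M 3, ← pow_succ', Nat.sub_sub, add_comm 1 D] at this
      · rw [hcoeff]
        have h1 := natDegree_derivative_le (F.coeff j)
        have h2 := natDegree_derivative_le a
        have h3 := hd j
        have h4 : a.natDegree ≤ d := hd F.natDegree
        refine (natDegree_sub_le _ _).trans (max_le (natDegree_mul_le.trans ?_)
          (natDegree_mul_le.trans ?_)) <;> omega
      · rw [hcoeff]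
        have h1 := polyNorm_derivative_le v (F.coeff j) (hd j)
        have h2 := polyNorm_derivative_le v a (hd F.natDegree)
        have h3 := hM v j
        have h4 : polyNorm v a ≤ M := hM v F.natDegree
        have h5 : (0 : ℝ) ≤ d := by positivity
        refine (RingSeminorm.sub_le_of_le _ (RingSeminorm.mul_le_of_le _ h4
          (h1.trans (mul_le_mul_of_nonneg_left h3 h5))) (RingSeminorm.mul_le_of_le _
          (h2.trans (mul_le_mul_of_nonneg_left h4 h5)) h3)).trans ?_
        nlinarith [mul_nonneg (by linarith : 0 ≤ M) (by linarith : 0 ≤ M)]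
      · rw [hF₁, eval₂_sub, eval₂_mul, eval₂_mul, eval₂_C, eval₂_C, eval₂_coeffDeriv]
        exact dvd_sub (Dvd.dvd.mul_left (pow_sub_one_dvd_derivative_of_pow_dvd hdvd) _)
          (Dvd.dvd.mul_left (dvd_trans (pow_dvd_pow _ (Nat.sub_le w 1)) hdvd) _)

end Roth

end VojtaCurve

namespace VojtaCurve

open Polynomial

section XDegree

variable {R : Type*} [CommRing R]

/-- The degree of `F ∈ R[X][Y]` in the inner variable. -/
noncomputable def xDegree (F : R[X][X]) : ℕ := F.support.sup fun j => (F.coeff j).natDegree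

theorem xDegree_le_iff {F : R[X][X]} {d : ℕ} :
    xDegree F ≤ d ↔ ∀ j, (F.coeff j).natDegree ≤ d := by
  rw [xDegree, Finset.sup_le_iff]
  refine ⟨fun h j => ?_, fun h j _ => h j⟩
  by_cases hj : j ∈ F.support
  · exact h j hj
  · simp [notMem_support_iff.mp hj]

theorem natDegree_coeff_le_xDegree (F : R[X][X]) (j : ℕ) : (F.coeff j).natDegree ≤ xDegree F :=
  xDegree_le_iff.mp le_rfl j

theorem xDegree_add_le (F G : R[X][X]) : xDegree (F + G) ≤ max (xDegree F) (xDegree G) :=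
  xDegree_le_iff.mpr fun j => by
    rw [coeff_add]
    exact (natDegree_add_le _ _).trans
      (max_le_max (natDegree_coeff_le_xDegree F j) (natDegree_coeff_le_xDegree G j))

theorem xDegree_sub_le (F G : R[X][X]) : xDegree (F - G) ≤ max (xDegree F) (xDegree G) :=
  xDegree_le_iff.mpr fun j => by
    rw [coeff_sub]
    exact (natDegree_sub_le _ _).trans
      (max_le_max (natDegree_coeff_le_xDegree F j) (natDegree_coeff_le_xDegree G j))

theorem xDegree_mul_le (F G : R[X][X]) : xDegree (F * G) ≤ xDegree F + xDegree G :=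
  xDegree_le_iff.mpr fun j => by
    rw [coeff_mul]
    exact natDegree_sum_le_of_forall_le _ _ fun p _ => natDegree_mul_le.trans
      (Nat.add_le_add (natDegree_coeff_le_xDegree F _) (natDegree_coeff_le_xDegree G _))

theorem xDegree_C_le (a : R[X]) : xDegree (C a) ≤ a.natDegree :=
  xDegree_le_iff.mpr fun j => by
    rw [coeff_C]
    split_ifs <;> simp

theorem xDegree_map_C (p : R[X]) : xDegree (p.map C) = 0 :=
  Nat.le_zero.mp <| xDegree_le_iff.mpr fun j => by rw [coeff_map, natDegree_C]

end XDegree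

section Norm

variable {R : Type*} [CommRing R]

/-- The ring `R[η₁, η₂]` with `η₁² = g₁` and `η₂² = g₂`. -/
def Biquad (g₁ g₂ : R) : Type _ :=
  QuadraticAlgebra (QuadraticAlgebra R g₁ 0) (.C g₂) 0

variable {g₁ g₂ : R}

instance : CommRing (Biquad g₁ g₂) :=
  inferInstanceAs (CommRing (QuadraticAlgebra (QuadraticAlgebra R g₁ 0) (.C g₂) 0))

namespace Biquad

/-- The element `p + q η₁ + r η₂ + s η₁ η₂` of `R[η₁, η₂]`. -/
def mk (p q r s : R) : Biquad g₁ g₂ := QuadraticAlgebra.mk ⟨p, q⟩ ⟨r, s⟩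

variable (F G : Biquad g₁ g₂)

theorem mul_eq : F * G = mk
    (F.re.re * G.re.re + g₁ * F.re.im * G.re.im +
      (g₂ * F.im.re * G.im.re + g₁ * (g₂ * F.im.im) * G.im.im))
    (F.re.re * G.re.im + F.re.im * G.re.re +
      (g₂ * F.im.re * G.im.im + g₂ * F.im.im * G.im.re))
    (F.re.re * G.im.re + g₁ * F.re.im * G.im.im +
      (F.im.re * G.re.re + g₁ * F.im.im * G.re.im))
    (F.re.re * G.im.im + F.re.im * G.im.re + (F.im.re * G.re.im + F.im.im * G.re.re)) := by
  have key (F G : QuadraticAlgebra (QuadraticAlgebra R g₁ 0) (.C g₂) 0) : F * G =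
      ⟨⟨F.re.re * G.re.re + g₁ * F.re.im * G.re.im +
          (g₂ * F.im.re * G.im.re + g₁ * (g₂ * F.im.im) * G.im.im),
        F.re.re * G.re.im + F.re.im * G.re.re + (g₂ * F.im.re * G.im.im + g₂ * F.im.im * G.im.re)⟩,
        ⟨F.re.re * G.im.re + g₁ * F.re.im * G.im.im + (F.im.re * G.re.re + g₁ * F.im.im * G.re.im),
        F.re.re * G.im.im + F.re.im * G.im.re + (F.im.re * G.re.im + F.im.im * G.re.re)⟩⟩ := by
    refine QuadraticAlgebra.ext (QuadraticAlgebra.ext ?_ ?_) (QuadraticAlgebra.ext ?_ ?_) <;>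
      simp only [QuadraticAlgebra.re_mul, QuadraticAlgebra.im_mul, QuadraticAlgebra.re_add,
        QuadraticAlgebra.im_add, QuadraticAlgebra.re_C, QuadraticAlgebra.im_C, zero_mul, add_zero,
        mul_zero]
  exact key F G

end Biquad

/-- The inclusion of `R` in `R[η₁, η₂]`. -/
def biC : R →+* Biquad g₁ g₂ :=
  (algebraMap (QuadraticAlgebra R g₁ 0) (QuadraticAlgebra (QuadraticAlgebra R g₁ 0) (.C g₂) 0)).comp
    (algebraMap R (QuadraticAlgebra R g₁ 0))

theorem biC_apply (r : R) : (biC r : Biquad g₁ g₂) = .mk r 0 0 0 := rfl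

/-- The norm from `R[η₁, η₂]` to `R`. -/
def biNorm (F : Biquad g₁ g₂) : R :=
  QuadraticAlgebra.norm (QuadraticAlgebra.norm (R := QuadraticAlgebra R g₁ 0) (b := 0) F)

theorem biNorm_eq (F : Biquad g₁ g₂) : biNorm F =
    (F.re.re ^ 2 + g₁ * F.re.im ^ 2 - g₂ * (F.im.re ^ 2 + g₁ * F.im.im ^ 2)) ^ 2 -
      g₁ * (2 * (F.re.re * F.re.im - g₂ * (F.im.re * F.im.im))) ^ 2 := by
  have key (F : QuadraticAlgebra (QuadraticAlgebra R g₁ 0) (.C g₂) 0) : F.norm.norm =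
      (F.re.re ^ 2 + g₁ * F.re.im ^ 2 - g₂ * (F.im.re ^ 2 + g₁ * F.im.im ^ 2)) ^ 2 -
        g₁ * (2 * (F.re.re * F.re.im - g₂ * (F.im.re * F.im.im))) ^ 2 := by
    simp only [QuadraticAlgebra.norm_def, QuadraticAlgebra.re_mul, QuadraticAlgebra.im_mul,
      QuadraticAlgebra.re_sub, QuadraticAlgebra.im_sub, QuadraticAlgebra.re_add,
      QuadraticAlgebra.im_add, QuadraticAlgebra.re_zero, QuadraticAlgebra.im_zero,
      QuadraticAlgebra.re_C, QuadraticAlgebra.im_C]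
    ring
  exact key F

theorem dvd_biC_biNorm (F : Biquad g₁ g₂) : F ∣ biC (biNorm F) := by
  have key (F : QuadraticAlgebra (QuadraticAlgebra R g₁ 0) (.C g₂) 0) :
      .C (.C F.norm.norm) = F * (star F * algebraMap _ _ (star F.norm)) := by
    rw [← mul_assoc, ← QuadraticAlgebra.algebraMap_norm_eq_mul_star, ← map_mul,
      ← QuadraticAlgebra.algebraMap_norm_eq_mul_star]
    rfl
  exact ⟨_, key F⟩

theorem biNorm_ne_zero [IsDomain R] (h2 : (2 : R) ≠ 0) (h₁ : ∀ p q : R, p ^ 2 = g₁ * q ^ 2 → q = 0)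
    (h₂ : ∀ p q : R, p ^ 2 = g₂ * q ^ 2 → q = 0) (h₃ : ∀ p q : R, p ^ 2 = g₁ * g₂ * q ^ 2 → q = 0)
    {F : Biquad g₁ g₂} (hF : F ≠ 0) : biNorm F ≠ 0 := by
  have key (z : QuadraticAlgebra R g₁ 0) (hz : z.norm = 0) : z = 0 := by
    rw [QuadraticAlgebra.norm_def] at hz
    have h := h₁ z.re z.im (by linear_combination hz)
    rw [h] at hz
    have h' : z.re = 0 := by simpa using hz
    ext <;> assumption
  intro h
  have h0 : F.re * F.re + 0 * F.re * F.im - .C g₂ * F.im * F.im = 0 := key _ h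
  rw [zero_mul, zero_mul, add_zero] at h0
  have him : F.im = 0 := by
    set z := F.re * star F.im with hz
    set n := F.im.norm with hn
    have h3 : z * z = .C (g₂ * n ^ 2) := by
      have h4 : (algebraMap R (QuadraticAlgebra R g₁ 0) n) = F.im * star F.im :=
        QuadraticAlgebra.algebraMap_norm_eq_mul_star _
      have h5 : (QuadraticAlgebra.C (g₂ * n ^ 2) : QuadraticAlgebra R g₁ 0) =
          .C g₂ * (algebraMap R (QuadraticAlgebra R g₁ 0) n * algebraMap R _ n) := by
        rw [← map_mul]
        change _ = (QuadraticAlgebra.C g₂ : QuadraticAlgebra R g₁ 0) * .C (n * n)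
        ext <;> simp [sq]
      rw [h5, h4, hz]
      linear_combination (star F.im * star F.im) * h0
    have hre := congrArg QuadraticAlgebra.re h3
    have himm := congrArg QuadraticAlgebra.im h3
    simp only [QuadraticAlgebra.re_mul, QuadraticAlgebra.im_mul, QuadraticAlgebra.re_C,
      QuadraticAlgebra.im_C, zero_mul, add_zero] at hre himm
    have h6 : z.re * z.im = 0 := by
      refine (mul_eq_zero.mp ?_).resolve_left h2
      linear_combination himm
    refine key _ ?_
    rcases mul_eq_zero.mp h6 with h7 | h7 <;> rw [h7] at hre
    · exact h₃ (g₁ * z.im) n (by linear_combination g₁ * hre)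
    · exact h₂ z.re n (by linear_combination hre)
  rw [him, mul_zero, sub_zero] at h0
  have hre : F.re = 0 := by
    refine key _ ?_
    have := congrArg QuadraticAlgebra.norm h0
    rw [map_mul, QuadraticAlgebra.norm_zero] at this
    exact mul_self_eq_zero.mp this
  exact hF (QuadraticAlgebra.ext hre him)

theorem seminorm_biNorm_le (ν : RingSeminorm R) (h1 : ν 1 ≤ 1) {F : Biquad g₁ g₂} {G M : ℝ}
    (hG : 1 ≤ G) (hg₁ : ν g₁ ≤ G) (hg₂ : ν g₂ ≤ G) (hrr : ν F.re.re ≤ M) (hri : ν F.re.im ≤ M)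
    (hir : ν F.im.re ≤ M) (hii : ν F.im.im ≤ M) : ν (biNorm F) ≤ 32 * G ^ 5 * M ^ 4 := by
  have hM : 0 ≤ M := (apply_nonneg ν _).trans hrr
  have h2 : ν 2 ≤ 2 := by exact_mod_cast RingSeminorm.natCast_le ν h1 2
  rw [biNorm_eq]
  have hsq {a : R} {b : ℝ} (h : ν a ≤ b) := RingSeminorm.pow_le_of_le ν h1 h 2
  have hre := RingSeminorm.add_le_of_le ν (hsq hrr) (RingSeminorm.mul_le_of_le ν hg₁ (hsq hri))
  have hre' := RingSeminorm.sub_le_of_le ν hre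
    (RingSeminorm.mul_le_of_le ν hg₂ (RingSeminorm.add_le_of_le ν (hsq hir)
      (RingSeminorm.mul_le_of_le ν hg₁ (hsq hii))))
  have him := RingSeminorm.mul_le_of_le ν h2 (RingSeminorm.sub_le_of_le ν
    (RingSeminorm.mul_le_of_le ν hrr hri)
    (RingSeminorm.mul_le_of_le ν hg₂ (RingSeminorm.mul_le_of_le ν hir hii)))
  refine (RingSeminorm.sub_le_of_le ν (hsq hre') (RingSeminorm.mul_le_of_le ν hg₁ (hsq him))).trans
    ?_
  have h3 : M ^ 2 + G * M ^ 2 + G * (M ^ 2 + G * M ^ 2) ≤ 4 * (G ^ 2 * M ^ 2) := by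
    nlinarith [mul_nonneg (sq_nonneg M) (by nlinarith : 0 ≤ 3 * G ^ 2 - 2 * G - 1)]
  have h4 : 2 * (M * M + G * (M * M)) ≤ 4 * (G ^ 2 * M ^ 2) := by
    nlinarith [mul_nonneg (sq_nonneg M) (by nlinarith : 0 ≤ 2 * G ^ 2 - G - 1)]
  have h5 := pow_le_pow_left₀ (by positivity) h3 2
  have h6 := pow_le_pow_left₀ (by positivity) h4 2
  have h7 : 0 ≤ G ^ 4 * M ^ 4 := by positivity
  nlinarith [mul_le_mul_of_nonneg_left h6 (by linarith : 0 ≤ G), mul_nonneg h7 (sub_nonneg.mpr hG)]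

theorem degree_biNorm_le (δ : R → ℕ) (hadd : ∀ a b, δ (a + b) ≤ max (δ a) (δ b))
    (hsub : ∀ a b, δ (a - b) ≤ max (δ a) (δ b)) (hmul : ∀ a b, δ (a * b) ≤ δ a + δ b)
    (h2 : δ 2 = 0) {F : Biquad g₁ g₂} {e m : ℕ} (hg₁ : δ g₁ ≤ e) (hg₂ : δ g₂ ≤ e)
    (hrr : δ F.re.re ≤ m) (hri : δ F.re.im ≤ m) (hir : δ F.im.re ≤ m) (hii : δ F.im.im ≤ m) :
    δ (biNorm F) ≤ 4 * m + 4 * e := by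
  have ha {a b : R} {k : ℕ} (h : δ a ≤ k) (h' : δ b ≤ k) : δ (a + b) ≤ k :=
    (hadd a b).trans (max_le h h')
  have hs {a b : R} {k : ℕ} (h : δ a ≤ k) (h' : δ b ≤ k) : δ (a - b) ≤ k :=
    (hsub a b).trans (max_le h h')
  have hm {a b : R} {k l : ℕ} (h : δ a ≤ k) (h' : δ b ≤ l) : δ (a * b) ≤ k + l :=
    (hmul a b).trans (Nat.add_le_add h h')
  have hq {a : R} {k : ℕ} (h : δ a ≤ k) : δ (a ^ 2) ≤ k + k := by
    rw [sq]; exact hm h h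
  rw [biNorm_eq]
  have hre : δ (F.re.re ^ 2 + g₁ * F.re.im ^ 2 - g₂ * (F.im.re ^ 2 + g₁ * F.im.im ^ 2)) ≤
      2 * m + 2 * e := by
    refine hs (ha ((hq hrr).trans (by omega)) ((hm hg₁ (hq hri)).trans (by omega)))
      ((hm hg₂ (ha ((hq hir).trans ?_) (hm hg₁ (hq hii)))).trans ?_) <;> omega
  have him : δ (2 * (F.re.re * F.re.im - g₂ * (F.im.re * F.im.im))) ≤ 2 * m + e := by
    refine (hm h2.le (hs ((hm hrr hri).trans ?_) (hm hg₂ (hm hir hii)))).trans ?_ <;> omega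
  exact hs ((hq hre).trans (by omega)) ((hm hg₁ (hq him)).trans (by omega))

end Norm

section Nonsquare

variable {R : Type*} [CommRing R] [IsDomain R]

theorem eq_zero_of_sq_eq_of_odd_natDegree {g p q : R[X]} (hg : Odd g.natDegree)
    (h : p ^ 2 = g * q ^ 2) : q = 0 := by
  by_contra hq
  have hg0 : g ≠ 0 := by rintro rfl; simp at hg
  have := congrArg natDegree h
  rw [natDegree_pow, natDegree_mul hg0 (pow_ne_zero 2 hq), natDegree_pow] at this
  obtain ⟨k, hk⟩ := hg
  omega

theorem eq_zero_of_sq_eq_of_odd_rootMultiplicity {g p q : R[X]} {c : R}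
    (hg : Odd (g.rootMultiplicity c)) (h : p ^ 2 = g * q ^ 2) : q = 0 := by
  by_contra hq
  have hg0 : g ≠ 0 := by rintro rfl; simp at hg
  have hp (s : R[X]) (hs : s ≠ 0) : (s ^ 2).rootMultiplicity c = 2 * s.rootMultiplicity c := by
    rw [sq, rootMultiplicity_mul (mul_ne_zero hs hs), two_mul]
  have h0 : g * q ^ 2 ≠ 0 := mul_ne_zero hg0 (pow_ne_zero 2 hq)
  have hp0 : p ≠ 0 := by rintro rfl; rw [← h] at h0; simp at h0
  have := congrArg (rootMultiplicity c) h
  rw [hp p hp0, rootMultiplicity_mul h0, hp q hq] at this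
  obtain ⟨k, hk⟩ := hg
  omega

end Nonsquare

end VojtaCurve

namespace VojtaCurve

open Polynomial

section Weights

variable {R : Type*} [CommRing R]

/-- `F ∈ R[X][Y]` has degree at most `d / 2` in the inner and at most `e / 2` in the outer
variable; a negative `d` or `e` forces `F = 0`. -/
def Wt (d e : ℤ) (F : R[X][X]) : Prop :=
  ∀ i j : ℕ, (F.coeff j).coeff i ≠ 0 → 2 * (i : ℤ) ≤ d ∧ 2 * (j : ℤ) ≤ e

theorem Wt.mono {d e d' e' : ℤ} {F : R[X][X]} (h : Wt d e F) (hd : d ≤ d') (he : e ≤ e') :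
    Wt d' e' F := fun i j hij => ⟨(h i j hij).1.trans hd, (h i j hij).2.trans he⟩

theorem Wt.zero {d e : ℤ} : Wt d e (0 : R[X][X]) := fun i j h => by simp at h

theorem Wt.add {d e : ℤ} {F G : R[X][X]} (hF : Wt d e F) (hG : Wt d e G) : Wt d e (F + G) := by
  intro i j h
  rw [coeff_add, coeff_add] at h
  by_cases hf : (F.coeff j).coeff i = 0
  · exact hG i j (by rwa [hf, zero_add] at h)
  · exact hF i j hf

theorem Wt.neg {d e : ℤ} {F : R[X][X]} (hF : Wt d e F) : Wt d e (-F) := by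
  intro i j h
  rw [coeff_neg, coeff_neg, neg_ne_zero] at h
  exact hF i j h

theorem Wt.sub {d e : ℤ} {F G : R[X][X]} (hF : Wt d e F) (hG : Wt d e G) : Wt d e (F - G) := by
  rw [sub_eq_add_neg]
  exact hF.add hG.neg

theorem Wt.mul {d e d' e' : ℤ} {F G : R[X][X]} (hF : Wt d e F) (hG : Wt d' e' G) :
    Wt (d + d') (e + e') (F * G) := by
  intro i j h
  rw [coeff_mul, finsetSum_coeff] at h
  obtain ⟨p, hp, h⟩ := Finset.exists_ne_zero_of_sum_ne_zero h
  rw [coeff_mul] at h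
  obtain ⟨q, hq, h⟩ := Finset.exists_ne_zero_of_sum_ne_zero h
  have h1 := hF _ _ (left_ne_zero_of_mul h)
  have h2 := hG _ _ (right_ne_zero_of_mul h)
  rw [Finset.HasAntidiagonal.mem_antidiagonal] at hp hq
  omega

theorem Wt.one : Wt 0 0 (1 : R[X][X]) := by
  intro i j h
  rw [← C_1, coeff_C] at h
  split_ifs at h with hj
  · rw [← C_1, coeff_C] at h
    split_ifs at h with hi
    · omega
    · exact absurd rfl h
  · simp at h

theorem Wt.C {a : R[X]} {m : ℕ} (h : a.natDegree ≤ m) : Wt (2 * m) 0 (C a) := by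
  intro i j hij
  rw [coeff_C] at hij
  split_ifs at hij with hj
  · have := le_natDegree_of_ne_zero hij
    omega
  · simp at hij

theorem Wt.X : Wt 0 2 (X : R[X][X]) := by
  intro i j h
  rw [coeff_X] at h
  split_ifs at h with hj
  · rw [← C_1, coeff_C] at h
    split_ifs at h with hi
    · omega
    · exact absurd rfl h
  · simp at h

theorem Wt.map_C {p : R[X]} {m : ℕ} (h : p.natDegree ≤ m) : Wt 0 (2 * m) (p.map Polynomial.C) := by
  intro i j hij
  rw [coeff_map, coeff_C] at hij
  split_ifs at hij with hi
  · have := le_natDegree_of_ne_zero hij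
    omega
  · exact absurd rfl hij

variable {g₁ g₂ : R[X][X]}

/-- The degree filtration on `R[X][Y][η₁, η₂]` for which `η₁` and `η₂` have degree `3 / 2` in both
variables. -/
def BiWt (d e : ℤ) (F : Biquad g₁ g₂) : Prop :=
  Wt d e F.re.re ∧ Wt (d - 3) (e - 3) F.re.im ∧ Wt (d - 3) (e - 3) F.im.re ∧
    Wt (d - 6) (e - 6) F.im.im

theorem BiWt.mono {d e d' e' : ℤ} {F : Biquad g₁ g₂} (h : BiWt d e F) (hd : d ≤ d') (he : e ≤ e') :
    BiWt d' e' F :=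
  ⟨h.1.mono hd he, h.2.1.mono (by omega) (by omega), h.2.2.1.mono (by omega) (by omega),
    h.2.2.2.mono (by omega) (by omega)⟩

theorem BiWt.add {d e : ℤ} {F G : Biquad g₁ g₂} (hF : BiWt d e F) (hG : BiWt d e G) :
    BiWt d e (F + G) :=
  ⟨hF.1.add hG.1, hF.2.1.add hG.2.1, hF.2.2.1.add hG.2.2.1, hF.2.2.2.add hG.2.2.2⟩

theorem BiWt.sub {d e : ℤ} {F G : Biquad g₁ g₂} (hF : BiWt d e F) (hG : BiWt d e G) :
    BiWt d e (F - G) :=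
  ⟨hF.1.sub hG.1, hF.2.1.sub hG.2.1, hF.2.2.1.sub hG.2.2.1, hF.2.2.2.sub hG.2.2.2⟩

theorem BiWt.mul (hg₁ : Wt 6 6 g₁) (hg₂ : Wt 6 6 g₂) {d e d' e' : ℤ} {F G : Biquad g₁ g₂}
    (hF : BiWt d e F) (hG : BiWt d' e' G) : BiWt (d + d') (e + e') (F * G) := by
  obtain ⟨f1, f2, f3, f4⟩ := hF
  obtain ⟨k1, k2, k3, k4⟩ := hG
  rw [Biquad.mul_eq]
  refine ⟨.add (.add ?_ ?_) (.add ?_ ?_), .add (.add ?_ ?_) (.add ?_ ?_),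
    .add (.add ?_ ?_) (.add ?_ ?_), .add (.add ?_ ?_) (.add ?_ ?_)⟩
  · exact f1.mul k1
  · exact ((hg₁.mul f2).mul k2).mono (by omega) (by omega)
  · exact ((hg₂.mul f3).mul k3).mono (by omega) (by omega)
  · exact ((hg₁.mul (hg₂.mul f4)).mul k4).mono (by omega) (by omega)
  · exact (f1.mul k2).mono (by omega) (by omega)
  · exact (f2.mul k1).mono (by omega) (by omega)
  · exact ((hg₂.mul f3).mul k4).mono (by omega) (by omega)
  · exact ((hg₂.mul f4).mul k3).mono (by omega) (by omega)
  · exact (f1.mul k3).mono (by omega) (by omega)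
  · exact ((hg₁.mul f2).mul k4).mono (by omega) (by omega)
  · exact (f3.mul k1).mono (by omega) (by omega)
  · exact ((hg₁.mul f4).mul k2).mono (by omega) (by omega)
  · exact (f1.mul k4).mono (by omega) (by omega)
  · exact (f2.mul k3).mono (by omega) (by omega)
  · exact (f3.mul k2).mono (by omega) (by omega)
  · exact (f4.mul k1).mono (by omega) (by omega)

theorem BiWt.biC {d e : ℤ} {a : R[X][X]} (h : Wt d e a) : BiWt d e (biC a : Biquad g₁ g₂) :=
  ⟨h, Wt.zero, Wt.zero, Wt.zero⟩

theorem BiWt.pow (hg₁ : Wt 6 6 g₁) (hg₂ : Wt 6 6 g₂) {d e : ℤ} {F : Biquad g₁ g₂}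
    (hF : BiWt d e F) (n : ℕ) : BiWt (n * d) (n * e) (F ^ n) := by
  induction n with
  | zero => simpa [map_one] using BiWt.biC (g₁ := g₁) (g₂ := g₂) (Wt.one (R := R))
  | succ n ih =>
    rw [pow_succ]
    exact (BiWt.mul hg₁ hg₂ ih hF).mono (by push_cast; linarith) (by push_cast; linarith)

end Weights

section Eta

variable {R : Type*} [CommRing R] {g₁ g₂ : R}

/-- The square root of `g₁` in `R[η₁, η₂]`. -/
def eta₁ : Biquad g₁ g₂ := .mk 0 1 0 0

/-- The square root of `g₂` in `R[η₁, η₂]`. -/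
def eta₂ : Biquad g₁ g₂ := .mk 0 0 1 0

/-- The sum of the values of a seminorm at the coordinates of an element of `R[η₁, η₂]`, weighted
so as to be submultiplicative. -/
noncomputable def biSeminorm (ν : RingSeminorm R) (κ : NNReal) (h₁ : ν g₁ ≤ κ ^ 2)
    (h₂ : ν g₂ ≤ κ ^ 2) : RingSeminorm (Biquad g₁ g₂) :=
  quadSeminorm (quadSeminorm ν κ h₁) κ (by rwa [quadSeminorm_C])

variable {ν : RingSeminorm R} {κ : NNReal} {h₁ : ν g₁ ≤ κ ^ 2} {h₂ : ν g₂ ≤ κ ^ 2}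

theorem biSeminorm_apply (F : Biquad g₁ g₂) : biSeminorm ν κ h₁ h₂ F =
    ν F.re.re + κ * ν F.re.im + κ * (ν F.im.re + κ * ν F.im.im) := rfl

@[simp] theorem biSeminorm_biC (a : R) : biSeminorm ν κ h₁ h₂ (biC a) = ν a := by
  rw [biSeminorm_apply]
  simp [biC_apply, Biquad.mk]

theorem biSeminorm_one_le (h1 : ν 1 ≤ 1) : biSeminorm ν κ h₁ h₂ 1 ≤ 1 := by
  rwa [← map_one biC, biSeminorm_biC]

theorem biSeminorm_eta₁_le (h1 : ν 1 ≤ 1) : biSeminorm ν κ h₁ h₂ eta₁ ≤ κ := by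
  have := mul_le_mul_of_nonneg_left h1 κ.2
  rw [biSeminorm_apply]
  simpa [eta₁, Biquad.mk] using this.trans (mul_one _).le

theorem biSeminorm_eta₂_le (h1 : ν 1 ≤ 1) : biSeminorm ν κ h₁ h₂ eta₂ ≤ κ := by
  have := mul_le_mul_of_nonneg_left h1 κ.2
  rw [biSeminorm_apply]
  simpa [eta₂, Biquad.mk]
    using this.trans (mul_one _).le

theorem components_le_biSeminorm (hκ : 1 ≤ κ) (F : Biquad g₁ g₂) :
    ν F.re.re ≤ biSeminorm ν κ h₁ h₂ F ∧ ν F.re.im ≤ biSeminorm ν κ h₁ h₂ F ∧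
      ν F.im.re ≤ biSeminorm ν κ h₁ h₂ F ∧ ν F.im.im ≤ biSeminorm ν κ h₁ h₂ F := by
  have hκ' : (1 : ℝ) ≤ κ := hκ
  rw [biSeminorm_apply]
  have h1 := apply_nonneg ν F.re.re
  have h2 := apply_nonneg ν F.re.im
  have h3 := apply_nonneg ν F.im.re
  have h4 := apply_nonneg ν F.im.im
  have h5 := le_mul_of_one_le_left h2 hκ'
  have h6 := le_mul_of_one_le_left h4 hκ'
  have h7 : 0 ≤ ν F.im.re + κ * ν F.im.im := by positivity
  have h8 := le_mul_of_one_le_left h7 hκ'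
  refine ⟨?_, ?_, ?_, ?_⟩ <;> linarith

end Eta

section Aux

variable {R : Type*} [CommRing R]

/-- The polynomial `f(x) f(u)` for the cubic `f = X³ + α X² + β X`. -/
noncomputable def cubicProd (α β : R) : R[X][X] := C (cubic α β) * (cubic α β).map C

/-- The denominator of the abscissae of `2 ^ k P ± Q`. -/
noncomputable def auxD (α β : R) (k : ℕ) : R[X][X] := (C (duplA α β k) - X * C (duplB α β k)) ^ 2

/-- The rational part of the numerator of the abscissae of `2 ^ k P ± Q`. -/
noncomputable def auxS (α β : R) (k : ℕ) : R[X][X] :=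
  (C (duplA α β k) + X * C (duplB α β k)) *
      (C (duplA α β k) * X + C (C β) * C (duplB α β k)) +
    2 * C (C α) * C (duplA α β k) * C (duplB α β k) * X

/-- The numerator of the product of the abscissae of `2 ^ k P ± Q`. -/
noncomputable def auxW (α β : R) (k : ℕ) : R[X][X] :=
  (C (duplA α β k) * X - C (C β) * C (duplB α β k)) ^ 2

variable (α β : R) (k : ℕ)

theorem auxS_sq_sub : auxS α β k ^ 2 - 4 * C (duplG α β k) ^ 2 * cubicProd α β =
    auxD α β k * auxW α β k := by
  have h := congrArg (C : R[X] → R[X][X]) (duplB_curve α β k)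
  have hmap : (cubic α β).map C = X ^ 3 + C (C α) * X ^ 2 + C (C β) * X := by
    simp [cubic]
  simp only [C_mul, C_add, C_pow] at h
  rw [cubicProd, auxS, auxD, auxW, hmap]
  linear_combination 4 * (X ^ 3 + C (C α) * X ^ 2 + C (C β) * X) * h

theorem cubicProd_wt [Nontrivial R] : Wt 6 6 (cubicProd α β) :=
  ((Wt.C (cubic_natDegree_le α β)).mul (Wt.map_C (cubic_natDegree_le α β))).mono (by simp) (by simp)

variable [Nontrivial R]

theorem aux_wt : Wt (4 * 4 ^ k) 4 (auxD α β k) ∧ Wt (4 * 4 ^ k) 4 (auxS α β k) ∧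
    Wt (4 * 4 ^ k) 4 (auxW α β k) ∧ Wt (4 * 4 ^ k - 4) 0 (C (duplG α β k)) := by
  obtain ⟨-, hA, hB, hG⟩ := dupl_degree α β k
  have wA : Wt (2 * 4 ^ k) 0 (C (duplA α β k)) := (Wt.C hA.le).mono (by simp) le_rfl
  have wB : Wt (2 * 4 ^ k) 0 (C (duplB α β k)) := (Wt.C hB.le).mono (by simp) le_rfl
  have wc (c : R) : Wt 0 0 (C (C c)) := (Wt.C (natDegree_C c).le).mono (by simp) le_rfl
  have w2 : Wt 0 0 (2 : R[X][X]) := by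
    simpa only [map_ofNat] using wc 2
  have w1 := (wA.mono (le_refl _) (by norm_num : (0 : ℤ) ≤ 2)).sub
    ((Wt.X.mul wB).mono (by simp) (by simp))
  have w1' := (wA.mono (le_refl _) (by norm_num : (0 : ℤ) ≤ 2)).add
    ((Wt.X.mul wB).mono (by simp) (by simp))
  have w3 := ((wA.mul Wt.X).mono (by simp : _ ≤ 2 * (4 : ℤ) ^ k) (by simp : _ ≤ (2 : ℤ))).sub
    (((wc β).mul wB).mono (by simp) (by simp))
  have w3' := ((wA.mul Wt.X).mono (by simp : _ ≤ 2 * (4 : ℤ) ^ k) (by simp : _ ≤ (2 : ℤ))).add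
    (((wc β).mul wB).mono (by simp) (by simp))
  refine ⟨?_, ?_, ?_, ?_⟩
  · rw [auxD, sq]
    exact (w1.mul w1).mono (by ring_nf; rfl) (by norm_num)
  · rw [auxS]
    exact ((w1'.mul w3').mono (by ring_nf; rfl) (by norm_num)).add
      (((((w2.mul (wc α)).mul wA).mul wB).mul Wt.X).mono (by ring_nf; rfl) (by norm_num))
  · rw [auxW, sq]
    exact (w3.mul w3).mono (by ring_nf; rfl) (by norm_num)
  · refine (Wt.C (m := 2 * 4 ^ k - 2) (by omega)).mono ?_ le_rfl
    have : 2 ≤ 2 * 4 ^ k := by have := Nat.one_le_pow k 4 (by norm_num); omega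
    push_cast [Nat.cast_sub this]
    linarith

end Aux

end VojtaCurve

namespace VojtaCurve

open Polynomial

section Pair

variable {R B : Type*} [CommRing R] [CommRing B] (φ : R[X][X] →+* B) (α β : R) (k : ℕ) (e : B)

/-- The numerators of two fractions representing the abscissa of `2 ^ k P + Q`. -/
noncomputable def auxNum (s : Bool) : B :=
  bif s then φ (auxW α β k) else φ (auxS α β k) + 2 * φ (C (duplG α β k)) * e

/-- The denominators of two fractions representing the abscissa of `2 ^ k P + Q`. -/
noncomputable def auxDen (s : Bool) : B :=
  bif s then φ (auxS α β k) - 2 * φ (C (duplG α β k)) * e else φ (auxD α β k)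

variable {e}

theorem auxNum_mul_auxDen (he : e * e = φ (cubicProd α β)) :
    auxNum φ α β k e false * auxDen φ α β k e true =
      auxNum φ α β k e true * auxDen φ α β k e false := by
  have h := congrArg φ (auxS_sq_sub α β k)
  simp only [map_sub, map_mul, map_pow, map_ofNat, ← he] at h
  simp only [auxNum, auxDen, cond_true, cond_false]
  linear_combination h

theorem map_auxNum {B' : Type*} [CommRing B'] (ψ : B →+* B') (s : Bool) :
    ψ (auxNum φ α β k e s) = auxNum (ψ.comp φ) α β k (ψ e) s := by
  cases s <;> simp [auxNum, map_ofNat ψ 2]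

theorem map_auxDen {B' : Type*} [CommRing B'] (ψ : B →+* B') (s : Bool) :
    ψ (auxDen φ α β k e s) = auxDen (ψ.comp φ) α β k (ψ e) s := by
  cases s <;> simp [auxDen, map_ofNat ψ 2]

end Pair

section Weights

variable {R : Type*} [CommRing R] [Nontrivial R] {g₁ g₂ : R[X][X]} (α β : R) (k : ℕ)
  {e : Biquad g₁ g₂}

theorem aux_biWt (hg₁ : Wt 6 6 g₁) (hg₂ : Wt 6 6 g₂) (he : BiWt 3 3 e) (s : Bool) :
    BiWt (4 * 4 ^ k) 4 (auxNum biC α β k e s) ∧ BiWt (4 * 4 ^ k) 4 (auxDen biC α β k e s) := by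
  obtain ⟨hD, hS, hW, hG⟩ := aux_wt α β k
  have w2 : BiWt 0 0 (2 : Biquad g₁ g₂) := by
    have : Wt 0 0 (2 : R[X][X]) := by
      simpa only [map_ofNat] using (Wt.C (natDegree_C (2 : R)).le).mono (by simp) le_rfl
    simpa only [map_ofNat] using BiWt.biC (g₁ := g₁) (g₂ := g₂) this
  have h : BiWt (4 * 4 ^ k) 4 (2 * biC (C (duplG α β k)) * e) :=
    (((w2.mul hg₁ hg₂ (.biC hG)).mul hg₁ hg₂ he)).mono (by linarith) (by norm_num)
  cases s
  · exact ⟨(BiWt.biC hS).add h, .biC hD⟩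
  · exact ⟨.biC hW, (BiWt.biC hS).sub h⟩

end Weights

theorem aux_seminorm_le_of_le {B : Type*} [CommRing B] (μ : RingSeminorm B) (h1 : μ 1 ≤ 1)
    {c t : ℝ} (hc : 1 ≤ c) {a b g x α β e : B} (ha : μ a ≤ t) (hb : μ b ≤ t) (hg : μ g ≤ t ^ 2)
    (hα : μ α ≤ c) (hβ : μ β ≤ c) (hx : μ x ≤ c) (he : μ e ≤ 3 * c) :
    μ ((a - x * b) ^ 2) ≤ 12 * c ^ 2 * t ^ 2 ∧ μ ((a * x - β * b) ^ 2) ≤ 12 * c ^ 2 * t ^ 2 ∧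
      μ ((a + x * b) * (a * x + β * b) + 2 * α * a * b * x + 2 * g * e) ≤ 12 * c ^ 2 * t ^ 2 ∧
      μ ((a + x * b) * (a * x + β * b) + 2 * α * a * b * x - 2 * g * e) ≤ 12 * c ^ 2 * t ^ 2 := by
  have h2 : μ (2 : B) ≤ 2 := mod_cast RingSeminorm.natCast_le μ h1 2
  have hlin : μ (a - x * b) ≤ t + c * t :=
    RingSeminorm.sub_le_of_le μ ha (RingSeminorm.mul_le_of_le μ hx hb)
  have hlin' : μ (a + x * b) ≤ t + c * t :=
    RingSeminorm.add_le_of_le μ ha (RingSeminorm.mul_le_of_le μ hx hb)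
  have hpro : μ (a * x - β * b) ≤ t * c + c * t :=
    RingSeminorm.sub_le_of_le μ (RingSeminorm.mul_le_of_le μ ha hx)
      (RingSeminorm.mul_le_of_le μ hβ hb)
  have hpro' : μ (a * x + β * b) ≤ t * c + c * t :=
    RingSeminorm.add_le_of_le μ (RingSeminorm.mul_le_of_le μ ha hx)
      (RingSeminorm.mul_le_of_le μ hβ hb)
  have hS : μ ((a + x * b) * (a * x + β * b) + 2 * α * a * b * x) ≤
      (t + c * t) * (t * c + c * t) + 2 * c * t * t * c :=
    RingSeminorm.add_le_of_le μ (RingSeminorm.mul_le_of_le μ hlin' hpro')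
      (RingSeminorm.mul_le_of_le μ (RingSeminorm.mul_le_of_le μ (RingSeminorm.mul_le_of_le μ
        (RingSeminorm.mul_le_of_le μ h2 hα) ha) hb) hx)
  have hE : μ (2 * g * e) ≤ 2 * t ^ 2 * (3 * c) :=
    RingSeminorm.mul_le_of_le μ (RingSeminorm.mul_le_of_le μ h2 hg) he
  have hcc : c ≤ c ^ 2 := by nlinarith
  have h11 : 1 ≤ c ^ 2 := by nlinarith
  have hct : c * t ^ 2 ≤ c ^ 2 * t ^ 2 := by gcongr
  have hct' : 1 * t ^ 2 ≤ c ^ 2 * t ^ 2 := by gcongr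
  refine ⟨(RingSeminorm.pow_le_of_le μ h1 hlin 2).trans ?_,
    (RingSeminorm.pow_le_of_le μ h1 hpro 2).trans ?_,
    (RingSeminorm.add_le_of_le μ hS hE).trans ?_, (RingSeminorm.sub_le_of_le μ hS hE).trans ?_⟩ <;>
  nlinarith

theorem aux_seminorm_le {R B : Type*} [CommRing R] [CommRing B] (φ : R[X][X] →+* B) {α β : R}
    {e : B} (ν : RingSeminorm R[X]) (μ : RingSeminorm B) (h1 : ν 1 ≤ 1) (h1' : μ 1 ≤ 1) {c : ℝ}
    (hc : 1 ≤ c) (hα : ν (C α) ≤ c) (hβ : ν (C β) ≤ c) (hX : ν X ≤ c)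
    (hμ : ∀ p, μ (φ (C p)) ≤ ν p) (hX' : μ (φ X) ≤ c) (he : μ e ≤ 3 * c) (k : ℕ) (s : Bool) :
    μ (auxNum φ α β k e s) ≤ (4 * c ^ 2) ^ (4 * 4 ^ k) ∧
      μ (auxDen φ α β k e s) ≤ (4 * c ^ 2) ^ (4 * 4 ^ k) := by
  obtain ⟨hA, hB, hG⟩ := dupl_seminorm_le α β ν h1 hc hα hβ hX k
  set n := 4 ^ k with hn
  have hn1 : 1 ≤ n := Nat.one_le_pow _ _ (by norm_num)
  set T := 4 * c ^ 2 with hT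
  have hT4 : 4 ≤ T := by nlinarith
  set t := T ^ n with ht
  have hle (p) (h : 4 * c * ν p ≤ t) : μ (φ (C p)) ≤ t :=
    (hμ p).trans ((le_mul_of_one_le_left (apply_nonneg ν p) (by linarith)).trans h)
  replace hG := (hμ _).trans hG
  rw [mul_comm 2, pow_mul, ← ht] at hG
  have key : 12 * c ^ 2 * t ^ 2 ≤ T ^ (4 * n) := by
    calc 12 * c ^ 2 * t ^ 2 = 3 * T * t ^ 2 := by rw [hT]; ring
      _ ≤ T * T * t ^ 2 := by gcongr; linarith
      _ = T ^ (n * 2 + 2) := by rw [ht]; ring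
      _ ≤ T ^ (4 * n) := pow_le_pow_right₀ (by linarith) (by omega)
  obtain ⟨r1, r2, r3, r4⟩ := aux_seminorm_le_of_le μ h1' hc (hle _ hA) (hle _ hB) hG
    ((hμ _).trans hα) ((hμ _).trans hβ) hX' he
  cases s <;>
  simp only [auxNum, auxDen, cond_true, cond_false, auxD, auxW, auxS, map_add, map_mul, map_sub,
    map_pow, map_ofNat]
  · exact ⟨r3.trans key, r1.trans key⟩
  · exact ⟨r2.trans key, r4.trans key⟩

/-- A monomial of degree `N` in `a` and `b` and degree `N` in `c` and `d`. -/
def auxMon {B : Type*} [CommRing B] (x a b c d : B) (l i j N : ℕ) : B :=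
  x ^ l * (a ^ i * b ^ (N - i)) * (c ^ j * d ^ (N - j))

theorem monomial_seminorm_le {B : Type*} [CommRing B] (μ : RingSeminorm B) (h1 : μ 1 ≤ 1) {T : ℝ}
    {x a b c d : B} (hx : μ x ≤ 1) (ha : μ a ≤ T) (hb : μ b ≤ T) (hc : μ c ≤ T)
    (hd : μ d ≤ T) (l : ℕ) {i j N : ℕ} (hi : i ≤ N) (hj : j ≤ N) :
    μ (auxMon x a b c d l i j N) ≤ T ^ (2 * N) := by
  refine (RingSeminorm.mul_le_of_le μ (RingSeminorm.mul_le_of_le μ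
    (RingSeminorm.pow_le_of_le μ h1 hx l) (RingSeminorm.mul_le_of_le μ
    (RingSeminorm.pow_le_of_le μ h1 ha i) (RingSeminorm.pow_le_of_le μ h1 hb (N - i))))
    (RingSeminorm.mul_le_of_le μ (RingSeminorm.pow_le_of_le μ h1 hc j)
      (RingSeminorm.pow_le_of_le μ h1 hd (N - j)))).trans ?_
  rw [one_pow, one_mul, ← pow_add, ← pow_add, Nat.add_sub_cancel' hi, Nat.add_sub_cancel' hj,
    ← pow_add, two_mul]

theorem monomial_biWt {R : Type*} [CommRing R] {g₁ g₂ : R[X][X]} (hg₁ : Wt 6 6 g₁)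
    (hg₂ : Wt 6 6 g₂) {x a b c d : Biquad g₁ g₂} {m : ℤ} (hx : BiWt 2 0 x) (ha : BiWt m 4 a)
    (hb : BiWt m 4 b) (hc : BiWt m 4 c) (hd : BiWt m 4 d) (l : ℕ) {i j N : ℕ} (hi : i ≤ N)
    (hj : j ≤ N) :
    BiWt (2 * l + 2 * N * m) (8 * N) (auxMon x a b c d l i j N) := by
  have h1 := BiWt.mul hg₁ hg₂ (ha.pow hg₁ hg₂ i) (hb.pow hg₁ hg₂ (N - i))
  have h2 := BiWt.mul hg₁ hg₂ (hc.pow hg₁ hg₂ j) (hd.pow hg₁ hg₂ (N - j))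
  have h3 := BiWt.mul hg₁ hg₂ (BiWt.mul hg₁ hg₂ (hx.pow hg₁ hg₂ l) h1) h2
  refine h3.mono (le_of_eq ?_) (le_of_eq ?_) <;>
  · push_cast [Nat.cast_sub hi, Nat.cast_sub hj]
    ring

section Term

variable {R B : Type*} [CommRing R] [CommRing B] (φ : R[X][X] →+* B) (α₁ β₁ α₂ β₂ : R) (k N : ℕ)
  (e₁ e₂ : B)

/-- The monomials, in the abscissae of `P`, `2 ^ k P + Q` on one curve and `2 ^ k P + Q` on another
one, which make up the auxiliary form. -/
noncomputable def auxTerm (s t : Bool) (a : ℕ × ℕ × ℕ) : B :=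
  auxMon (φ (C X)) (auxNum φ α₁ β₁ k e₁ s) (auxDen φ α₁ β₁ k e₁ s) (auxNum φ α₂ β₂ k e₂ t)
    (auxDen φ α₂ β₂ k e₂ t) a.1 a.2.1 a.2.2 N

/-- The exponents which occur in the auxiliary form. -/
def auxBox : Finset (ℕ × ℕ × ℕ) :=
  Finset.range (4 * 4 ^ k) ×ˢ Finset.range (N + 1) ×ˢ Finset.range (N + 1)

variable {N k} in
theorem mem_auxBox {a : ℕ × ℕ × ℕ} :
    a ∈ auxBox k N ↔ a.1 < 4 * 4 ^ k ∧ a.2.1 ≤ N ∧ a.2.2 ≤ N := by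
  simp [auxBox]

/-- The auxiliary form with given coefficients. -/
noncomputable def auxForm (c : ℕ × ℕ × ℕ → R) (s t : Bool) : B :=
  ∑ a ∈ auxBox k N, φ (C (C (c a))) * auxTerm φ α₁ β₁ α₂ β₂ k N e₁ e₂ s t a

theorem map_auxForm {B' : Type*} [CommRing B'] (ψ : B →+* B') (c : ℕ × ℕ × ℕ → R) (s t : Bool) :
    ψ (auxForm φ α₁ β₁ α₂ β₂ k N e₁ e₂ c s t) =
      auxForm (ψ.comp φ) α₁ β₁ α₂ β₂ k N (ψ e₁) (ψ e₂) c s t := by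
  simp [auxForm, auxTerm, auxMon, map_auxNum, map_auxDen]

end Term

section TermBounds

variable {R : Type*} [CommRing R] (α₁ β₁ α₂ β₂ : R) (k N : ℕ)

/-- The monomials which make up the auxiliary form, as functions on the product of two curves. -/
noncomputable def biTerm (s t : Bool) (a : ℕ × ℕ × ℕ) :
    Biquad (cubicProd α₁ β₁) (cubicProd α₂ β₂) :=
  auxTerm biC α₁ β₁ α₂ β₂ k N eta₁ eta₂ s t a

theorem eta₁_biWt {g₁ g₂ : R[X][X]} : BiWt 3 3 (eta₁ : Biquad g₁ g₂) := by
  have h : Wt (3 - 3) (3 - 3) (1 : R[X][X]) := .mono .one (by norm_num) (by norm_num)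
  exact ⟨.zero, h, .zero, .zero⟩

theorem eta₂_biWt {g₁ g₂ : R[X][X]} : BiWt 3 3 (eta₂ : Biquad g₁ g₂) := by
  have h : Wt (3 - 3) (3 - 3) (1 : R[X][X]) := .mono .one (by norm_num) (by norm_num)
  exact ⟨.zero, .zero, h, .zero⟩

theorem biTerm_biWt [Nontrivial R] (s t : Bool) {a : ℕ × ℕ × ℕ} (ha : a ∈ auxBox k N) :
    BiWt (8 * (N + 1) * 4 ^ k) (8 * N) (biTerm α₁ β₁ α₂ β₂ k N s t a) := by
  obtain ⟨h0, h1, h2⟩ := mem_auxBox.mp ha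
  have hg₁ := cubicProd_wt α₁ β₁
  have hg₂ := cubicProd_wt α₂ β₂
  obtain ⟨n1, d1⟩ := aux_biWt α₁ β₁ k hg₁ hg₂ eta₁_biWt s
  obtain ⟨n2, d2⟩ := aux_biWt α₂ β₂ k hg₁ hg₂ eta₂_biWt t
  have hx : BiWt 2 0 (biC (C X) : Biquad (cubicProd α₁ β₁) (cubicProd α₂ β₂)) :=
    BiWt.biC ((Wt.C natDegree_X_le).mono (by norm_num) le_rfl)
  have key := monomial_biWt hg₁ hg₂ hx n1 d1 n2 d2 a.1 h1 h2
  unfold biTerm auxTerm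
  refine BiWt.mono key ?_ le_rfl
  have h0' : (a.1 : ℤ) ≤ 4 * 4 ^ k := mod_cast h0.le
  linarith

theorem biTerm_seminorm_le (ν : RingSeminorm R) (h1 : ν 1 ≤ 1) {c : ℝ} (hc : 1 ≤ c)
    (hα₁ : ν α₁ ≤ c) (hβ₁ : ν β₁ ≤ c) (hα₂ : ν α₂ ≤ c) (hβ₂ : ν β₂ ≤ c) (s t : Bool)
    {a : ℕ × ℕ × ℕ} (ha : a ∈ auxBox k N) (i j : ℕ) :
    ν (((biTerm α₁ β₁ α₂ β₂ k N s t a).re.re.coeff j).coeff i) ≤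
        (4 * c ^ 2) ^ (8 * (N + 1) * 4 ^ k) ∧
      ν (((biTerm α₁ β₁ α₂ β₂ k N s t a).re.im.coeff j).coeff i) ≤
        (4 * c ^ 2) ^ (8 * (N + 1) * 4 ^ k) ∧
      ν (((biTerm α₁ β₁ α₂ β₂ k N s t a).im.re.coeff j).coeff i) ≤
        (4 * c ^ 2) ^ (8 * (N + 1) * 4 ^ k) ∧
      ν (((biTerm α₁ β₁ α₂ β₂ k N s t a).im.im.coeff j).coeff i) ≤
        (4 * c ^ 2) ^ (8 * (N + 1) * 4 ^ k) := by
  obtain ⟨m0, m1, m2⟩ := mem_auxBox.mp ha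
  set ν₁ := polySeminorm ν 1 with hν₁
  set ν₂ := polySeminorm ν₁ 1 with hν₂
  have o1 : ν₁ 1 ≤ 1 := polySeminorm_one_le ν 1 h1
  have o2 : ν₂ 1 ≤ 1 := polySeminorm_one_le ν₁ 1 o1
  have x1 : ν₁ X ≤ 1 := by simpa using polySeminorm_X_le ν 1 h1
  have x2 : ν₂ X ≤ 1 := by simpa using polySeminorm_X_le ν₁ 1 o1
  have hc0 : 0 ≤ c := by linarith
  have hcub {α β : R} (hα : ν α ≤ c) (hβ : ν β ≤ c) : ν₂ (cubicProd α β) ≤ ((3 * c) ^ 2) := by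
    have hC (a : R) : ν₁ (C a) ≤ ν a := (polySeminorm_C ν 1 a).le
    have hCC (p : R[X]) : ν₂ (C p) ≤ ν₁ p := (polySeminorm_C ν₁ 1 p).le
    have b1 : ν₁ (cubic α β) ≤ 1 ^ 3 + c * 1 ^ 2 + c * 1 :=
      RingSeminorm.add_le_of_le _ (RingSeminorm.add_le_of_le _
        (RingSeminorm.pow_le_of_le _ o1 x1 3) (RingSeminorm.mul_le_of_le _ ((hC α).trans hα)
          (RingSeminorm.pow_le_of_le _ o1 x1 2)))
        (RingSeminorm.mul_le_of_le _ ((hC β).trans hβ) x1)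
    have b2 : ν₂ ((cubic α β).map C) ≤ 1 ^ 3 + c * 1 ^ 2 + c * 1 := by
      simp only [cubic, Polynomial.map_add, Polynomial.map_mul, Polynomial.map_pow, map_X, map_C]
      exact RingSeminorm.add_le_of_le _ (RingSeminorm.add_le_of_le _
        (RingSeminorm.pow_le_of_le _ o2 x2 3) (RingSeminorm.mul_le_of_le _
          ((hCC _).trans ((hC α).trans hα)) (RingSeminorm.pow_le_of_le _ o2 x2 2)))
        (RingSeminorm.mul_le_of_le _ ((hCC _).trans ((hC β).trans hβ)) x2)
    refine (RingSeminorm.mul_le_of_le ν₂ ((hCC _).trans b1) b2).trans ?_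
    nlinarith
  set κ : NNReal := ⟨3 * c, by positivity⟩ with hκ
  have hκ1 : 1 ≤ κ := show (1 : ℝ) ≤ 3 * c by linarith
  set μ := biSeminorm (g₁ := cubicProd α₁ β₁) (g₂ := cubicProd α₂ β₂) ν₂ κ (hcub hα₁ hβ₁)
    (hcub hα₂ hβ₂) with hμ
  have o3 : μ 1 ≤ 1 := biSeminorm_one_le o2
  have hμC (p : R[X]) : μ (biC (C p)) ≤ ν₁ p :=
    (biSeminorm_biC (h₁ := hcub hα₁ hβ₁) (h₂ := hcub hα₂ hβ₂) (C p)).le.trans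
      (polySeminorm_C ν₁ 1 p).le
  have hμX : μ (biC X) ≤ c :=
    (biSeminorm_biC (h₁ := hcub hα₁ hβ₁) (h₂ := hcub hα₂ hβ₂) X).le.trans (x2.trans hc)
  obtain ⟨n1, d1⟩ := aux_seminorm_le biC ν₁ μ o1 o3 hc ((polySeminorm_C ν 1 α₁).le.trans hα₁)
    ((polySeminorm_C ν 1 β₁).le.trans hβ₁) (x1.trans hc) hμC hμX (biSeminorm_eta₁_le o2) k s
  obtain ⟨n2, d2⟩ := aux_seminorm_le biC ν₁ μ o1 o3 hc ((polySeminorm_C ν 1 α₂).le.trans hα₂)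
    ((polySeminorm_C ν 1 β₂).le.trans hβ₂) (x1.trans hc) hμC hμX (biSeminorm_eta₂_le o2) k t
  have hT : 1 ≤ 4 * c ^ 2 := by nlinarith
  have key : μ (biTerm α₁ β₁ α₂ β₂ k N s t a) ≤ (4 * c ^ 2) ^ (8 * (N + 1) * 4 ^ k) := by
    refine (monomial_seminorm_le μ o3 ((hμC X).trans x1) n1 d1 n2 d2 a.1 m1 m2).trans ?_
    rw [← pow_mul]
    refine pow_le_pow_right₀ hT ?_
    ring_nf
    omega
  have hco (F : R[X][X]) : ν ((F.coeff j).coeff i) ≤ ν₂ F := by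
    have q1 := coeff_le_polySeminorm ν 1 (F.coeff j) i
    have q2 := coeff_le_polySeminorm ν₁ 1 F j
    simp only [NNReal.coe_one, one_pow, mul_one] at q1 q2
    exact q1.trans q2
  obtain ⟨r1, r2, r3, r4⟩ := components_le_biSeminorm (h₁ := hcub hα₁ hβ₁) (h₂ := hcub hα₂ hβ₂)
    (ν := ν₂) hκ1 (biTerm α₁ β₁ α₂ β₂ k N s t a)
  exact ⟨(hco _).trans (r1.trans key), (hco _).trans (r2.trans key), (hco _).trans (r3.trans key),
    (hco _).trans (r4.trans key)⟩

end TermBounds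

end VojtaCurve

namespace VojtaCurve

open Polynomial

section BiHom

variable {R S : Type*} [CommRing R] [CommRing S] {g₁ g₂ : R} (f : R →+* S) (s₁ s₂ : S)
  (h₁ : s₁ * s₁ = f g₁) (h₂ : s₂ * s₂ = f g₂)

/-- The evaluation homomorphism from `R[η₁, η₂]` given by square roots of the images of `g₁`
and `g₂`. -/
def biHom : Biquad g₁ g₂ →+* S :=
  quadHom (g := (QuadraticAlgebra.C g₂ : QuadraticAlgebra R g₁ 0)) (quadHom f s₁ h₁) s₂ (by
    rw [h₂, quadHom_apply]
    simp)

theorem biHom_apply (F : Biquad g₁ g₂) : biHom f s₁ s₂ h₁ h₂ F =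
    f F.re.re + f F.re.im * s₁ + (f F.im.re + f F.im.im * s₁) * s₂ := rfl

theorem biHom_biC (r : R) : biHom f s₁ s₂ h₁ h₂ (biC r) = f r := by
  rw [biHom_apply, biC_apply]
  simp [Biquad.mk]

theorem biHom_comp_biC : (biHom f s₁ s₂ h₁ h₂).comp biC = f :=
  RingHom.ext fun r => biHom_biC f s₁ s₂ h₁ h₂ r

theorem biHom_eta₁ : biHom f s₁ s₂ h₁ h₂ eta₁ = s₁ := by
  rw [biHom_apply, eta₁]
  simp [Biquad.mk]

theorem biHom_eta₂ : biHom f s₁ s₂ h₁ h₂ eta₂ = s₂ := by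
  rw [biHom_apply, eta₂]
  simp [Biquad.mk]

theorem eq_zero_of_biC_mul_eq_zero [IsDomain R] {r : R} (hr : r ≠ 0) {F : Biquad g₁ g₂}
    (h : biC r * F = 0) : F = 0 := by
  rw [Biquad.mul_eq, biC_apply] at h
  have h' : (Biquad.mk (r * F.re.re) (r * F.re.im) (r * F.im.re) (r * F.im.im) :
      Biquad g₁ g₂) = Biquad.mk 0 0 0 0 := by
    refine Eq.trans ?_ h
    simp [Biquad.mk]
    rfl
  have e₁ : r * F.re.re = 0 := congrArg (fun z : Biquad g₁ g₂ => z.re.re) h'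
  have e₂ : r * F.re.im = 0 := congrArg (fun z : Biquad g₁ g₂ => z.re.im) h'
  have e₃ : r * F.im.re = 0 := congrArg (fun z : Biquad g₁ g₂ => z.im.re) h'
  have e₄ : r * F.im.im = 0 := congrArg (fun z : Biquad g₁ g₂ => z.im.im) h'
  exact QuadraticAlgebra.ext
    (QuadraticAlgebra.ext ((mul_eq_zero.mp e₁).resolve_left hr)
      ((mul_eq_zero.mp e₂).resolve_left hr))
    (QuadraticAlgebra.ext ((mul_eq_zero.mp e₃).resolve_left hr)
      ((mul_eq_zero.mp e₄).resolve_left hr))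

end BiHom

section Gauss

variable {K : Type*} [Field K] [CharZero K]

/-- The quadratic relation between `2 ^ k P ± Q` specialised at `X(Q) = a₁ / b₁`. -/
noncomputable def specQuad (α β : K) (A₁ B₁ A₂ B₂ : K[X]) : K[X][X] :=
  C ((A₂ * B₁ - A₁ * B₂) ^ 2) * X ^ 2 -
    2 * C ((A₂ * B₁ + A₁ * B₂) * (A₁ * A₂ + C β * B₁ * B₂) + 2 * C α * A₁ * A₂ * B₁ * B₂) * X +
    C ((A₁ * A₂ - C β * B₁ * B₂) ^ 2)

variable {α β : K} {A₁ B₁ A₂ B₂ : K[X]}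

theorem specQuad_isPrimitive (hβ : β ≠ 0) (hd : α ^ 2 ≠ 4 * β)
    (h0 : A₁ * A₂ - C β * B₁ * B₂ ≠ 0)
    (h₁ : ∀ z : AlgebraicClosure K, ¬ (aeval z A₁ = 0 ∧ aeval z B₁ = 0))
    (h₂ : ∀ z : AlgebraicClosure K, ¬ (aeval z A₂ = 0 ∧ aeval z B₂ = 0)) :
    (specQuad α β A₁ B₁ A₂ B₂).IsPrimitive := by
  intro r hr
  by_contra hu
  have hc := fun i => (C_dvd_iff_dvd_coeff _ _).mp hr i
  have c0 := hc 0
  have c1 := hc 1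
  have c2 := hc 2
  have two : (2 : K[X][X]) = C 2 := rfl
  simp only [specQuad, two, mul_assoc, coeff_add, coeff_sub, coeff_C_mul, coeff_X_pow, coeff_C,
    coeff_X] at c0 c1 c2
  simp at c0 c1 c2
  have hr0 : r ≠ 0 := by
    rintro rfl
    exact h0 (by simpa [mul_assoc] using c0)
  obtain ⟨z, hz⟩ := IsAlgClosed.exists_aeval_eq_zero (AlgebraicClosure K) r
    (fun hdeg => hu (isUnit_iff_degree_eq_zero.mpr hdeg))
  have ev {p : K[X]} (h : r ∣ p) : aeval z p = 0 := by
    obtain ⟨q, rfl⟩ := h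
    simp [hz]
  have e0 := ev c0
  have e1 := ev c1
  have e2 := ev c2
  have hβ' : algebraMap K (AlgebraicClosure K) β ≠ 0 := by simpa
  have hd' : algebraMap K (AlgebraicClosure K) α ^ 2 ≠ 4 * algebraMap K (AlgebraicClosure K) β := by
    intro h
    refine hd ((algebraMap K (AlgebraicClosure K)).injective ?_)
    simpa only [map_pow, map_mul, map_ofNat] using h
  have h₁ := h₁ z
  have h₂ := h₂ z
  simp only [map_pow, map_sub, map_add, map_mul, aeval_C, map_ofNat] at e0 e1 e2
  generalize aeval z A₁ = a₁ at *
  generalize aeval z A₂ = a₂ at *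
  generalize aeval z B₁ = b₁ at *
  generalize aeval z B₂ = b₂ at *
  generalize algebraMap K (AlgebraicClosure K) α = a at *
  generalize algebraMap K (AlgebraicClosure K) β = b at *
  have e0' := pow_eq_zero_iff (two_ne_zero) |>.mp e0
  have e2' := pow_eq_zero_iff (two_ne_zero) |>.mp e2
  by_cases hb₁ : b₁ = 0
  · subst hb₁
    have : a₁ ≠ 0 := fun h => h₁ ⟨h, rfl⟩
    have hb₂ : b₂ = 0 := by simpa [this] using e2'
    have : a₂ ≠ 0 := fun h => h₂ ⟨h, hb₂⟩
    simp_all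
  by_cases hb₂ : b₂ = 0
  · subst hb₂
    have : a₂ ≠ 0 := fun h => h₂ ⟨h, rfl⟩
    simp_all
  have e : a₁ / b₁ = a₂ / b₂ := by
    field_simp
    linear_combination -e2'
  obtain ⟨s, hs⟩ : ∃ s, s = a₁ / b₁ := ⟨_, rfl⟩
  have ha₁ : a₁ = s * b₁ := by rw [hs]; field_simp
  have ha₂ : a₂ = s * b₂ := by rw [hs, e]; field_simp
  subst ha₁ ha₂
  have hs2 : s ^ 2 = b := by
    have : (s ^ 2 - b) * (b₁ * b₂) = 0 := by linear_combination e0'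
    simpa [hb₁, hb₂, sub_eq_zero] using this
  have h3 : 2 * b₁ ^ 2 * b₂ ^ 2 * b * (2 * s + a) = 0 := by
    rw [← hs2] at e1 ⊢
    linear_combination e1 / 2
  have h4 : 2 * s + a = 0 := by simpa [hb₁, hb₂, hβ'] using h3
  exact hd' (by linear_combination (a - 2 * s) * h4 + 4 * hs2)

theorem eq_zero_of_specQuad_dvd (hβ : β ≠ 0) (hd : α ^ 2 ≠ 4 * β) {n : ℕ}
    (hA₁ : A₁.Monic) (hA₂ : A₂.Monic) (hdA₁ : A₁.natDegree = n) (hdA₂ : A₂.natDegree = n)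
    (hB₁ : B₁.natDegree < n) (hB₂ : B₂.natDegree < n)
    (h₁ : ∀ z : AlgebraicClosure K, ¬ (aeval z A₁ = 0 ∧ aeval z B₁ = 0))
    (h₂ : ∀ z : AlgebraicClosure K, ¬ (aeval z A₂ = 0 ∧ aeval z B₂ = 0))
    {L : Type*} [Field L] [Algebra K[X] L] [IsFractionRing K[X] L] {H : K[X][X]}
    (hH : ∀ j, (H.coeff j).natDegree < 4 * n)
    (hdvd : (specQuad α β A₁ B₁ A₂ B₂).map (algebraMap K[X] L) ∣ H.map (algebraMap K[X] L)) :
    H = 0 := by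
  have hm : (A₁ * A₂).Monic := hA₁.mul hA₂
  have hmd : (A₁ * A₂).natDegree = 2 * n := by rw [hA₁.natDegree_mul hA₂]; omega
  have hlt : (C β * B₁ * B₂).degree < (A₁ * A₂).degree := by
    refine degree_lt_degree (lt_of_le_of_lt (natDegree_mul_le.trans
      (Nat.add_le_add_right (natDegree_C_mul_le _ _) _)) ?_)
    omega
  have hm' := hm.sub_of_left hlt
  have hmd' : (A₁ * A₂ - C β * B₁ * B₂).natDegree = 2 * n := by
    rw [← hmd]
    exact natDegree_eq_of_degree_eq (degree_sub_eq_left_of_degree_lt hlt)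
  have c0 : (specQuad α β A₁ B₁ A₂ B₂).coeff 0 = (A₁ * A₂ - C β * B₁ * B₂) ^ 2 := by
    have two : (2 : K[X][X]) = C 2 := rfl
    simp only [specQuad, two, mul_assoc, coeff_add, coeff_sub, coeff_C_mul, coeff_X_pow, coeff_C,
      coeff_X]
    simp
  have hdeg : ((A₁ * A₂ - C β * B₁ * B₂) ^ 2).natDegree = 4 * n := by
    rw [hm'.natDegree_pow, hmd']
    ring
  have hp := specQuad_isPrimitive hβ hd hm'.ne_zero h₁ h₂
  obtain ⟨q, rfl⟩ := hp.dvd_of_fraction_map_dvd_fraction_map hdvd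
  by_contra h0
  have htr := trailingCoeff_mul (specQuad α β A₁ B₁ A₂ B₂) q
  have hq : q.trailingCoeff ≠ 0 := trailingCoeff_nonzero_iff_nonzero.mpr (right_ne_zero_of_mul h0)
  have hc0 : (specQuad α β A₁ B₁ A₂ B₂).coeff 0 ≠ 0 := by
    rw [c0]
    exact pow_ne_zero 2 hm'.ne_zero
  have hs : (specQuad α β A₁ B₁ A₂ B₂).trailingCoeff = (A₁ * A₂ - C β * B₁ * B₂) ^ 2 := by
    rw [trailingCoeff, natTrailingDegree_eq_zero.mpr (.inr hc0), c0]
  have := hH (specQuad α β A₁ B₁ A₂ B₂ * q).natTrailingDegree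
  rw [← trailingCoeff, htr, hs, natDegree_mul (pow_ne_zero 2 hm'.ne_zero) hq, hdeg] at this
  omega

end Gauss

end VojtaCurve

namespace VojtaCurve

open Polynomial

universe u v

section Reduced

variable {R B : Type*} [CommRing R] [CommRing B] (φ : R[X][X] →+* B) (α₁ β₁ α₂ β₂ : R) (k N : ℕ)
  (e₁ e₂ : B) (c : ℕ × ℕ × ℕ → R) (i₀ : ℕ)

/-- The quotient of the auxiliary form by a power of a denominator. -/
noncomputable def redForm : B :=
  ∑ a ∈ auxBox k N, φ (C (C (c a))) * (φ (C X) ^ a.1 *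
    (auxNum φ α₁ β₁ k e₁ false ^ a.2.1 * auxDen φ α₁ β₁ k e₁ false ^ (i₀ - a.2.1)) *
    (auxNum φ α₂ β₂ k e₂ false ^ a.2.2 * auxDen φ α₂ β₂ k e₂ false ^ (N - a.2.2)))

theorem map_redForm {B' : Type*} [CommRing B'] (ψ : B →+* B') :
    ψ (redForm φ α₁ β₁ α₂ β₂ k N e₁ e₂ c i₀) =
      redForm (ψ.comp φ) α₁ β₁ α₂ β₂ k N (ψ e₁) (ψ e₂) c i₀ := by
  simp [redForm, map_auxNum, map_auxDen]

theorem auxForm_eq_redForm (hi₀ : i₀ ≤ N) (hc : ∀ a ∈ auxBox k N, c a ≠ 0 → a.2.1 ≤ i₀) :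
    auxForm φ α₁ β₁ α₂ β₂ k N e₁ e₂ c false false =
      auxDen φ α₁ β₁ k e₁ false ^ (N - i₀) * redForm φ α₁ β₁ α₂ β₂ k N e₁ e₂ c i₀ := by
  rw [auxForm, redForm, Finset.mul_sum]
  refine Finset.sum_congr rfl fun a ha => ?_
  by_cases h : c a = 0
  · simp [h]
  · have := hc a ha h
    rw [auxTerm, auxMon, show N - a.2.1 = (N - i₀) + (i₀ - a.2.1) by omega, pow_add]
    ring

theorem redForm_eq_of_den_eq_zero (hD : auxDen φ α₁ β₁ k e₁ false = 0)
    (hc : ∀ a ∈ auxBox k N, c a ≠ 0 → a.2.1 ≤ i₀) {ξ : B}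
    (hξ : auxNum φ α₂ β₂ k e₂ false = auxDen φ α₂ β₂ k e₂ false * ξ) :
    redForm φ α₁ β₁ α₂ β₂ k N e₁ e₂ c i₀ =
      auxNum φ α₁ β₁ k e₁ false ^ i₀ * auxDen φ α₂ β₂ k e₂ false ^ N *
        ∑ a ∈ auxBox k N, if a.2.1 = i₀ then φ (C (C (c a))) * φ (C X) ^ a.1 * ξ ^ a.2.2
          else 0 := by
  rw [redForm, Finset.mul_sum]
  refine Finset.sum_congr rfl fun a ha => ?_
  have hN := (mem_auxBox.mp ha).2.2
  split_ifs with h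
  · rw [h, Nat.sub_self, pow_zero, hξ, ← Nat.add_sub_of_le hN, pow_add, Nat.add_sub_cancel_left]
    ring
  · by_cases h' : c a = 0
    · simp [h']
    · have := hc a ha h'
      rw [hD, zero_pow (by omega)]
      simp

end Reduced

section Slice

variable {R K : Type*} [CommRing R] [Field K] (f : R →+* K) (c : ℕ × ℕ × ℕ → R) (k N i₀ : ℕ)

/-- The slice of the coefficients at a given power of the second variable. -/
noncomputable def slice : K[X][X] :=
  ∑ a ∈ auxBox k N, if a.2.1 = i₀ then monomial a.2.2 (monomial a.1 (f (c a))) else 0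

theorem slice_coeff (l j : ℕ) (h : (l, i₀, j) ∈ auxBox k N) :
    ((slice f c k N i₀).coeff j).coeff l = f (c (l, i₀, j)) := by
  rw [slice, finsetSum_coeff, finsetSum_coeff, Finset.sum_eq_single (l, i₀, j)]
  · simp
  · rintro ⟨l', i', j'⟩ - hne
    by_cases hi : i' = i₀
    · subst hi
      by_cases hj : j' = j
      · subst hj
        have : l' ≠ l := by
          rintro rfl
          exact hne rfl
        simp [coeff_monomial, this]
      · simp [coeff_monomial, hj]
    · simp [hi]
  · exact fun h' => absurd h h'

theorem slice_natDegree_lt (j : ℕ) : ((slice f c k N i₀).coeff j).natDegree < 4 * 4 ^ k := by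
  have h0 : 0 < 4 * 4 ^ k := by positivity
  refine Nat.lt_of_le_pred h0 ?_
  rw [slice, finsetSum_coeff]
  refine natDegree_sum_le_of_forall_le _ _ fun a ha => ?_
  have hl := Nat.le_pred_of_lt (mem_auxBox.mp ha).1
  split_ifs
  · rw [coeff_monomial]
    split_ifs
    · exact (natDegree_monomial_le _).trans hl
    · simp
  · simp

theorem eval₂_slice {S : Type*} [CommRing S] (g : K[X] →+* S) (ξ : S) :
    (slice f c k N i₀).eval₂ g ξ = ∑ a ∈ auxBox k N,
      if a.2.1 = i₀ then g (C (f (c a))) * g X ^ a.1 * ξ ^ a.2.2 else 0 := by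
  rw [slice, eval₂_finsetSum]
  refine Finset.sum_congr rfl fun a _ => ?_
  split_ifs
  · rw [eval₂_monomial, ← C_mul_X_pow_eq_monomial, map_mul, map_pow]
  · simp

end Slice

theorem exists_root_generic {A : Type u} {L : Type v} [CommRing A] [Field L] (j : A →+* L)
    (Φ : A[X]) :
    ∃ (S : Type v) (_ : CommRing S) (o : L →+* S) (ξ : S), Φ.eval₂ (o.comp j) ξ = 0 ∧
      ∀ H : A[X], H.eval₂ (o.comp j) ξ = 0 → Φ.map j ∣ H.map j := by
  refine ⟨AdjoinRoot (Φ.map j), inferInstance, AdjoinRoot.of (Φ.map j), AdjoinRoot.root (Φ.map j),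
    ?_, fun H h => ?_⟩
  · rw [← eval₂_map, AdjoinRoot.eval₂_root]
  · rw [← AdjoinRoot.mk_eq_zero, ← h, ← eval₂_map, ← AdjoinRoot.algebraMap_eq]
    exact (AdjoinRoot.aeval_eq _).symm

theorem duplA_mul_duplB_ne {R : Type*} [CommRing R] [IsDomain R] [CharZero R] {α₁ β₁ α₂ β₂ : R}
    (hns : ∀ p q : R[X], p ^ 2 = cubic α₁ β₁ * cubic α₂ β₂ * q ^ 2 → q = 0) {k : ℕ} (hk : 1 ≤ k) :
    duplA α₂ β₂ k * duplB α₁ β₁ k - duplA α₁ β₁ k * duplB α₂ β₂ k ≠ 0 := by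
  obtain ⟨k, rfl⟩ := Nat.exists_eq_add_of_le' hk
  intro h
  have hA := (dupl_degree α₁ β₁ (k + 1)).1.ne_zero
  rw [duplA_succ] at hA
  rw [duplA_succ, duplA_succ, duplB_succ', duplB_succ'] at h
  have hG := duplG_ne_zero α₂ β₂ k
  set a₁ := duplA α₁ β₁ k ^ 2 - C β₁ * duplB α₁ β₁ k ^ 2
  set a₂ := duplA α₂ β₂ k ^ 2 - C β₂ * duplB α₂ β₂ k ^ 2
  have h4 : (4 : R[X]) ≠ 0 := by simp
  have h' := hns (a₂ * duplG α₁ β₁ k * cubic α₁ β₁) (a₁ * duplG α₂ β₂ k) (by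
    refine mul_left_cancel₀ h4 ?_
    linear_combination cubic α₁ β₁ * h)
  have := pow_ne_zero_iff two_ne_zero |>.mp hA
  simp_all

section Independence

variable {R : Type u} [CommRing R] [IsDomain R] [CharZero R] {α₁ β₁ α₂ β₂ : R}

theorem auxForm_ne_zero_of_isFractionRing (K L : Type*) [Field K] [Algebra R K] [IsFractionRing R K]
    [Field L] [Algebra K[X] L] [IsFractionRing K[X] L] (hβ₁ : β₁ ≠ 0) (hd₁ : α₁ ^ 2 ≠ 4 * β₁)
      (hβ₂ : β₂ ≠ 0)
    (hd₂ : α₂ ^ 2 ≠ 4 * β₂)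
    (hns : ∀ p q : R[X], p ^ 2 = cubic α₁ β₁ * cubic α₂ β₂ * q ^ 2 → q = 0) {k N : ℕ} (hk : 1 ≤ k)
    {c : ℕ × ℕ × ℕ → R} {a₀ : ℕ × ℕ × ℕ} (ha₀ : a₀ ∈ auxBox k N) (hc₀ : c a₀ ≠ 0) :
    auxForm biC α₁ β₁ α₂ β₂ k N (eta₁ : Biquad (cubicProd α₁ β₁) (cubicProd α₂ β₂)) eta₂ c
      false false ≠ 0 := by
  classical
  obtain ⟨⟨l₀, i₀, j₀⟩, hmem, hmax⟩ := Finset.exists_max_image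
    ((auxBox k N).filter fun a => c a ≠ 0) (fun a => a.2.1) ⟨a₀, by simp [ha₀, hc₀]⟩
  clear ha₀ hc₀ a₀
  rw [Finset.mem_filter] at hmem
  obtain ⟨hbox, hc₀⟩ := hmem
  have hc : ∀ a ∈ auxBox k N, c a ≠ 0 → a.2.1 ≤ i₀ := fun a ha h =>
    hmax a (Finset.mem_filter.mpr ⟨ha, h⟩)
  intro hF
  rw [auxForm_eq_redForm (hi₀ := (mem_auxBox.mp hbox).2.1) (hc := hc)] at hF
  have hD₁ : auxD α₁ β₁ k ≠ 0 := by
    have h0 := (dupl_degree α₁ β₁ k).1.ne_zero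
    refine pow_ne_zero 2 fun h => h0 ?_
    simpa using congrArg (fun p => coeff p 0) h
  have hden (α β : R) (e : Biquad (cubicProd α₁ β₁) (cubicProd α₂ β₂)) :
      auxDen biC α β k e false = biC (auxD α β k) := rfl
  rw [hden, ← map_pow] at hF
  replace hF := eq_zero_of_biC_mul_eq_zero (pow_ne_zero _ hD₁) hF
  have : CharZero K := IsFractionRing.charZero_of_isFractionRing R
  let μ : R[X] →+* K[X] := mapRingHom (algebraMap R K)
  have : CharZero L := IsFractionRing.charZero_of_isFractionRing K[X]
  have hμ : Function.Injective μ := map_injective _ (IsFractionRing.injective R K)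
  let ι : R[X] →+* L := (algebraMap K[X] L).comp μ
  have hι : Function.Injective ι := (IsFractionRing.injective K[X] L).comp hμ
  have hι0 {p : R[X]} (hp : p ≠ 0) : ι p ≠ 0 := (map_ne_zero_iff ι hι).mpr hp
  have hB₁ := hι0 (duplB_ne_zero α₁ β₁ k)
  have hG₁ := hι0 (duplG_ne_zero α₁ β₁ k)
  have hG₂ := hι0 (duplG_ne_zero α₂ β₂ k)
  have hf₁ := hι0 (cubic_monic α₁ β₁).ne_zero
  have hΔ := hι0 (duplA_mul_duplB_ne hns hk)
  have hcur := congrArg ι (duplB_curve α₁ β₁ k)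
  let φ : R[X][X] →+* L := eval₂RingHom ι (ι (duplA α₁ β₁ k) / ι (duplB α₁ β₁ k))
  have hφC (p : R[X]) : φ (C p) = ι p := eval₂_C _ _
  have hφX : φ X = ι (duplA α₁ β₁ k) / ι (duplB α₁ β₁ k) := eval₂_X _ _
  have hsq := congrArg φ (auxS_sq_sub α₂ β₂ k)
  obtain ⟨S, _, o, ξ, hroot, hdvd⟩ := exists_root_generic (algebraMap K[X] L)
    (specQuad (algebraMap R K α₂) (algebraMap R K β₂) (μ (duplA α₁ β₁ k)) (μ (duplB α₁ β₁ k))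
      (μ (duplA α₂ β₂ k)) (μ (duplB α₂ β₂ k)))
  have hμC (r : R) : (C (algebraMap R K r) : K[X]) = μ (C r) := (map_C _).symm
  have hφD : φ (auxD α₂ β₂ k) = (ι (duplA α₂ β₂ k) -
      ι (duplA α₁ β₁ k) / ι (duplB α₁ β₁ k) * ι (duplB α₂ β₂ k)) ^ 2 := by
    simp only [auxD, map_pow, map_sub, map_mul, hφC, hφX]
  have hroot' : o (φ (auxD α₂ β₂ k)) * ξ ^ 2 - 2 * o (φ (auxS α₂ β₂ k)) * ξ +
      o (φ (auxW α₂ β₂ k)) = 0 := by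
    have e1 : ι (duplB α₁ β₁ k) ^ 2 * φ (auxD α₂ β₂ k) = ι ((duplA α₂ β₂ k * duplB α₁ β₁ k -
        duplA α₁ β₁ k * duplB α₂ β₂ k) ^ 2) := by
      simp only [hφD, map_sub, map_mul, map_pow]
      field_simp
    have e2 : ι (duplB α₁ β₁ k) ^ 2 * φ (auxS α₂ β₂ k) = ι ((duplA α₂ β₂ k * duplB α₁ β₁ k +
        duplA α₁ β₁ k * duplB α₂ β₂ k) * (duplA α₁ β₁ k * duplA α₂ β₂ k +
          C β₂ * duplB α₁ β₁ k * duplB α₂ β₂ k) +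
        2 * C α₂ * duplA α₁ β₁ k * duplA α₂ β₂ k * duplB α₁ β₁ k * duplB α₂ β₂ k) := by
      simp only [auxS, map_add, map_mul, map_ofNat, hφC, hφX]
      field_simp
    have e3 : ι (duplB α₁ β₁ k) ^ 2 * φ (auxW α₂ β₂ k) = ι ((duplA α₁ β₁ k * duplA α₂ β₂ k -
          C β₂ * duplB α₁ β₁ k * duplB α₂ β₂ k) ^ 2) := by
      simp only [auxW, map_sub, map_mul, map_pow, hφC, hφX]
      field_simp
    have hinv : o ((ι (duplB α₁ β₁ k) ^ 2)⁻¹) * o (ι (duplB α₁ β₁ k) ^ 2) = 1 := by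
      rw [← map_mul, inv_mul_cancel₀ (pow_ne_zero 2 hB₁), map_one]
    simp only [specQuad, eval₂_add, eval₂_sub, eval₂_mul, eval₂_pow, eval₂_C, eval₂_X, hμC,
      eval₂_ofNat] at hroot
    have hoι (p : R[X]) : (o.comp (algebraMap K[X] L)) (μ p) = o (ι p) := rfl
    simp only [← map_mul μ, ← map_add μ, ← map_sub μ, ← map_pow μ, ← map_ofNat μ 2, hoι] at hroot
    rw [← e1, ← e2, ← e3] at hroot
    simp only [map_mul o] at hroot
    linear_combination o ((ι (duplB α₁ β₁ k) ^ 2)⁻¹) * hroot - (o (φ (auxD α₂ β₂ k)) * ξ ^ 2 -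
      2 * o (φ (auxS α₂ β₂ k)) * ξ + o (φ (auxW α₂ β₂ k))) * hinv
  let e₁ : L := ι (cubic α₁ β₁ * duplG α₁ β₁ k) / ι (duplB α₁ β₁ k) ^ 2
  have he₁ : e₁ * e₁ = φ (cubicProd α₁ β₁) := by
    have hmap : (cubic α₁ β₁).map C = X ^ 3 + C (C α₁) * X ^ 2 + C (C β₁) * X := by
      simp [cubic]
    rw [cubicProd, map_mul, hmap]
    simp only [map_mul, map_add, map_pow, hφC, hφX, e₁]
    simp only [map_mul, map_add, map_pow] at hcur
    field_simp
    linear_combination -hcur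
  have hD₁' : auxDen φ α₁ β₁ k e₁ false = 0 := by
    change φ (auxD α₁ β₁ k) = 0
    simp only [auxD, map_pow, map_sub, map_mul, hφC, hφX]
    field_simp
    simp
  have hN₁' : auxNum φ α₁ β₁ k e₁ false ≠ 0 := by
    have : auxNum φ α₁ β₁ k e₁ false =
        4 * ι (cubic α₁ β₁) * (ι (duplG α₁ β₁ k) / ι (duplB α₁ β₁ k)) ^ 2 := by
      change φ (auxS α₁ β₁ k) + 2 * φ (C (duplG α₁ β₁ k)) * e₁ = _
      simp only [auxS, map_add, map_mul, map_ofNat, hφC, hφX, e₁]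
      simp only [map_mul, map_add, map_pow] at hcur
      field_simp
      linear_combination 2 * hcur
    rw [this]
    refine mul_ne_zero (mul_ne_zero (by simp) hf₁) (pow_ne_zero 2 (div_ne_zero hG₁ hB₁))
  have hD₂' : φ (auxD α₂ β₂ k) ≠ 0 := by
    rw [hφD]
    refine pow_ne_zero 2 fun h => hΔ ?_
    simp only [map_sub, map_mul]
    field_simp at h
    linear_combination h
  let e₂ : S := o (2 * ι (duplG α₂ β₂ k))⁻¹ * (o (φ (auxD α₂ β₂ k)) * ξ - o (φ (auxS α₂ β₂ k)))
  have hinv₂ : o (2 * ι (duplG α₂ β₂ k))⁻¹ * (2 * o (ι (duplG α₂ β₂ k))) = 1 := by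
    rw [← map_ofNat o 2, ← map_mul, ← map_mul, inv_mul_cancel₀ (mul_ne_zero two_ne_zero hG₂),
      map_one]
  have he₂ : e₂ * e₂ = o (φ (cubicProd α₂ β₂)) := by
    have hs := congrArg o hsq
    simp only [map_sub, map_mul, map_pow, map_ofNat, hφC] at hs
    linear_combination o (2 * ι (duplG α₂ β₂ k))⁻¹ ^ 2 * (o (φ (auxD α₂ β₂ k)) * hroot' + hs) +
      o (φ (cubicProd α₂ β₂)) * (o (2 * ι (duplG α₂ β₂ k))⁻¹ * (2 * o (ι (duplG α₂ β₂ k))) + 1) *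
        hinv₂
  have hN₂ : auxNum (o.comp φ) α₂ β₂ k e₂ false = auxDen (o.comp φ) α₂ β₂ k e₂ false * ξ := by
    change o (φ (auxS α₂ β₂ k)) + 2 * o (φ (C (duplG α₂ β₂ k))) * e₂ = o (φ (auxD α₂ β₂ k)) * ξ
    rw [hφC]
    linear_combination (o (φ (auxD α₂ β₂ k)) * ξ - o (φ (auxS α₂ β₂ k))) * hinv₂
  have hψ := congrArg (biHom (o.comp φ) (o e₁) e₂ (by rw [← map_mul, he₁]; rfl) he₂) hF
  rw [map_redForm, biHom_eta₁, biHom_eta₂, biHom_comp_biC, map_zero,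
    redForm_eq_of_den_eq_zero (ξ := ξ) (hc := hc) (hξ := hN₂)
      (hD := by rw [← map_auxDen, hD₁', map_zero]), ← map_auxNum] at hψ
  have hden₂ : auxDen (o.comp φ) α₂ β₂ k e₂ false = o (φ (auxD α₂ β₂ k)) := rfl
  rw [hden₂, ← map_pow, ← map_pow, ← map_mul] at hψ
  have hunit : IsUnit (o (auxNum φ α₁ β₁ k e₁ false ^ i₀ * φ (auxD α₂ β₂ k) ^ N)) :=
    (IsUnit.mk0 _ (mul_ne_zero (pow_ne_zero _ hN₁') (pow_ne_zero _ hD₂'))).map o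
  replace hψ := hunit.mul_right_eq_zero.mp hψ
  have hslice := eval₂_slice (algebraMap R K) c k N i₀ (o.comp (algebraMap K[X] L)) ξ
  have hX : μ X = X := map_X _
  have hterm (a : ℕ × ℕ × ℕ) : (o.comp φ) (C (C (c a))) * (o.comp φ) (C X) ^ a.1 * ξ ^ a.2.2 =
      (o.comp (algebraMap K[X] L)) (C (algebraMap R K (c a))) *
        (o.comp (algebraMap K[X] L)) X ^ a.1 * ξ ^ a.2.2 := by
    rw [hμC, ← hX]
    simp only [RingHom.comp_apply, hφC]
    rfl
  simp only [hterm] at hψ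
  rw [← hslice] at hψ
  obtain ⟨hA₁, hdA₁, hdB₁, -⟩ := dupl_degree α₁ β₁ k
  obtain ⟨hA₂, hdA₂, hdB₂, -⟩ := dupl_degree α₂ β₂ k
  have hinj : Function.Injective (algebraMap R K) := IsFractionRing.injective R K
  have hinj' : Function.Injective ((algebraMap K (AlgebraicClosure K)).comp (algebraMap R K)) :=
    (algebraMap K (AlgebraicClosure K)).injective.comp hinj
  have hnc {α β : R} (hβ : β ≠ 0) (hd : α ^ 2 ≠ 4 * β) (z : AlgebraicClosure K) :
      ¬ (aeval z (μ (duplA α β k)) = 0 ∧ aeval z (μ (duplB α β k)) = 0) := by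
    have := dupl_no_common_zero α β ((algebraMap K (AlgebraicClosure K)).comp (algebraMap R K))
      ((map_ne_zero_iff _ hinj').mpr hβ) (fun h => hd (hinj' (by simpa only [map_pow, map_mul,
        map_ofNat] using h))) z k
    rwa [← eval₂_map, ← eval₂_map] at this
  have hzero := eq_zero_of_specQuad_dvd (α := algebraMap R K α₂) (β := algebraMap R K β₂)
    ((map_ne_zero_iff _ hinj).mpr hβ₂) (fun h => hd₂ (hinj (by simpa only [map_pow, map_mul,
      map_ofNat] using h))) (hA₁.map _) (hA₂.map _)
    ((natDegree_map_eq_of_injective hinj _).trans hdA₁)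
    ((natDegree_map_eq_of_injective hinj _).trans hdA₂)
    ((natDegree_map_le).trans_lt hdB₁) ((natDegree_map_le).trans_lt hdB₂) (hnc hβ₁ hd₁)
    (hnc hβ₂ hd₂) (fun j => slice_natDegree_lt (algebraMap R K) c k N i₀ j) (hdvd _ hψ)
  have := slice_coeff (algebraMap R K) c k N i₀ l₀ j₀ hbox
  rw [hzero, coeff_zero, coeff_zero, eq_comm, map_eq_zero_iff _ hinj] at this
  exact hc₀ this

theorem auxForm_ne_zero (hβ₁ : β₁ ≠ 0) (hd₁ : α₁ ^ 2 ≠ 4 * β₁) (hβ₂ : β₂ ≠ 0)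
    (hd₂ : α₂ ^ 2 ≠ 4 * β₂)
    (hns : ∀ p q : R[X], p ^ 2 = cubic α₁ β₁ * cubic α₂ β₂ * q ^ 2 → q = 0) {k N : ℕ} (hk : 1 ≤ k)
    {c : ℕ × ℕ × ℕ → R} {a₀ : ℕ × ℕ × ℕ} (ha₀ : a₀ ∈ auxBox k N) (hc₀ : c a₀ ≠ 0) :
    auxForm biC α₁ β₁ α₂ β₂ k N (eta₁ : Biquad (cubicProd α₁ β₁) (cubicProd α₂ β₂)) eta₂ c
      false false ≠ 0 :=
  auxForm_ne_zero_of_isFractionRing (FractionRing R) (FractionRing (FractionRing R)[X]) hβ₁ hd₁ hβ₂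
    hd₂ hns hk ha₀ hc₀

end Independence

end VojtaCurve

namespace VojtaCurve

open Polynomial NumberField

theorem exists_siegel_constant (K : Type*) [Field K] [NumberField K] :
    ∃ C : ℝ, ∀ (α β : Type) [Fintype α] [Fintype β] [DecidableEq α] [DecidableEq β]
      (a : Matrix α β (𝓞 K)) (A : ℝ), a ≠ 0 → 0 < Fintype.card α →
      Fintype.card α < Fintype.card β → (∀ k l, house ((a k l : 𝓞 K) : K) ≤ A) →
      ∃ ξ : β → 𝓞 K, ξ ≠ 0 ∧ a.mulVec ξ = 0 ∧ ∀ l, house (ξ l : K) ≤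
        C * ((C * (Fintype.card β : ℕ) * A) ^ (((Fintype.card α : ℕ) : ℝ) /
          ((Fintype.card β : ℕ) - (Fintype.card α : ℕ)))) := by
  classical
  exact ⟨_, fun α β _ _ _ _ a A ha h0 h hA =>
    house.exists_ne_zero_int_vec_house_le K a ha h0 h rfl hA rfl⟩

theorem exists_siegel (K : Type*) [Field K] [NumberField K] :
    ∃ C : ℝ, 1 ≤ C ∧ ∀ (α β : Type) [Fintype α] [Fintype β] (a : Matrix α β (𝓞 K)) (A : ℝ),
      1 ≤ A → 0 < Fintype.card β → 2 * Fintype.card α ≤ Fintype.card β →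
      (∀ (v : InfinitePlace K) (k l), v (a k l) ≤ A) →
      ∃ ξ : β → 𝓞 K, ξ ≠ 0 ∧ a.mulVec ξ = 0 ∧
        ∀ (v : InfinitePlace K) (l), v (ξ l) ≤ C * ((Fintype.card β : ℕ) * A) := by
  classical
  obtain ⟨C, hC⟩ := exists_siegel_constant K
  refine ⟨max 1 |C| * max 1 |C|, one_le_mul_of_one_le_of_one_le (le_max_left _ _) (le_max_left _ _),
    fun α β _ _ a A hA h0 h2 ha => ?_⟩
  set q : ℝ := ((Fintype.card β : ℕ) : ℝ) with hq
  set p : ℝ := ((Fintype.card α : ℕ) : ℝ) with hp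
  have hq1 : 1 ≤ q := Nat.one_le_cast.mpr h0
  have hD : 1 ≤ max 1 |C| := le_max_left _ _
  have hqA : 1 ≤ q * A := one_le_mul_of_one_le_of_one_le hq1 hA
  have hDD : 1 ≤ max 1 |C| * max 1 |C| := one_le_mul_of_one_le_of_one_le hD hD
  by_cases hcase : a ≠ 0 ∧ 0 < Fintype.card α
  · have hle (k l) : house ((a k l : 𝓞 K) : K) ≤ A := by
      rw [house_eq_sup']
      obtain ⟨φ, -, hφ⟩ := Finset.exists_mem_eq_sup' Finset.univ_nonempty
        (fun φ : K →+* ℂ => ‖φ (a k l)‖₊)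
      rw [hφ]
      exact ha (.mk φ) k l
    obtain ⟨ξ, h1, h3, h4⟩ := hC α β a A hcase.1 hcase.2 (by omega) hle
    refine ⟨ξ, h1, h3, fun v l => ?_⟩
    have hv : v (ξ l) ≤ house (ξ l : K) := by
      rw [← v.norm_embedding_eq]
      exact norm_embedding_le_house _ _
    refine (hv.trans (h4 l)).trans ?_
    have h2' : 2 * p ≤ q := by
      rw [hp, hq]
      exact_mod_cast h2
    have hp0 : 0 < p := Nat.cast_pos.mpr hcase.2
    have he0 : 0 ≤ p / (q - p) := div_nonneg hp0.le (by linarith)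
    have he1 : p / (q - p) ≤ 1 := by
      rw [div_le_one (by linarith)]
      linarith
    have hbase : 1 ≤ max 1 |C| * (q * A) := one_le_mul_of_one_le_of_one_le hD hqA
    calc C * (C * q * A) ^ (p / (q - p)) ≤ |C| * |(C * q * A) ^ (p / (q - p))| :=
          (le_abs_self _).trans (abs_mul _ _).le
      _ ≤ max 1 |C| * (max 1 |C| * (q * A)) ^ (p / (q - p)) := by
          refine mul_le_mul (le_max_right _ _) ((Real.abs_rpow_le_abs_rpow _ _).trans
            (Real.rpow_le_rpow (abs_nonneg _) ?_ he0)) (abs_nonneg _) (by positivity)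
          rw [mul_assoc, abs_mul, abs_of_pos (by linarith : 0 < q * A)]
          gcongr
          exact le_max_right _ _
      _ ≤ max 1 |C| * (max 1 |C| * (q * A)) ^ (1 : ℝ) := by
          gcongr
      _ = _ := by rw [Real.rpow_one]; ring
  · have : Nonempty β := Fintype.card_pos_iff.mp h0
    refine ⟨1, one_ne_zero, ?_, fun v l => ?_⟩
    · rcases not_and_or.mp hcase with h | h
      · rw [not_not.mp h, Matrix.zero_mulVec]
      · have : IsEmpty α := Fintype.card_eq_zero_iff.mp (by omega)
        exact Subsingleton.elim _ _
    · have : v ((1 : β → 𝓞 K) l : K) = 1 := by simp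
      rw [this]
      exact one_le_mul_of_one_le_of_one_le hDD hqA

section Components

variable {R : Type*} [CommRing R] {g₁ g₂ : R[X][X]}

/-- The components of an element of `R[x, u][η₁, η₂]`. -/
def biComp (y z : Bool) (F : Biquad g₁ g₂) : R[X][X] :=
  bif z then bif y then F.im.im else F.im.re else bif y then F.re.im else F.re.re

/-- The coefficient of `xⁱ uʲ` in a component of an element of `R[x, u][η₁, η₂]`. -/
noncomputable def biCoeff (y z : Bool) (i j : ℕ) : Biquad g₁ g₂ →+ R where
  toFun F := ((biComp y z F).coeff j).coeff i
  map_zero' := by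
    cases y <;> cases z <;> exact (congrArg (coeff · i) (coeff_zero j)).trans (coeff_zero i)
  map_add' F G := by
    have h : biComp y z (F + G) = biComp y z F + biComp y z G := by cases y <;> cases z <;> rfl
    rw [h, coeff_add, coeff_add]

theorem biCoeff_apply (y z : Bool) (i j : ℕ) (F : Biquad g₁ g₂) :
    biCoeff y z i j F = ((biComp y z F).coeff j).coeff i := rfl

theorem biCoeff_biC_mul (y z : Bool) (i j : ℕ) (r : R) (F : Biquad g₁ g₂) :
    biCoeff y z i j (biC (C (C r)) * F) = r * biCoeff y z i j F := by
  have h : biComp y z (biC (C (C r)) * F) = C (C r) * biComp y z F := by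
    rw [Biquad.mul_eq, biC_apply]
    cases y <;> cases z <;> simp [biComp, Biquad.mk]
  rw [biCoeff_apply, h, coeff_C_mul, coeff_C_mul, biCoeff_apply]

theorem BiWt.biComp {d e : ℤ} {F : Biquad g₁ g₂} (h : BiWt d e F) (y z : Bool) :
    Wt d e (biComp y z F) := by
  obtain ⟨h1, h2, h3, h4⟩ := h
  cases y <;> cases z
  exacts [h1, h3.mono (by omega) (by omega), h2.mono (by omega) (by omega),
    h4.mono (by omega) (by omega)]

end Components

theorem exists_auxForm {K : Type*} [Field K] [NumberField K] (α₁ β₁ α₂ β₂ : 𝓞 K) {N : ℕ}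
    (hN : 1000 ≤ N) : ∃ M : ℝ, 2 ≤ M ∧ ∀ k, ∃ c : ℕ × ℕ × ℕ → 𝓞 K, (∃ a ∈ auxBox k N, c a ≠ 0) ∧
      ∀ s t y z i j,
        (biCoeff y z i j (auxForm biC α₁ β₁ α₂ β₂ k N
          (eta₁ : Biquad (cubicProd α₁ β₁) (cubicProd α₂ β₂)) eta₂ c s t) ≠ 0 →
            i < (4 * N - 10) * 4 ^ k ∧ j < 4 * N - 10) ∧
        ∀ v : InfinitePlace K, v ((biCoeff y z i j (auxForm biC α₁ β₁ α₂ β₂ k N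
          (eta₁ : Biquad (cubicProd α₁ β₁) (cubicProd α₂ β₂)) eta₂ c s t) : 𝓞 K) : K) ≤
            M ^ 4 ^ k := by
  classical
  obtain ⟨C₀, hC₀, siegel⟩ := exists_siegel K
  obtain ⟨c₀, hc1, hc₀⟩ : ∃ c₀ : ℝ, 1 ≤ c₀ ∧ ∀ v : InfinitePlace K, v (α₁ : K) ≤ c₀ ∧
      v (β₁ : K) ≤ c₀ ∧ v (α₂ : K) ≤ c₀ ∧ v (β₂ : K) ≤ c₀ := by
    refine ⟨1 + ∑ v : InfinitePlace K, (v (α₁ : K) + v (β₁ : K) + v (α₂ : K) + v (β₂ : K)), ?_,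
      fun v => ?_⟩
    · have : 0 ≤ ∑ v : InfinitePlace K, (v (α₁ : K) + v (β₁ : K) + v (α₂ : K) + v (β₂ : K)) :=
        Finset.sum_nonneg fun v _ => by positivity
      linarith
    · have := Finset.single_le_sum (f := fun v : InfinitePlace K =>
        v (α₁ : K) + v (β₁ : K) + v (α₂ : K) + v (β₂ : K)) (fun v _ => by positivity)
        (Finset.mem_univ v)
      have h1 := apply_nonneg v (α₁ : K)
      have h2 := apply_nonneg v (β₁ : K)
      have h3 := apply_nonneg v (α₂ : K)
      have h4 := apply_nonneg v (β₂ : K)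
      refine ⟨?_, ?_, ?_, ?_⟩ <;> linarith
  set T := (4 * c₀ ^ 2) ^ (8 * (N + 1)) with hT
  have hT1 : 1 ≤ T := one_le_pow₀ (by nlinarith)
  set S : ℝ := 8 * (N + 1) ^ 2 with hS
  have hS8 : 8 ≤ S := by
    have : (1 : ℝ) ≤ (N + 1) ^ 2 := one_le_pow₀ (by linarith [(Nat.cast_nonneg N : (0 : ℝ) ≤ N)])
    linarith
  refine ⟨C₀ * S ^ 2 * T ^ 2, ?_, fun k => ?_⟩
  · have h1 : 1 ≤ T ^ 2 := one_le_pow₀ hT1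
    have h2 : 1 * 64 ≤ C₀ * S ^ 2 := by
      gcongr
      nlinarith
    nlinarith
  set n := 4 ^ k with hn
  have hn1 : 1 ≤ n := Nat.one_le_pow _ _ (by norm_num)
  set L := 4 * N - 10 with hL
  let I : Finset (ℕ × ℕ) := (Finset.range (4 * (N + 1) * n + 1) ×ˢ Finset.range (4 * N + 1)) \
    (Finset.range (L * n) ×ˢ Finset.range L)
  have hIcard : I.card ≤ 104 * N * n := by
    have hsub : Finset.range (L * n) ×ˢ Finset.range L ⊆
        Finset.range (4 * (N + 1) * n + 1) ×ˢ Finset.range (4 * N + 1) := by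
      refine Finset.product_subset_product (Finset.range_subset_range.mpr ?_)
        (Finset.range_subset_range.mpr (by omega))
      exact (Nat.mul_le_mul_right n (by omega)).trans (Nat.le_succ _)
    rw [Finset.card_sdiff_of_subset hsub, Finset.card_product, Finset.card_product,
      Finset.card_range, Finset.card_range, Finset.card_range, Finset.card_range]
    obtain ⟨L', hL'⟩ : ∃ L' : ℕ, 4 * N = L' + 10 := ⟨4 * N - 10, by omega⟩
    have : L = L' := by omega
    rw [this, Nat.sub_le_iff_le_add]
    zify at hL' hn1 hN ⊢
    rw [show (L' : ℤ) = 4 * N - 10 by linarith]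
    nlinarith [mul_nonneg (by linarith : (0 : ℤ) ≤ N) (by linarith : (0 : ℤ) ≤ n - 1)]
  have hbox : Fintype.card {a // a ∈ auxBox k N} = 4 * n * ((N + 1) * (N + 1)) := by
    rw [Fintype.card_coe, auxBox, Finset.card_product, Finset.card_product, Finset.card_range,
      Finset.card_range]
  set A := T ^ n with hA
  have hA1 : 1 ≤ A := one_le_pow₀ hT1
  have hAeq : (4 * c₀ ^ 2) ^ (8 * (N + 1) * 4 ^ k) = A := by rw [hA, hT, ← pow_mul]
  have hterm (v : InfinitePlace K) (s t y z : Bool) (i j : ℕ) {a : ℕ × ℕ × ℕ}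
      (ha : a ∈ auxBox k N) :
      v ((biCoeff y z i j (biTerm α₁ β₁ α₂ β₂ k N s t a) : 𝓞 K) : K) ≤ A := by
    obtain ⟨h1, h2, h3, h4⟩ := biTerm_seminorm_le α₁ β₁ α₂ β₂ k N (placeSeminorm v.1)
      (placeSeminorm_one_le v.1) hc1 (hc₀ v).1 (hc₀ v).2.1 (hc₀ v).2.2.1 (hc₀ v).2.2.2 s t ha i j
    rw [hAeq] at h1 h2 h3 h4
    cases y <;> cases z
    exacts [h1, h3, h2, h4]
  let mat : Matrix (Bool × Bool × Bool × Bool × {p // p ∈ I}) {a // a ∈ auxBox k N} (𝓞 K) :=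
    fun e a => biCoeff e.2.2.1 e.2.2.2.1 e.2.2.2.2.1.1 e.2.2.2.2.1.2
      (biTerm α₁ β₁ α₂ β₂ k N e.1 e.2.1 a.1)
  obtain ⟨ξ, hξ0, hξ, hξle⟩ := siegel _ _ mat A hA1 (by rw [hbox]; positivity) (by
    rw [hbox]
    simp only [Fintype.card_prod, Fintype.card_bool, Fintype.card_coe]
    nlinarith) (fun v e a => hterm v _ _ _ _ _ _ a.2)
  let c : ℕ × ℕ × ℕ → 𝓞 K := fun a => if ha : a ∈ auxBox k N then ξ ⟨a, ha⟩ else 0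
  have hform (s t y z : Bool) (i j : ℕ) : biCoeff y z i j (auxForm biC α₁ β₁ α₂ β₂ k N
      (eta₁ : Biquad (cubicProd α₁ β₁) (cubicProd α₂ β₂)) eta₂ c s t) =
      ∑ a : {a // a ∈ auxBox k N}, biCoeff y z i j (biTerm α₁ β₁ α₂ β₂ k N s t a.1) * ξ a := by
    rw [auxForm, map_sum, ← Finset.sum_coe_sort]
    refine Finset.sum_congr rfl fun a _ => ?_
    rw [biCoeff_biC_mul, mul_comm]
    simp only [c, a.2, dif_pos, Subtype.coe_eta]
    rfl
  refine ⟨c, ?_, fun s t y z i j => ⟨fun hne => ?_, fun v => ?_⟩⟩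
  · obtain ⟨a, ha⟩ := Function.ne_iff.mp hξ0
    exact ⟨a.1, a.2, by
      simp only [c, a.2, dif_pos, Subtype.coe_eta]
      exact ha⟩
  · rw [hform] at hne
    by_contra hcon
    refine hne ?_
    by_cases hI : (i, j) ∈ I
    · exact congrFun hξ (s, t, y, z, ⟨(i, j), hI⟩)
    · refine Finset.sum_eq_zero fun a _ => ?_
      by_cases h0 : biCoeff y z i j (biTerm α₁ β₁ α₂ β₂ k N s t a.1) = 0
      · rw [h0, zero_mul]
      exfalso
      obtain ⟨h1, h2⟩ := (biTerm_biWt α₁ β₁ α₂ β₂ k N s t a.2).biComp y z i j h0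
      refine hI (Finset.mem_sdiff.mpr ⟨?_, fun h => hcon ?_⟩)
      · rw [Finset.mem_product, Finset.mem_range, Finset.mem_range]
        refine ⟨?_, by omega⟩
        have : (i : ℤ) ≤ 4 * (N + 1) * 4 ^ k := by linarith
        rw [Nat.lt_succ_iff, hn]
        exact_mod_cast this
      · rw [Finset.mem_product, Finset.mem_range, Finset.mem_range] at h
        exact h
  · rw [hform]
    push_cast
    refine (v.1.sum_le _ _).trans ?_
    have hle (a : {a // a ∈ auxBox k N}) : v.1 (((biCoeff y z i j (biTerm α₁ β₁ α₂ β₂ k N s t a.1) :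
        𝓞 K) : K) * ξ a) ≤ A * (C₀ * (((4 * n * ((N + 1) * (N + 1)) : ℕ) : ℝ) * A)) := by
      rw [map_mul, ← hbox]
      exact mul_le_mul (hterm v s t y z i j a.2) (hξle v a) (apply_nonneg _ _) (by linarith)
    refine (Finset.sum_le_sum fun a _ => hle a).trans ?_
    rw [Finset.sum_const, Finset.card_univ, hbox, nsmul_eq_mul]
    have hSn : ((4 * n * ((N + 1) * (N + 1)) : ℕ) : ℝ) ≤ S ^ n := by
      have h2 : (n : ℝ) ≤ 2 ^ n := mod_cast Nat.lt_two_pow_self.le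
      have h4 : (4 : ℝ) * (N + 1) ^ 2 ≤ (4 * (N + 1) ^ 2) ^ n :=
        le_self_pow₀ (by linarith) (by omega)
      calc ((4 * n * ((N + 1) * (N + 1)) : ℕ) : ℝ) = n * (4 * (N + 1) ^ 2) := by push_cast; ring
        _ ≤ 2 ^ n * (4 * (N + 1) ^ 2) ^ n := by gcongr
        _ = S ^ n := by
            rw [← mul_pow, hS]
            congr 1
            ring
    calc _ = C₀ * ((4 * n * ((N + 1) * (N + 1)) : ℕ) : ℝ) ^ 2 * A ^ 2 := by ring
      _ ≤ C₀ ^ n * (S ^ n) ^ 2 * A ^ 2 := by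
          gcongr
          exact le_self_pow₀ hC₀ (by omega)
      _ = _ := by rw [hA]; ring_nf

end VojtaCurve

namespace VojtaCurve

open Polynomial NumberField Height

section NonSquare

variable {R : Type*} [CommRing R] [IsDomain R] {α₁ β₁ α₂ β₂ : R}

theorem cubicProd_natDegree (α β : R) : (cubicProd α β).natDegree = 3 := by
  have hc := cubic_monic α β
  rw [cubicProd, natDegree_mul (C_ne_zero.mpr hc.ne_zero) (hc.map C).ne_zero, natDegree_C,
    hc.natDegree_map, cubic_natDegree]

theorem eq_zero_of_sq_eq_cubicProd_mul {p q : R[X][X]} {α β : R}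
    (h : p ^ 2 = cubicProd α β * q ^ 2) : q = 0 :=
  eq_zero_of_sq_eq_of_odd_natDegree (by rw [cubicProd_natDegree]; decide) h

theorem eq_zero_of_sq_eq_cubicProd_mul_cubicProd {c : R}
    (hc : Odd ((cubic α₁ β₁ * cubic α₂ β₂).rootMultiplicity c)) {p q : R[X][X]}
    (h : p ^ 2 = cubicProd α₁ β₁ * cubicProd α₂ β₂ * q ^ 2) : q = 0 := by
  refine eq_zero_of_sq_eq_of_odd_rootMultiplicity (c := C c) ?_ h
  have h0 : cubic α₁ β₁ * cubic α₂ β₂ ≠ 0 :=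
    mul_ne_zero (cubic_monic α₁ β₁).ne_zero (cubic_monic α₂ β₂).ne_zero
  have e : cubicProd α₁ β₁ * cubicProd α₂ β₂ =
      C (cubic α₁ β₁ * cubic α₂ β₂) * (cubic α₁ β₁ * cubic α₂ β₂).map C := by
    rw [cubicProd, cubicProd, C_mul, Polynomial.map_mul]
    ring
  rw [e, rootMultiplicity_mul (mul_ne_zero (C_ne_zero.mpr h0)
    ((Polynomial.map_ne_zero_iff C_injective).mpr h0)), rootMultiplicity_C, zero_add,
    ← eq_rootMultiplicity_map C_injective]
  exact hc

end NonSquare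

section NormDegree

variable {R : Type*} [CommRing R] [IsDomain R] {α₁ β₁ α₂ β₂ : R}

omit [IsDomain R] in
theorem xDegree_cubicProd_le (α β : R) : xDegree (cubicProd α β) ≤ 3 := by
  rw [cubicProd]
  refine (xDegree_mul_le _ _).trans ?_
  rw [xDegree_map_C, add_zero]
  exact (xDegree_C_le _).trans (cubic_natDegree_le α β)

theorem natDegree_biNorm_le (F : Biquad (cubicProd α₁ β₁) (cubicProd α₂ β₂)) {m : ℕ}
    (h : ∀ y z, (biComp y z F).natDegree ≤ m) : (biNorm F).natDegree ≤ 4 * m + 12 := by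
  have hh2 : (2 : R[X][X]).natDegree = 0 := by
    rw [← map_ofNat C 2, natDegree_C]
  have hadd (a b : R[X][X]) : (a + b).natDegree ≤ max a.natDegree b.natDegree :=
    Polynomial.natDegree_add_le a b
  have hsub (a b : R[X][X]) : (a - b).natDegree ≤ max a.natDegree b.natDegree :=
    Polynomial.natDegree_sub_le a b
  have hmul (a b : R[X][X]) : (a * b).natDegree ≤ a.natDegree + b.natDegree :=
    Polynomial.natDegree_mul_le
  exact degree_biNorm_le (e := 3) (Polynomial.natDegree : R[X][X] → ℕ) hadd hsub hmul hh2
    (cubicProd_natDegree α₁ β₁).le (cubicProd_natDegree α₂ β₂).le (h false false)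
    (h true false) (h false true) (h true true)

omit [IsDomain R] in
theorem xDegree_biNorm_le (F : Biquad (cubicProd α₁ β₁) (cubicProd α₂ β₂)) {m : ℕ}
    (h : ∀ y z, xDegree (biComp y z F) ≤ m) : xDegree (biNorm F) ≤ 4 * m + 12 := by
  have hh2 : xDegree (2 : R[X][X]) = 0 := by
    rw [← map_ofNat (mapRingHom C) 2, coe_mapRingHom, xDegree_map_C]
  exact degree_biNorm_le (e := 3) xDegree xDegree_add_le xDegree_sub_le xDegree_mul_le
    hh2
    (xDegree_cubicProd_le α₁ β₁) (xDegree_cubicProd_le α₂ β₂) (h false false)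
    (h true false) (h false true) (h true true)

end NormDegree

theorem exists_forall_infinitePlace_le {K : Type*} [Field K] [NumberField K]
    (f : InfinitePlace K → ℝ) : ∃ C : ℝ, 1 ≤ C ∧ ∀ v, f v ≤ C := by
  obtain ⟨C, hC⟩ := (Set.finite_range f).bddAbove
  exact ⟨max 1 C, le_max_left _ _, fun v => (hC ⟨v, rfl⟩).trans (le_max_right _ _)⟩

theorem polySeminorm_one_le_mul {R : Type*} [CommRing R] (ν : RingSeminorm R) (p : R[X]) {m : ℕ}
    {B : ℝ} (hm : ∀ i, p.coeff i ≠ 0 → i < m) (hB : 0 ≤ B) (h : ∀ i, ν (p.coeff i) ≤ B) :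
    polySeminorm ν 1 p ≤ m * B := by
  rw [polySeminorm_def, Polynomial.sum_def]
  refine (Finset.sum_le_card_nsmul _ _ B fun i _ => by simpa using h i).trans ?_
  rw [nsmul_eq_mul]
  gcongr
  calc p.support.card ≤ (Finset.range m).card := Finset.card_le_card fun i hi =>
        Finset.mem_range.mpr (hm i (mem_support_iff.mp hi))
    _ = m := Finset.card_range m

set_option maxHeartbeats 800000 in
theorem exists_order_lt {K : Type*} [Field K] [NumberField K] (α₁ β₁ α₂ β₂ c : 𝓞 K)
    (hc : Odd ((cubic α₁ β₁ * cubic α₂ β₂).rootMultiplicity c)) (L : ℕ) {M : ℝ} (hM : 1 ≤ M) :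
    ∃ C : ℝ, 1 ≤ C ∧ ∀ (n : ℕ), 1 ≤ n → ∀ F : Biquad (cubicProd α₁ β₁) (cubicProd α₂ β₂), F ≠ 0 →
      (∀ y z i j, (biCoeff y z i j F ≠ 0 → i < L * n ∧ j < L) ∧
        ∀ v : InfinitePlace K, v ((biCoeff y z i j F : 𝓞 K) : K) ≤ M ^ n) →
      ∀ x u : K, C ^ n < mulHeight₁ u → C < mulHeight₁ x → ∀ w,
        (X - Polynomial.C x) ^ w ∣ (biNorm F).eval₂ (mapRingHom (algebraMap (𝓞 K) K))
          (Polynomial.C u) → w < n + (4 * L + 13) := by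
  obtain ⟨G, hG1, hG⟩ := exists_forall_infinitePlace_le (K := K) fun v =>
    max (polySeminorm (polyNorm v) 1 (cubicProd α₁ β₁))
      (polySeminorm (polyNorm v) 1 (cubicProd α₂ β₂))
  set D := 4 * L + 13 with hD
  set S : ℝ := 32 * G ^ 5 * (2 * (L * L + 1) * M) ^ 4 * (8 * L + 26) with hS
  have hL0 : (0 : ℝ) ≤ L := Nat.cast_nonneg L
  have hG5 : 1 ≤ G ^ 5 := one_le_pow₀ hG1
  have hS0 : 1 ≤ 2 * ((L : ℝ) * L + 1) * M := by nlinarith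
  have hS0' : 1 ≤ (2 * ((L : ℝ) * L + 1) * M) ^ 4 := one_le_pow₀ hS0
  have hS1 : 8 * L + 26 ≤ S := by
    rw [hS]
    nlinarith [mul_le_mul hG5 hS0' zero_le_one (by linarith)]
  refine ⟨(S ^ 3 ^ D) ^ Module.finrank ℚ K, one_le_pow₀ (one_le_pow₀ (by linarith)),
    fun n hn F hF hcoeff x u hu hx w hw => ?_⟩
  have h0 : biNorm F ≠ 0 := biNorm_ne_zero two_ne_zero
    (fun p q h => eq_zero_of_sq_eq_cubicProd_mul h) (fun p q h => eq_zero_of_sq_eq_cubicProd_mul h)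
    (fun p q h => eq_zero_of_sq_eq_cubicProd_mul_cubicProd hc h) hF
  have hdeg (y z : Bool) : (biComp y z F).natDegree ≤ L := by
    refine natDegree_le_iff_coeff_eq_zero.mpr fun j hj => ?_
    ext i
    by_contra h
    exact absurd ((hcoeff y z i j).1 (by simpa [biCoeff_apply] using h)).2 (by omega)
  have hxdeg (y z : Bool) : xDegree (biComp y z F) ≤ L * n := by
    refine xDegree_le_iff.mpr fun j => natDegree_le_iff_coeff_eq_zero.mpr fun i hi => ?_
    by_contra h
    exact absurd ((hcoeff y z i j).1 h).1 (by omega)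
  have hnorm (v : InfinitePlace K) (y z : Bool) :
      polySeminorm (polyNorm v) 1 (biComp y z F) ≤ (2 * (L * L + 1) * M) ^ n := by
    refine (polySeminorm_one_le_mul _ _ (m := L) (B := (L * n : ℕ) * M ^ n) (fun j hj => ?_)
      (by positivity) fun j => ?_).trans ?_
    · by_contra h
      refine hj (Polynomial.ext fun i => ?_)
      by_contra h'
      exact h ((hcoeff y z i j).1 (by simpa [biCoeff_apply] using h')).2
    · exact polySeminorm_one_le_mul _ _ (fun i hi => ((hcoeff y z i j).1 hi).1) (by positivity)
        fun i => (hcoeff y z i j).2 v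
    · have h2 : (n : ℝ) ≤ 2 ^ n := mod_cast Nat.lt_two_pow_self.le
      have h3 : (L : ℝ) * L ≤ L * L + 1 := by linarith
      calc (L : ℝ) * ((L * n : ℕ) * M ^ n) = n * (L * L) * M ^ n := by push_cast; ring
        _ ≤ 2 ^ n * (L * L + 1) ^ n * M ^ n := by
            gcongr
            exact h3.trans (le_self_pow₀ (by nlinarith) (by omega))
        _ = _ := by rw [mul_pow, mul_pow]
  have hSn (m : ℕ) (hm : 1 ≤ m) : S ≤ S ^ m := le_self_pow₀ (by linarith) (by omega)
  have hnD : (8 * L + 26 : ℝ) * n ≤ S ^ n := by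
    have h2 : (n : ℝ) ≤ 2 ^ (n - 1) := by
      have : n ≤ 2 ^ (n - 1) := by
        have := @Nat.lt_two_pow_self (n - 1)
        omega
      exact_mod_cast this
    calc (8 * L + 26 : ℝ) * n ≤ S * S ^ (n - 1) := by
          gcongr
          exact h2.trans (pow_le_pow_left₀ (by norm_num) (by linarith) _)
      _ = S ^ n := by rw [← pow_succ', Nat.sub_add_cancel hn]
  have hpoly (v : InfinitePlace K) (j : ℕ) : polyNorm v ((biNorm F).coeff j) ≤ S ^ n := by
    have h1 := coeff_le_polySeminorm (polyNorm v) 1 (biNorm F) j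
    rw [NNReal.coe_one, one_pow, mul_one] at h1
    refine (h1.trans (seminorm_biNorm_le _ (polySeminorm_one_le _ 1 (polySeminorm_one_le _ 1
      (placeSeminorm_one_le v.1))) hG1 ((le_max_left _ _).trans (hG v))
      ((le_max_right _ _).trans (hG v)) (hnorm v false false) (hnorm v true false)
      (hnorm v false true) (hnorm v true true))).trans ?_
    have h32 : 1 ≤ 32 * G ^ 5 := by linarith
    calc 32 * G ^ 5 * ((2 * (L * L + 1) * M) ^ n) ^ 4
        ≤ (32 * G ^ 5) ^ n * ((2 * (L * L + 1) * M) ^ n) ^ 4 * (8 * L + 26) ^ n := by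
          refine (mul_le_mul_of_nonneg_right (le_self_pow₀ h32 (by omega)) (by positivity)).trans
            (le_mul_of_one_le_right (by positivity) (one_le_pow₀ (by linarith)))
      _ = S ^ n := by rw [hS, ← pow_mul, mul_comm n 4, pow_mul, ← mul_pow, ← mul_pow]
  have hD1 : (biNorm F).natDegree < D := (natDegree_biNorm_le F hdeg).trans_lt (by omega)
  have hd1 : xDegree (biNorm F) ≤ 4 * (L * n) + 12 := xDegree_biNorm_le F hxdeg
  have hn1 : (1 : ℝ) ≤ n := mod_cast hn
  have key := mulHeight₁_le_or_of_dvd x u D (biNorm F) (4 * (L * n) + 12) w (S ^ n) h0 hD1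
    (xDegree_le_iff.mp hd1) hpoly (by linarith [hSn n hn])
    (by push_cast; nlinarith) (by rw [hD]; push_cast; linarith [hSn n hn]) hw
  have hCn : ((S ^ n) ^ 3 ^ D) ^ Module.finrank ℚ K = ((S ^ 3 ^ D) ^ Module.finrank ℚ K) ^ n := by
    rw [← pow_mul, ← pow_mul, ← pow_mul, ← pow_mul]
    congr 1
    ring
  rw [hCn] at key
  by_contra! hwn
  rcases key with h | h
  · exact absurd hu (not_lt.mpr h)
  · refine absurd h (not_le.mpr ?_)
    refine lt_of_lt_of_le (pow_lt_pow_left₀ hx (by positivity) (by omega))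
      (pow_le_pow_right₀ (one_le_mulHeight₁ x) (by omega))

end VojtaCurve

namespace VojtaCurve

open Polynomial NumberField Height

section SqrtSeries

variable {R : Type*} [CommRing R] (τ : PowerSeries R)

/-- Successive approximations of the solution of `h + h² = τ`. -/
noncomputable def sqrtIter : ℕ → PowerSeries R
  | 0 => 0
  | m + 1 => τ - sqrtIter m ^ 2

variable {τ} in
theorem exists_add_sq_eq (hτ : PowerSeries.X ∣ τ) : ∃ h : PowerSeries R, h + h ^ 2 = τ ∧
    ∀ j m, j ≤ m → PowerSeries.coeff j h = PowerSeries.coeff j (sqrtIter τ m) := by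
  have hX (m : ℕ) : PowerSeries.X ∣ sqrtIter τ m := by
    induction m with
    | zero => exact dvd_zero _
    | succ m ih => exact dvd_sub hτ (dvd_pow ih two_ne_zero)
  have hstep (m : ℕ) : PowerSeries.X ^ (m + 1) ∣ sqrtIter τ (m + 1) - sqrtIter τ m := by
    induction m with
    | zero => simpa using dvd_sub (hX 1) (hX 0)
    | succ m ih =>
      have e : sqrtIter τ (m + 2) - sqrtIter τ (m + 1) =
          -((sqrtIter τ (m + 1) - sqrtIter τ m) * (sqrtIter τ (m + 1) + sqrtIter τ m)) := by
        rw [sqrtIter, sqrtIter]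
        ring
      rw [e, dvd_neg, pow_succ]
      exact mul_dvd_mul ih (dvd_add (hX _) (hX _))
  have hco (j m : ℕ) (h : j ≤ m) :
      PowerSeries.coeff j (sqrtIter τ j) = PowerSeries.coeff j (sqrtIter τ m) := by
    induction m, h using Nat.le_induction with
    | base => rfl
    | succ m hm ih =>
      have := PowerSeries.X_pow_dvd_iff.mp (hstep m) j (by omega)
      rw [map_sub, sub_eq_zero] at this
      rw [ih, this]
  refine ⟨PowerSeries.mk fun j => PowerSeries.coeff j (sqrtIter τ j), ?_, fun j m h => ?_⟩
  · ext j
    have e :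
        PowerSeries.coeff j ((PowerSeries.mk fun j => PowerSeries.coeff j (sqrtIter τ j)) ^ 2) =
        PowerSeries.coeff j (sqrtIter τ j ^ 2) := by
      rw [sq, sq, PowerSeries.coeff_mul, PowerSeries.coeff_mul]
      refine Finset.sum_congr rfl fun p hp => ?_
      have := Finset.HasAntidiagonal.mem_antidiagonal.mp hp
      rw [PowerSeries.coeff_mk, PowerSeries.coeff_mk, hco _ j (by omega), hco p.2 j (by omega)]
    rw [map_add, e, PowerSeries.coeff_mk, hco j (j + 1) (by omega), sqrtIter, map_sub,
      sub_add_cancel]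
  · rw [PowerSeries.coeff_mk, hco j m h]

end SqrtSeries

theorem apply_sum_le_of_isNonarchimedean {ι A : Type*} [AddCommMonoid A] {f : A → ℝ}
    (hf : IsNonarchimedean f) (s : Finset ι) (l : ι → A) {B : ℝ} (h0 : f 0 ≤ B)
    (h : ∀ i ∈ s, f (l i) ≤ B) : f (∑ i ∈ s, l i) ≤ B := by
  rcases s.eq_empty_or_nonempty with rfl | hs
  · simpa using h0
  · exact (hf.apply_sum_le_sup hs).trans (Finset.sup'_le hs _ h)

section GaussSeminorm

variable {K : Type*} [Field K] {v : AbsoluteValue K ℝ} (hv : IsNonarchimedean v) (ρ : NNReal)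
  (w : ℕ)

/-- The seminorm `max_{i ≤ w} v(aᵢ) ρ^i` on power series. -/
noncomputable def gaussSeminorm : RingSeminorm (PowerSeries K) where
  toFun p := (Finset.range (w + 1)).sup' Finset.nonempty_range_add_one fun i =>
    v (PowerSeries.coeff i p) * (ρ : ℝ) ^ i
  map_zero' := by simp
  neg' p := by simp
  add_le' p q := by
    refine Finset.sup'_le _ _ fun i hi => ?_
    have h1 := Finset.le_sup' (fun i => v (PowerSeries.coeff i p) * (ρ : ℝ) ^ i) hi
    have h2 := Finset.le_sup' (fun i => v (PowerSeries.coeff i q) * (ρ : ℝ) ^ i) hi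
    refine le_trans ?_ (add_le_add h1 h2)
    rw [map_add, ← add_mul]
    exact mul_le_mul_of_nonneg_right (v.add_le _ _) (by positivity)
  mul_le' p q := by
    refine Finset.sup'_le _ _ fun i hi => ?_
    have h0 (f : PowerSeries K) : 0 ≤ (Finset.range (w + 1)).sup' Finset.nonempty_range_add_one
        fun i => v (PowerSeries.coeff i f) * (ρ : ℝ) ^ i :=
      (by positivity : 0 ≤ v (PowerSeries.coeff 0 f) * (ρ : ℝ) ^ 0).trans
        (Finset.le_sup' (fun i => v (PowerSeries.coeff i f) * (ρ : ℝ) ^ i)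
          (Finset.mem_range.mpr (Nat.succ_pos w)))
    rcases eq_or_ne ((ρ : ℝ) ^ i) 0 with hz | hz
    · rw [hz, mul_zero]
      exact mul_nonneg (h0 p) (h0 q)
    have hpos : 0 < (ρ : ℝ) ^ i := lt_of_le_of_ne (by positivity) (Ne.symm hz)
    rw [PowerSeries.coeff_mul, ← le_div_iff₀ hpos]
    refine apply_sum_le_of_isNonarchimedean hv _ _ ?_ fun ab hab => ?_
    · rw [map_zero]
      exact div_nonneg (mul_nonneg (h0 p) (h0 q)) hpos.le
    · have hab' := Finset.HasAntidiagonal.mem_antidiagonal.mp hab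
      have hi' := Finset.mem_range.mp hi
      have h1 := Finset.le_sup' (fun i => v (PowerSeries.coeff i p) * (ρ : ℝ) ^ i)
        (Finset.mem_range.mpr (by omega : ab.1 < w + 1))
      have h2 := Finset.le_sup' (fun i => v (PowerSeries.coeff i q) * (ρ : ℝ) ^ i)
        (Finset.mem_range.mpr (by omega : ab.2 < w + 1))
      rw [le_div_iff₀ hpos, map_mul, ← hab', pow_add, mul_mul_mul_comm]
      exact mul_le_mul h1 h2 (by positivity) (h0 p)

theorem coeff_le_gaussSeminorm (p : PowerSeries K) :
    v (PowerSeries.coeff w p) * (ρ : ℝ) ^ w ≤ gaussSeminorm hv ρ w p :=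
  Finset.le_sup' (fun i => v (PowerSeries.coeff i p) * (ρ : ℝ) ^ i)
    (Finset.mem_range.mpr w.lt_succ_self)

theorem gaussSeminorm_le_iff (p : PowerSeries K) {B : ℝ} : gaussSeminorm hv ρ w p ≤ B ↔
    ∀ i ≤ w, v (PowerSeries.coeff i p) * (ρ : ℝ) ^ i ≤ B := by
  refine (Finset.sup'_le_iff Finset.nonempty_range_add_one
    (fun i => v (PowerSeries.coeff i p) * (ρ : ℝ) ^ i) (a := B)).trans ?_
  simp

end GaussSeminorm

end VojtaCurve

namespace VojtaCurve

open Polynomial NumberField Height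

section LocalExpansion

variable {K : Type*} [Field K]

/-- The expansion `x + 4 g t` of the abscissa. -/
noncomputable def xSer (x g : K) : PowerSeries K :=
  PowerSeries.C x + PowerSeries.C (4 * g) * PowerSeries.X

/-- The series `τ` for which `f(x + 4 g t) = f(x)(1 + 4 τ)`, where `f = X³ + αX² + βX`
and `g = f(x)g'`. -/
noncomputable def tauSer (α β x g' g : K) : PowerSeries K :=
  (PowerSeries.C (g' * (3 * x ^ 2 + 2 * α * x + β)) +
    PowerSeries.C (g' * (2 * 2 * (3 * x + α) * g)) * PowerSeries.X +
    PowerSeries.C (g' * (2 * 2 * 2 * 2 * g ^ 2)) * PowerSeries.X ^ 2) * PowerSeries.X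

theorem cubic_xSer {α β x g' g : K} (hg : g = (x ^ 3 + α * x ^ 2 + β * x) * g') :
    xSer x g ^ 3 + PowerSeries.C α * xSer x g ^ 2 + PowerSeries.C β * xSer x g =
      PowerSeries.C (x ^ 3 + α * x ^ 2 + β * x) * (1 + 4 * tauSer α β x g' g) := by
  have h4 : (PowerSeries.C (4 : K)) = 4 := map_ofNat _ 4
  have h2 : (PowerSeries.C (2 : K)) = 2 := map_ofNat _ 2
  have h3 : (PowerSeries.C (3 : K)) = 3 := map_ofNat _ 3
  have hg' := congrArg (PowerSeries.C (R := K)) hg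
  simp only [map_add, map_mul, map_pow] at hg'
  simp only [xSer, tauSer, map_add, map_mul, map_pow, h2, h3, h4]
  generalize (PowerSeries.C g : PowerSeries K) = G at *
  subst hg'
  ring

theorem exists_sqrt_cubic_xSer {α β x u y v g' g : K}
    (hg : g = (x ^ 3 + α * x ^ 2 + β * x) * g') (hy : y ^ 2 = x ^ 3 + α * x ^ 2 + β * x)
    (hv : v ^ 2 = u ^ 3 + α * u ^ 2 + β * u) :
    ∃ h : PowerSeries K,
      (PowerSeries.C (y * v) * (1 + 2 * h)) * (PowerSeries.C (y * v) * (1 + 2 * h)) =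
        (xSer x g ^ 3 + PowerSeries.C α * xSer x g ^ 2 + PowerSeries.C β * xSer x g) *
        PowerSeries.C (u ^ 3 + α * u ^ 2 + β * u) ∧ PowerSeries.constantCoeff h = 0 ∧
      ∀ j m, j ≤ m → PowerSeries.coeff j h = PowerSeries.coeff j
        (sqrtIter (tauSer α β x g' g) m) := by
  obtain ⟨h, h1, h2⟩ := exists_add_sq_eq (τ := tauSer α β x g' g) (Dvd.intro_left _ rfl)
  refine ⟨h, ?_, ?_, h2⟩
  · rw [cubic_xSer hg, ← hy, ← hv, ← h1, map_mul, map_pow, map_pow]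
    ring
  · have := h2 0 0 le_rfl
    rwa [PowerSeries.coeff_zero_eq_constantCoeff_apply, sqrtIter, map_zero] at this

variable {c : ℝ}

theorem add_le_mul_of_le {A : Type*} [Add A] {f : A → ℝ} (hc : 0 ≤ c)
    (hf : ∀ a b, f (a + b) ≤ c * max (f a) (f b)) {a b : A} {B : ℝ} (ha : f a ≤ B) (hb : f b ≤ B) :
    f (a + b) ≤ c * B :=
  (hf a b).trans (mul_le_mul_of_nonneg_left (max_le ha hb) hc)

variable {v : AbsoluteValue K ℝ} (hc : 1 ≤ c) (hv : ∀ a b, v (a + b) ≤ c * max (v a) (v b))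
  (hv2 : v 2 ≤ c) (hv3 : v 3 ≤ c) {α β x : K} {H : ℝ} (hα : v α ≤ c) (hβ : v β ≤ c) (hH : 1 ≤ H)
  (hx : v x ≤ H)

include hc hv hα hβ hH hx in
theorem cubic_abs_le : v (x ^ 3 + α * x ^ 2 + β * x) ≤ c ^ 3 * H ^ 3 := by
  have hc0 : 0 ≤ c := by linarith
  have h1 : v (x ^ 3) ≤ c * H ^ 3 := by
    rw [map_pow]
    calc v x ^ 3 ≤ 1 * H ^ 3 := by rw [one_mul]; gcongr
      _ ≤ _ := by gcongr
  have h2 : v (α * x ^ 2) ≤ c * H ^ 3 := by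
    rw [map_mul, map_pow]
    calc v α * v x ^ 2 ≤ c * H ^ 2 := by gcongr
      _ ≤ c * H ^ 3 := by gcongr; simp
  have h3 : v (β * x) ≤ c * (c * H ^ 3) := by
    rw [map_mul]
    calc v β * v x ≤ c * H ^ 1 := by rw [pow_one]; gcongr
      _ ≤ c * H ^ 3 := by gcongr; simp
      _ ≤ c * (c * H ^ 3) := by gcongr; exact le_mul_of_one_le_left (by positivity) hc
  refine (add_le_mul_of_le hc0 hv (add_le_mul_of_le hc0 hv h1 h2) h3).trans (le_of_eq ?_)
  ring

include hc hv hα hβ hH hx in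
theorem sqrt_cubic_abs_le {y : K} (hy : y ^ 2 = x ^ 3 + α * x ^ 2 + β * x) :
    v y ≤ c ^ 2 * H ^ 2 := by
  refine le_of_sq_le_sq ?_ (by positivity)
  rw [← map_pow, hy]
  calc _ ≤ c ^ 3 * H ^ 3 := cubic_abs_le hc hv hα hβ hH hx
    _ ≤ c ^ 4 * H ^ 4 := by gcongr <;> simp
    _ = _ := by ring

include hc hv hv2 hv3 hα hβ hH hx in
theorem deriv_cubic_abs_le : v (3 * x ^ 2 + 2 * α * x + β) ≤ c ^ 4 * H ^ 2 := by
  have hc0 : 0 ≤ c := by linarith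
  have h1 : v (3 * x ^ 2) ≤ c * c * H ^ 2 := by
    rw [map_mul, map_pow]
    calc v 3 * v x ^ 2 ≤ 1 * c * H ^ 2 := by rw [one_mul]; gcongr
      _ ≤ _ := by gcongr
  have h2 : v (2 * α * x) ≤ c * c * H ^ 2 := by
    rw [map_mul, map_mul]
    calc v 2 * v α * v x ≤ c * c * H ^ 1 := by rw [pow_one]; gcongr
      _ ≤ c * c * H ^ 2 := by gcongr; simp
  have h3 : v β ≤ c * (c * c * H ^ 2) := by
    calc v β ≤ c * (1 * 1 * 1 ^ 2) := by simpa using hβ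
      _ ≤ _ := by gcongr
  refine (add_le_mul_of_le hc0 hv (add_le_mul_of_le hc0 hv h1 h2) h3).trans (le_of_eq ?_)
  ring

include hc hv hv3 hα hH hx in
theorem deriv₂_cubic_abs_le : v (3 * x + α) ≤ c ^ 2 * H := by
  have hc0 : 0 ≤ c := by linarith
  have h1 : v (3 * x) ≤ c * H := by
    rw [map_mul]
    gcongr
  refine (add_le_mul_of_le hc0 hv h1 (hα.trans (le_mul_of_one_le_right hc0 hH))).trans
    (le_of_eq ?_)
  ring

variable {μ : RingSeminorm (PowerSeries K)} {ρ : ℝ}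
  (hμ : ∀ a b, μ (a + b) ≤ c * max (μ a) (μ b)) (hμC : ∀ a, μ (PowerSeries.C a) ≤ v a)
  (hμX : μ PowerSeries.X ≤ ρ) (hρ : ρ = 1 / (c ^ 21 * H ^ 6))

include hc hv hv2 hv3 hα hβ hH hx hμ hμC hμX hρ in
theorem tauSer_seminorm_le {g' g : K} (hg' : v g' ≤ c ^ 3 * H ^ 3) (hg : v g ≤ c ^ 6 * H ^ 6) :
    μ (tauSer α β x g' g) ≤ 1 / c ^ 2 := by
  have hc0 : 0 < c := by linarith
  have hH0 : 0 < H := by linarith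
  have hρ0 : 0 ≤ ρ := (apply_nonneg μ _).trans hμX
  have e1 := deriv_cubic_abs_le hc hv hv2 hv3 hα hβ hH hx
  have e2 := deriv₂_cubic_abs_le hc hv hv3 hα hH hx
  set B : ℝ := c ^ 17 * H ^ 5 with hB
  have hH6 : H ^ 6 * ρ = 1 / c ^ 21 := by
    rw [hρ]
    field_simp
  have hle1 : H ^ 6 * ρ ≤ 1 := by
    rw [hH6]
    exact (div_le_one (by positivity)).mpr (one_le_pow₀ hc)
  have h1 : μ (PowerSeries.C (g' * (3 * x ^ 2 + 2 * α * x + β))) ≤ B := by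
    refine (hμC _).trans ?_
    rw [map_mul]
    calc _ ≤ (c ^ 3 * H ^ 3) * (c ^ 4 * H ^ 2) := by gcongr
      _ = c ^ 7 * H ^ 5 := by ring
      _ ≤ c ^ 17 * H ^ 5 := by gcongr; simp
  have h2 : μ (PowerSeries.C (g' * (2 * 2 * (3 * x + α) * g)) * PowerSeries.X) ≤ B := by
    refine (RingSeminorm.mul_le_of_le μ (hμC _) hμX).trans ?_
    simp only [map_mul]
    calc _ ≤ (c ^ 3 * H ^ 3) * (c * c * (c ^ 2 * H) * (c ^ 6 * H ^ 6)) * ρ := by gcongr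
      _ = c ^ 13 * H ^ 4 * (H ^ 6 * ρ) := by ring
      _ ≤ c ^ 17 * H ^ 5 * 1 := by gcongr <;> simp
      _ = _ := mul_one _
  have h3 : μ (PowerSeries.C (g' * (2 * 2 * 2 * 2 * g ^ 2)) * PowerSeries.X ^ 2) ≤ c * B := by
    rw [sq PowerSeries.X]
    refine (RingSeminorm.mul_le_of_le μ (hμC _) (RingSeminorm.mul_le_of_le μ hμX hμX)).trans ?_
    simp only [map_mul, map_pow]
    calc _ ≤ (c ^ 3 * H ^ 3) * (c * c * c * c * (c ^ 6 * H ^ 6) ^ 2) * (ρ * ρ) := by gcongr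
      _ = c ^ 19 * H ^ 3 * ((H ^ 6 * ρ) * (H ^ 6 * ρ)) := by ring
      _ = c ^ 19 * H ^ 3 * ((1 / c ^ 21) * (H ^ 6 * ρ)) := by rw [hH6]
      _ = H ^ 3 * (1 / c ^ 2) * (H ^ 6 * ρ) := by field_simp
      _ ≤ H ^ 5 * c ^ 18 * 1 := by
        gcongr
        · simp
        · exact ((div_le_one (by positivity)).mpr (one_le_pow₀ hc)).trans (one_le_pow₀ hc)
      _ = c * B := by rw [hB]; ring
  refine (RingSeminorm.mul_le_of_le μ (add_le_mul_of_le hc0.le hμ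
    (add_le_mul_of_le hc0.le hμ h1 h2) h3) hμX).trans ?_
  calc c * (c * B) * ρ = c ^ 19 * H ^ 5 * ρ := by rw [hB]; ring
    _ ≤ c ^ 19 * H ^ 6 * ρ := by gcongr; simp
    _ = c ^ 19 * (H ^ 6 * ρ) := by ring
    _ = 1 / c ^ 2 := by rw [hH6]; field_simp

include hc hμ in
theorem sqrtIter_seminorm_le {τ : PowerSeries K} (hτ : μ τ ≤ 1 / c ^ 2) (m : ℕ) :
    μ (sqrtIter τ m) ≤ 1 / c := by
  have hc0 : 0 < c := by linarith
  induction m with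
  | zero => simpa [sqrtIter] using hc0.le
  | succ m ih =>
    have h2 : μ (-(sqrtIter τ m) ^ 2) ≤ 1 / c ^ 2 := by
      rw [map_neg_eq_map, sq]
      refine (RingSeminorm.mul_le_of_le μ ih ih).trans (le_of_eq ?_)
      field_simp
    rw [sqrtIter, sub_eq_add_neg]
    refine (add_le_mul_of_le hc0.le hμ hτ h2).trans (le_of_eq ?_)
    field_simp

include hc hH hx hμ hμC hμX hρ hv2 in
theorem xSer_seminorm_le {g : K} (hg : v g ≤ c ^ 6 * H ^ 6) : μ (xSer x g) ≤ c * H := by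
  have hc0 : 0 < c := by linarith
  have hH0 : 0 < H := by linarith
  refine add_le_mul_of_le hc0.le hμ ((hμC _).trans hx) ?_
  refine (RingSeminorm.mul_le_of_le μ (hμC _) hμX).trans ?_
  rw [show (4 : K) = 2 * 2 by norm_num, map_mul, map_mul, hρ]
  calc _ ≤ c * c * (c ^ 6 * H ^ 6) * (1 / (c ^ 21 * H ^ 6)) := by gcongr
    _ = 1 / c ^ 13 := by field_simp
    _ ≤ 1 := (div_le_one (by positivity)).mpr (one_le_pow₀ hc)
    _ ≤ H := hH

include hc hv hv2 hv3 hα hβ hH hx hμ hμC hμX hρ in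
theorem eta_seminorm_le {u y z g' g : K} {H' : ℝ} (hH' : 1 ≤ H') (hu : v u ≤ H')
    (hg' : v g' ≤ c ^ 3 * H ^ 3) (hg : v g ≤ c ^ 6 * H ^ 6)
    (hy : y ^ 2 = x ^ 3 + α * x ^ 2 + β * x) (hz : z ^ 2 = u ^ 3 + α * u ^ 2 + β * u)
    {w : ℕ} (hw : ∀ p q, (∀ j ≤ w, PowerSeries.coeff j p = PowerSeries.coeff j q) → μ p ≤ μ q)
    {h : PowerSeries K} (hh : ∀ j m, j ≤ m →
      PowerSeries.coeff j h = PowerSeries.coeff j (sqrtIter (tauSer α β x g' g) m)) :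
    μ (PowerSeries.C (y * z) * (1 + 2 * h)) ≤ c ^ 5 * H ^ 2 * H' ^ 2 := by
  have hc0 : 0 < c := by linarith
  have h0 : μ h ≤ 1 / c := (hw h _ fun j hj => hh j w hj).trans
    (sqrtIter_seminorm_le hc hμ (tauSer_seminorm_le hc hv hv2 hv3 hα hβ hH hx hμ hμC hμX hρ hg' hg)
      w)
  have h1 : μ (2 * h) ≤ 1 := by
    have h2 : μ (2 : PowerSeries K) ≤ c := by
      have := (hμC 2).trans hv2
      rwa [map_ofNat] at this
    refine (RingSeminorm.mul_le_of_le μ h2 h0).trans (le_of_eq ?_)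
    field_simp
  have h2 : μ (1 : PowerSeries K) ≤ 1 := by
    have := hμC 1
    rwa [map_one PowerSeries.C, map_one v] at this
  have h3 := add_le_mul_of_le hc0.le hμ h2 h1
  refine (RingSeminorm.mul_le_of_le μ (hμC _) h3).trans ?_
  have hy' := sqrt_cubic_abs_le hc hv hα hβ hH hx hy
  have hz' := sqrt_cubic_abs_le hc hv hα hβ hH' hu hz
  rw [map_mul]
  calc _ ≤ (c ^ 2 * H ^ 2) * (c ^ 2 * H' ^ 2) * (c * 1) := by gcongr
    _ = _ := by ring

end LocalExpansion

end VojtaCurve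

namespace VojtaCurve

open Polynomial NumberField Height

section SerHom

variable {R K : Type*} [CommRing R] [Field K] (f : R →+* K)

/-- The homomorphism sending the inner variable to `x + 4 g t` and the outer variable to `u`. -/
noncomputable def serHom (x u g : K) : R[X][X] →+* PowerSeries K :=
  eval₂RingHom (eval₂RingHom (PowerSeries.C.comp f) (xSer x g)) (PowerSeries.C u)

variable (x u g : K)

theorem serHom_C (p : R[X]) :
    serHom f x u g (C p) = p.eval₂ (PowerSeries.C.comp f) (xSer x g) := by
  simp [serHom]

theorem serHom_cubicProd (α β : R) : serHom f x u g (cubicProd α β) =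
    (xSer x g ^ 3 + PowerSeries.C (f α) * xSer x g ^ 2 + PowerSeries.C (f β) * xSer x g) *
      PowerSeries.C (u ^ 3 + f α * u ^ 2 + f β * u) := by
  rw [cubicProd, map_mul, serHom_C, serHom, coe_eval₂RingHom, eval₂_map]
  simp [cubic]

theorem eval₂_eq_sum_of_support_subset {R S : Type*} [CommRing R] [CommRing S] (f : R →+* S) (x : S)
    {p : R[X]} {s : Finset ℕ} (hs : p.support ⊆ s) : p.eval₂ f x = ∑ n ∈ s, f (p.coeff n) * x ^ n :=
  eval₂_eq_sum.trans (sum_eq_of_subset (fun n a => f a * x ^ n) (by simp) hs)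

theorem serHom_eq_sum {I J : ℕ} {p : R[X][X]}
    (hp : ∀ i j, (p.coeff j).coeff i ≠ 0 → i < I ∧ j < J) :
    serHom f x u g p = ∑ i ∈ Finset.range I, ∑ j ∈ Finset.range J,
      PowerSeries.C (f ((p.coeff j).coeff i)) * (xSer x g ^ i * PowerSeries.C u ^ j) := by
  have h1 (j : ℕ) : (p.coeff j).eval₂ (PowerSeries.C.comp f) (xSer x g) =
      ∑ i ∈ Finset.range I, PowerSeries.C (f ((p.coeff j).coeff i)) * xSer x g ^ i :=
    eval₂_eq_sum_of_support_subset _ _ fun i hi =>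
      Finset.mem_range.mpr (hp i j (mem_support_iff.mp hi)).1
  have h2 : p.support ⊆ Finset.range J := fun j hj => by
    obtain ⟨i, hi⟩ : ∃ i, (p.coeff j).coeff i ≠ 0 := by
      by_contra! h
      exact mem_support_iff.mp hj (ext fun i => (h i).trans (coeff_zero i).symm)
    exact Finset.mem_range.mpr (hp i j hi).2
  rw [serHom, coe_eval₂RingHom, eval₂_eq_sum_of_support_subset _ _ h2, Finset.sum_comm]
  refine Finset.sum_congr rfl fun j _ => ?_
  rw [coe_eval₂RingHom, h1, Finset.sum_mul]
  exact Finset.sum_congr rfl fun i _ => mul_assoc _ _ _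

theorem serHom_eq_eval₂ (p : R[X][X]) : serHom f x u g p =
    (p.eval₂ (mapRingHom f) (C u)).eval₂ PowerSeries.C (xSer x g) := by
  have : serHom f x u g = (eval₂RingHom PowerSeries.C (xSer x g)).comp
      (eval₂RingHom (mapRingHom f) (C u)) := by
    refine ringHom_ext' (ringHom_ext' ?_ ?_) ?_
    · ext r
      simp [serHom]
    · simp [serHom]
    · simp [serHom]
  exact congrArg (fun φ : R[X][X] →+* PowerSeries K => φ p) this

theorem constantCoeff_xSer : PowerSeries.constantCoeff (xSer x g) = x := by
  simp [xSer]

variable {x g} in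
theorem X_sub_C_pow_dvd_of_X_pow_dvd (hg : 4 * g ≠ 0) {p : K[X]} {w : ℕ}
    (h : PowerSeries.X ^ w ∣ p.eval₂ PowerSeries.C (xSer x g)) : (X - C x) ^ w ∣ p := by
  have e : p.eval₂ PowerSeries.C (xSer x g) =
      ((p.comp (C x + C (4 * g) * X) : K[X]) : PowerSeries K) := by
    rw [← Polynomial.coeToPowerSeries.ringHom_apply, comp, hom_eval₂]
    congr 1
    · ext a
      simp
    · simp [xSer]
  rw [e, PowerSeries.X_pow_dvd_iff] at h
  have h' : X ^ w ∣ p.comp (C x + C (4 * g) * X) :=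
    X_pow_dvd_iff.mpr fun d hd => by simpa using h d hd
  obtain ⟨q, hq⟩ := h'
  have h2 := congrArg (fun r => r.comp (C (4 * g)⁻¹ * (X - C x))) hq
  simp only [comp_assoc, add_comp, C_comp, mul_comp, X_comp, X_pow_comp] at h2
  rw [← mul_assoc, ← C_mul, mul_inv_cancel₀ hg, C_1, one_mul, add_sub_cancel, comp_X, mul_pow] at h2
  exact ⟨C (4 * g)⁻¹ ^ w * q.comp (C (4 * g)⁻¹ * (X - C x)), by rw [h2]; ring⟩

end SerHom

section BiEval

variable {R K : Type*} [CommRing R] [Field K] (f : R →+* K) {g₁ g₂ : R[X][X]} (x u g : K)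
  {e₁ e₂ : PowerSeries K} (h₁ : e₁ * e₁ = serHom f x u g g₁) (h₂ : e₂ * e₂ = serHom f x u g g₂)

/-- The indices of the coefficients of an element of `R[x, u][η₁, η₂]` of degree less than `I`
in `x` and less than `J` in `u`. -/
def biIdx (I J : ℕ) : Finset (Bool × Bool × ℕ × ℕ) :=
  Finset.univ ×ˢ Finset.univ ×ˢ Finset.range I ×ˢ Finset.range J

theorem card_biIdx (I J : ℕ) : (biIdx I J).card = 4 * I * J := by
  simp [biIdx]
  ring

theorem biHom_serHom_eq_sum {I J : ℕ} {F : Biquad g₁ g₂}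
    (hF : ∀ y z i j, biCoeff y z i j F ≠ 0 → i < I ∧ j < J) :
    biHom (serHom f x u g) e₁ e₂ h₁ h₂ F = ∑ a ∈ biIdx I J,
      PowerSeries.C (f (biCoeff a.1 a.2.1 a.2.2.1 a.2.2.2 F)) *
        (xSer x g ^ a.2.2.1 * PowerSeries.C u ^ a.2.2.2 * (e₁ ^ a.1.toNat * e₂ ^ a.2.1.toNat)) := by
  have h (y z : Bool) : serHom f x u g (biComp y z F) = ∑ a ∈ Finset.range I ×ˢ Finset.range J,
      PowerSeries.C (f (biCoeff y z a.1 a.2 F)) * (xSer x g ^ a.1 * PowerSeries.C u ^ a.2) := by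
    rw [Finset.sum_product]
    exact serHom_eq_sum f x u g (p := biComp y z F) (hF y z)
  have h' (y z : Bool) : ∑ a ∈ Finset.range I ×ˢ Finset.range J,
      PowerSeries.C (f (biCoeff y z a.1 a.2 F)) *
        (xSer x g ^ a.1 * PowerSeries.C u ^ a.2 * (e₁ ^ y.toNat * e₂ ^ z.toNat)) =
      serHom f x u g (biComp y z F) * (e₁ ^ y.toNat * e₂ ^ z.toNat) := by
    rw [h, Finset.sum_mul]
    exact Finset.sum_congr rfl fun a _ => by ring
  rw [biIdx, Finset.sum_product, Fintype.sum_bool, Finset.sum_product, Finset.sum_product,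
    Fintype.sum_bool, Fintype.sum_bool]
  simp only [h']
  rw [biHom_apply]
  simp only [biComp, cond_true, cond_false, Bool.toNat_true, Bool.toNat_false]
  ring

end BiEval

end VojtaCurve

namespace VojtaCurve

open Polynomial NumberField Height

section LocalBounds

variable {K : Type*} [Field K]

/-- The existence of seminorms on power series which control the coefficients. -/
def HasSeriesNorms (v : AbsoluteValue K ℝ) (c : ℝ) (S : ℕ → ℝ) : Prop :=
  ∀ (ρ : NNReal) (w : ℕ), ∃ μ : RingSeminorm (PowerSeries K),
    (∀ a b, μ (a + b) ≤ c * max (μ a) (μ b)) ∧ (∀ a, μ (PowerSeries.C a) ≤ v a) ∧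
    μ PowerSeries.X ≤ ρ ∧
    (∀ p q, (∀ j ≤ w, PowerSeries.coeff j p = PowerSeries.coeff j q) → μ p ≤ μ q) ∧
    (∀ p, v (PowerSeries.coeff w p) * (ρ : ℝ) ^ w ≤ μ p) ∧
    ∀ (s : Finset (Bool × Bool × ℕ × ℕ)) (l : _ → PowerSeries K) (B : ℝ), 0 ≤ B →
      (∀ i ∈ s, μ (l i) ≤ B) → μ (∑ i ∈ s, l i) ≤ S s.card * B

theorem hasSeriesNorms_of_isNonarchimedean {v : AbsoluteValue K ℝ} (hv : IsNonarchimedean v) :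
    HasSeriesNorms v 1 fun _ => 1 := by
  intro ρ w
  have hadd : IsNonarchimedean (gaussSeminorm hv ρ w) := fun a b => by
    rw [gaussSeminorm_le_iff]
    intro i hi
    have ha := (gaussSeminorm_le_iff hv ρ w a).mp le_rfl i hi
    have hb := (gaussSeminorm_le_iff hv ρ w b).mp le_rfl i hi
    rw [map_add]
    calc _ ≤ max (v (PowerSeries.coeff i a)) (v (PowerSeries.coeff i b)) * (ρ : ℝ) ^ i := by
          gcongr
          exact hv _ _
      _ ≤ _ := by
          rw [max_mul_of_nonneg _ _ (by positivity)]
          exact max_le_max ha hb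
  refine ⟨gaussSeminorm hv ρ w, fun a b => by simpa using hadd a b, fun a => ?_, ?_, fun p q h =>
    ?_,
    coeff_le_gaussSeminorm hv ρ w, fun s l B hB h => ?_⟩
  · rw [gaussSeminorm_le_iff]
    rintro (_ | i) -
    · simp
    · simp
  · rw [gaussSeminorm_le_iff]
    intro i _
    rw [PowerSeries.coeff_X]
    split_ifs with h
    · simp [h]
    · simp
  · rw [gaussSeminorm_le_iff]
    intro i hi
    rw [h i hi]
    exact (gaussSeminorm_le_iff hv ρ w q).mp le_rfl i hi
  · rw [one_mul]
    exact apply_sum_le_of_isNonarchimedean hadd s l (by rwa [map_zero]) h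

theorem hasSeriesNorms (v : AbsoluteValue K ℝ) {c : ℝ} (hc : 2 ≤ c) :
    HasSeriesNorms v c fun n => n := by
  let ν : RingSeminorm K :=
    { toFun := v
      map_zero' := map_zero v
      add_le' := v.add_le
      mul_le' := fun a b => (map_mul v a b).le
      neg' := fun a => v.map_neg a }
  intro ρ w
  refine ⟨truncSeminorm ν ρ w, fun a b => ?_, fun a => ?_, ?_, fun p q h => ?_,
    coeff_le_truncSeminorm ν ρ w, fun s l B hB h => ?_⟩
  · have h0 := apply_nonneg (truncSeminorm ν ρ w) a
    have h1 := le_max_left (truncSeminorm ν ρ w a) (truncSeminorm ν ρ w b)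
    have h2 := le_max_right (truncSeminorm ν ρ w a) (truncSeminorm ν ρ w b)
    have h3 := map_add_le_add (truncSeminorm ν ρ w) a b
    nlinarith
  · rw [truncSeminorm_def, Finset.sum_eq_single 0]
    · simp [ν]
      rfl
    · intro i _ hi
      simp [PowerSeries.coeff_C, hi]
    · simp
  · rw [truncSeminorm_def]
    calc _ ≤ ∑ i ∈ Finset.range (w + 1), if i = 1 then (ρ : ℝ) else 0 := by
          refine Finset.sum_le_sum fun i _ => ?_
          rw [PowerSeries.coeff_X]
          split_ifs with h
          · subst h
            have : ν 1 = 1 := map_one v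
            rw [this]
            simp
          · simp
      _ ≤ ρ := by
          rw [Finset.sum_ite_eq']
          split_ifs
          · rfl
          · exact ρ.2
  · rw [truncSeminorm_def, truncSeminorm_def]
    refine Finset.sum_le_sum fun i hi => ?_
    rw [h i (Nat.lt_succ_iff.mp (Finset.mem_range.mp hi))]
  · refine (RingSeminorm.sum_le _ _ _).trans ?_
    rw [← nsmul_eq_mul]
    exact Finset.sum_le_card_nsmul _ _ _ h

variable {R : Type*} [CommRing R] (f : R →+* K) {v : AbsoluteValue K ℝ} {c : ℝ} {S : ℕ → ℝ}
  (hv : HasSeriesNorms v c S) (hc : 1 ≤ c) (hadd : ∀ a b, v (a + b) ≤ c * max (v a) (v b))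
  (hv2 : v 2 ≤ c) (hv3 : v 3 ≤ c) {α₁ β₁ α₂ β₂ : R} {x u y₁ y₂ z₁ z₂ g : K}
  (hα₁ : v (f α₁) ≤ c) (hβ₁ : v (f β₁) ≤ c) (hα₂ : v (f α₂) ≤ c) (hβ₂ : v (f β₂) ≤ c)
  (hg : g = (x ^ 3 + f α₁ * x ^ 2 + f β₁ * x) * (x ^ 3 + f α₂ * x ^ 2 + f β₂ * x))
  (hy₁ : y₁ ^ 2 = x ^ 3 + f α₁ * x ^ 2 + f β₁ * x) (hy₂ : y₂ ^ 2 = x ^ 3 + f α₂ * x ^ 2 + f β₂ * x)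
  (hz₁ : z₁ ^ 2 = u ^ 3 + f α₁ * u ^ 2 + f β₁ * u) (hz₂ : z₂ ^ 2 = u ^ 3 + f α₂ * u ^ 2 + f β₂ * u)
  {h₁ h₂ : PowerSeries K}
  (hh₁ : ∀ j m, j ≤ m → PowerSeries.coeff j h₁ = PowerSeries.coeff j
      (sqrtIter (tauSer (f α₁) (f β₁) x
    (x ^ 3 + f α₂ * x ^ 2 + f β₂ * x) g) m))
  (hh₂ : ∀ j m, j ≤ m → PowerSeries.coeff j h₂ = PowerSeries.coeff j
      (sqrtIter (tauSer (f α₂) (f β₂) x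
    (x ^ 3 + f α₁ * x ^ 2 + f β₁ * x) g) m))

include hv hc hadd hv2 hv3 hα₁ hβ₁ hα₂ hβ₂ hg hy₁ hy₂ hz₁ hz₂ hh₁ hh₂ in
theorem coeff_biHom_le {g₁ g₂ : R[X][X]} (he₁ : (PowerSeries.C (y₁ * z₁) * (1 + 2 * h₁)) *
      (PowerSeries.C (y₁ * z₁) * (1 + 2 * h₁)) = serHom f x u g g₁)
    (he₂ : (PowerSeries.C (y₂ * z₂) * (1 + 2 * h₂)) * (PowerSeries.C (y₂ * z₂) * (1 + 2 * h₂)) =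
      serHom f x u g g₂) {I J : ℕ} {F : Biquad g₁ g₂}
    (hF : ∀ y z i j, biCoeff y z i j F ≠ 0 → i < I ∧ j < J) {A : ℝ}
    (hA : ∀ y z i j, v (f (biCoeff y z i j F)) ≤ A) (w : ℕ) :
    v (PowerSeries.coeff w (biHom (serHom f x u g) _ _ he₁ he₂ F)) ≤
      S (4 * I * J) * A * c ^ (I + 10 + 21 * w) *
        (max (v x) 1 ^ (I + 4 + 6 * w) * max (v u) 1 ^ (J + 4)) := by
  have hc0 : 0 < c := by linarith
  set H := max (v x) 1 with hHd
  set H' := max (v u) 1 with hHd'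
  have hH : 1 ≤ H := le_max_right _ _
  have hH' : 1 ≤ H' := le_max_right _ _
  have hx : v x ≤ H := le_max_left _ _
  have hu : v u ≤ H' := le_max_left _ _
  have hA0 : 0 ≤ A := (v.nonneg _).trans (hA true true 0 0)
  have hρ0 : 0 ≤ 1 / (c ^ 21 * H ^ 6) := by positivity
  obtain ⟨ρ, hρ⟩ : ∃ ρ : NNReal, (ρ : ℝ) = 1 / (c ^ 21 * H ^ 6) := ⟨⟨_, hρ0⟩, rfl⟩
  obtain ⟨μ, hμ, hμC, hμX, hw, hco, hsum⟩ := hv ρ w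
  have h1 : μ 1 ≤ 1 := by
    have := hμC 1
    rwa [map_one PowerSeries.C, map_one v] at this
  have f1 := cubic_abs_le hc hadd hα₁ hβ₁ hH hx
  have f2 := cubic_abs_le hc hadd hα₂ hβ₂ hH hx
  have hgb : v g ≤ c ^ 6 * H ^ 6 := by
    rw [hg, map_mul]
    calc _ ≤ (c ^ 3 * H ^ 3) * (c ^ 3 * H ^ 3) := by gcongr
      _ = _ := by ring
  have E1 := eta_seminorm_le hc hadd hv2 hv3 hα₁ hβ₁ hH hx hμ hμC hμX hρ hH' hu f2 hgb hy₁ hz₁ hw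
    hh₁
  have E2 := eta_seminorm_le hc hadd hv2 hv3 hα₂ hβ₂ hH hx hμ hμC hμX hρ hH' hu f1 hgb hy₂ hz₂ hw
    hh₂
  have EX := xSer_seminorm_le hc hv2 hH hx hμ hμC hμX hρ hgb
  have hE : 1 ≤ c ^ 5 * H ^ 2 * H' ^ 2 :=
    one_le_mul_of_one_le_of_one_le (one_le_mul_of_one_le_of_one_le (one_le_pow₀ hc)
      (one_le_pow₀ hH))
      (one_le_pow₀ hH')
  have hpow {e : PowerSeries K} (he : μ e ≤ c ^ 5 * H ^ 2 * H' ^ 2) (b : Bool) :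
      μ (e ^ b.toNat) ≤ c ^ 5 * H ^ 2 * H' ^ 2 := by
    cases b
    · simpa using h1.trans hE
    · simpa using he
  rw [biHom_serHom_eq_sum f x u g he₁ he₂ hF]
  have key := hsum (biIdx I J) (fun a => PowerSeries.C (f (biCoeff a.1 a.2.1 a.2.2.1 a.2.2.2 F)) *
        (xSer x g ^ a.2.2.1 * PowerSeries.C u ^ a.2.2.2 *
          ((PowerSeries.C (y₁ * z₁) * (1 + 2 * h₁)) ^ a.1.toNat *
          (PowerSeries.C (y₂ * z₂) * (1 + 2 * h₂)) ^ a.2.1.toNat)))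
    (A * (c ^ (I + 10) * H ^ (I + 4) * H' ^ (J + 4))) (by positivity) fun a ha => by
      simp only [biIdx, Finset.mem_product, Finset.mem_range, Finset.mem_univ, true_and] at ha
      refine (RingSeminorm.mul_le_of_le μ ((hμC _).trans (hA _ _ _ _)) (RingSeminorm.mul_le_of_le μ
        (RingSeminorm.mul_le_of_le μ (RingSeminorm.pow_le_of_le μ h1 EX _)
          (RingSeminorm.pow_le_of_le μ h1 ((hμC _).trans hu) _))
        (RingSeminorm.mul_le_of_le μ (hpow E1 _) (hpow E2 _)))).trans ?_
      calc _ ≤ A * ((c * H) ^ I * H' ^ J * (c ^ 5 * H ^ 2 * H' ^ 2 * (c ^ 5 * H ^ 2 * H' ^ 2))) := by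
            gcongr
            · exact one_le_mul_of_one_le_of_one_le hc hH
            · exact ha.1.le
            · exact ha.2.le
        _ = _ := by ring
  have h2 := (hco _).trans key
  rw [hρ, card_biIdx, one_div, inv_pow, ← div_eq_mul_inv,
    div_le_iff₀ (by positivity)] at h2
  refine h2.trans (le_of_eq ?_)
  ring

end LocalBounds

end VojtaCurve

namespace VojtaCurve

open Polynomial NumberField Height

section Ratio

theorem mul_pow_eq_of_mul_eq {B : Type*} [CommRing B] {a b a' b' : B} (h : a * b' = a' * b)
    {i N : ℕ} (hi : i ≤ N) :
    a' ^ i * b' ^ (N - i) * b ^ N = a ^ i * b ^ (N - i) * b' ^ N ∧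
      a' ^ i * b' ^ (N - i) * a ^ N = a ^ i * b ^ (N - i) * a' ^ N := by
  obtain ⟨m, rfl⟩ := Nat.exists_eq_add_of_le hi
  rw [Nat.add_sub_cancel_left]
  constructor
  · calc _ = (a' * b) ^ i * (b ^ m * b' ^ m) := by ring
      _ = _ := by rw [← h]; ring
  · calc _ = (a * b') ^ m * (a ^ i * a' ^ i) := by ring
      _ = _ := by rw [h]; ring

section AuxForm

variable {R B : Type*} [CommRing R] [CommRing B] (φ : R[X][X] →+* B) (α₁ β₁ α₂ β₂ : R) (k N : ℕ)
  {e₁ e₂ : B} (c : ℕ × ℕ × ℕ → R)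

theorem auxForm_true_left (he₁ : e₁ * e₁ = φ (cubicProd α₁ β₁)) (t : Bool) :
    auxForm φ α₁ β₁ α₂ β₂ k N e₁ e₂ c true t * auxDen φ α₁ β₁ k e₁ false ^ N =
      auxForm φ α₁ β₁ α₂ β₂ k N e₁ e₂ c false t * auxDen φ α₁ β₁ k e₁ true ^ N ∧
    auxForm φ α₁ β₁ α₂ β₂ k N e₁ e₂ c true t * auxNum φ α₁ β₁ k e₁ false ^ N =
      auxForm φ α₁ β₁ α₂ β₂ k N e₁ e₂ c false t * auxNum φ α₁ β₁ k e₁ true ^ N := by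
  have h := auxNum_mul_auxDen φ α₁ β₁ k he₁
  simp only [auxForm, Finset.sum_mul, auxTerm, auxMon]
  constructor <;>
  refine Finset.sum_congr rfl fun a ha => ?_ <;>
  obtain ⟨i1, i2⟩ := mul_pow_eq_of_mul_eq h (mem_auxBox.mp ha).2.1
  · linear_combination (φ (C (C (c a))) * φ (C X) ^ a.1 * (auxNum φ α₂ β₂ k e₂ t ^ a.2.2 *
      auxDen φ α₂ β₂ k e₂ t ^ (N - a.2.2))) * i1
  · linear_combination (φ (C (C (c a))) * φ (C X) ^ a.1 * (auxNum φ α₂ β₂ k e₂ t ^ a.2.2 *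
      auxDen φ α₂ β₂ k e₂ t ^ (N - a.2.2))) * i2

theorem auxForm_true_right (he₂ : e₂ * e₂ = φ (cubicProd α₂ β₂)) (s : Bool) :
    auxForm φ α₁ β₁ α₂ β₂ k N e₁ e₂ c s true * auxDen φ α₂ β₂ k e₂ false ^ N =
      auxForm φ α₁ β₁ α₂ β₂ k N e₁ e₂ c s false * auxDen φ α₂ β₂ k e₂ true ^ N ∧
    auxForm φ α₁ β₁ α₂ β₂ k N e₁ e₂ c s true * auxNum φ α₂ β₂ k e₂ false ^ N =
      auxForm φ α₁ β₁ α₂ β₂ k N e₁ e₂ c s false * auxNum φ α₂ β₂ k e₂ true ^ N := by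
  have h := auxNum_mul_auxDen φ α₂ β₂ k he₂
  simp only [auxForm, Finset.sum_mul, auxTerm, auxMon]
  constructor <;>
  refine Finset.sum_congr rfl fun a ha => ?_ <;>
  obtain ⟨i1, i2⟩ := mul_pow_eq_of_mul_eq h (mem_auxBox.mp ha).2.2
  · linear_combination (φ (C (C (c a))) * φ (C X) ^ a.1 * (auxNum φ α₁ β₁ k e₁ s ^ a.2.1 *
      auxDen φ α₁ β₁ k e₁ s ^ (N - a.2.1))) * i1
  · linear_combination (φ (C (C (c a))) * φ (C X) ^ a.1 * (auxNum φ α₁ β₁ k e₁ s ^ a.2.1 *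
      auxDen φ α₁ β₁ k e₁ s ^ (N - a.2.1))) * i2

end AuxForm

section Series

variable {K : Type*} [Field K]

theorem coeff_eq_of_mul_pow_eq {F F' b b' : PowerSeries K} {N w : ℕ} {r : K}
    (h : F' * b ^ N = F * b' ^ N) (hb : PowerSeries.constantCoeff b ≠ 0)
    (hb' : PowerSeries.constantCoeff b' = r * PowerSeries.constantCoeff b)
    (hF : PowerSeries.X ^ w ∣ F) : PowerSeries.X ^ w ∣ F' ∧
      PowerSeries.coeff w F' = r ^ N * PowerSeries.coeff w F := by
  have hu : IsUnit (b ^ N) := (PowerSeries.isUnit_iff_constantCoeff.mpr hb.isUnit).pow N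
  have hF' : PowerSeries.X ^ w ∣ F' := by
    rw [← hu.dvd_mul_right, h]
    exact hF.mul_right _
  refine ⟨hF', ?_⟩
  obtain ⟨P, rfl⟩ := hF
  obtain ⟨P', rfl⟩ := hF'
  rw [mul_assoc, mul_assoc] at h
  have h' := congrArg PowerSeries.constantCoeff
    (mul_left_cancel₀ (pow_ne_zero w PowerSeries.X_ne_zero) h)
  rw [map_mul, map_mul, map_pow, map_pow, hb', mul_pow, ← mul_assoc] at h'
  have h2 := mul_right_cancel₀ (pow_ne_zero N hb) h'
  have e (P : PowerSeries K) : PowerSeries.coeff w (PowerSeries.X ^ w * P) =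
    PowerSeries.constantCoeff P := by
    simpa using PowerSeries.coeff_X_pow_mul P w 0
  rw [e, e, h2, mul_comm]

/-- The number `r` is the common value of the quotients of the two denominators and of the two
numerators of the fractions in `auxNum` and `auxDen`. -/
def IsAuxRatio {R : Type*} [CommRing R] (φ : R[X][X] →+* K) (α β : R) (k : ℕ) (e r : K) : Prop :=
  auxDen φ α β k e true = r * auxDen φ α β k e false ∧
    auxNum φ α β k e true = r * auxNum φ α β k e false ∧
    (auxDen φ α β k e false ≠ 0 ∨ auxNum φ α β k e false ≠ 0)

variable {R : Type*} [CommRing R] (φ : R[X][X] →+* PowerSeries K) (α₁ β₁ α₂ β₂ : R) (k N : ℕ)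
  {e₁ e₂ : PowerSeries K} (c : ℕ × ℕ × ℕ → R)

theorem coeff_auxForm_eq (he₁ : e₁ * e₁ = φ (cubicProd α₁ β₁)) (he₂ : e₂ * e₂ = φ (cubicProd α₂ β₂))
    {r₁ r₂ : K}
    (hr₁ : IsAuxRatio (PowerSeries.constantCoeff.comp φ) α₁ β₁ k (PowerSeries.constantCoeff e₁) r₁)
    (hr₂ : IsAuxRatio (PowerSeries.constantCoeff.comp φ) α₂ β₂ k (PowerSeries.constantCoeff e₂) r₂)
    {w : ℕ} (hw : PowerSeries.X ^ w ∣ auxForm φ α₁ β₁ α₂ β₂ k N e₁ e₂ c false false) (s t : Bool) :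
    PowerSeries.coeff w (auxForm φ α₁ β₁ α₂ β₂ k N e₁ e₂ c s t) =
      (bif s then r₁ ^ N else 1) * (bif t then r₂ ^ N else 1) *
        PowerSeries.coeff w (auxForm φ α₁ β₁ α₂ β₂ k N e₁ e₂ c false false) := by
  have key (F : Bool → PowerSeries K) {α β e r} (he : e * e = φ (cubicProd α β))
      (hr : IsAuxRatio (PowerSeries.constantCoeff.comp φ) α β k (PowerSeries.constantCoeff e) r)
      (hF : F true * auxDen φ α β k e false ^ N = F false * auxDen φ α β k e true ^ N ∧
        F true * auxNum φ α β k e false ^ N = F false * auxNum φ α β k e true ^ N)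
      (hw : PowerSeries.X ^ w ∣ F false) (s : Bool) : PowerSeries.X ^ w ∣ F s ∧
        PowerSeries.coeff w (F s) = (bif s then r ^ N else 1) * PowerSeries.coeff w (F false) := by
    cases s
    · simpa using hw
    obtain ⟨h1, h2, h3⟩ := hr
    simp only [← map_auxDen, ← map_auxNum] at h1 h2 h3
    rcases h3 with h3 | h3
    · exact coeff_eq_of_mul_pow_eq hF.1 h3 h1 hw
    · exact coeff_eq_of_mul_pow_eq hF.2 h3 h2 hw
  obtain ⟨h1, h2⟩ := key (fun s => auxForm φ α₁ β₁ α₂ β₂ k N e₁ e₂ c s false) he₁ hr₁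
    (auxForm_true_left φ α₁ β₁ α₂ β₂ k N c he₁ false) hw s
  obtain ⟨-, h4⟩ := key (fun t => auxForm φ α₁ β₁ α₂ β₂ k N e₁ e₂ c s t) he₂ hr₂
    (auxForm_true_right φ α₁ β₁ α₂ β₂ k N c he₂ s) h1 t
  rw [h4, h2]
  ring

end Series

end Ratio

end VojtaCurve

namespace VojtaCurve

open Polynomial NumberField Height

section Main

theorem mulHeight_cond_one {K : Type*} [Field K] [AdmissibleAbsValues K] (r : K) :
    mulHeight (fun s : Bool => bif s then r else 1) = mulHeight₁ r := by
  rw [mulHeight₁_eq_mulHeight, ← mulHeight_comp_equiv finTwoEquiv, ← mulHeight_swap]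
  congr 1
  ext i
  fin_cases i <;> rfl

/-- The evaluation homomorphism at a point. -/
noncomputable def evHom {R K : Type*} [CommRing R] [CommRing K] (f : R →+* K) (x u : K) :
    R[X][X] →+* K :=
  eval₂RingHom (eval₂RingHom f x) u

theorem constantCoeff_comp_serHom {R K : Type*} [CommRing R] [Field K] (f : R →+* K) (x u g : K) :
    PowerSeries.constantCoeff.comp (serHom f x u g) = evHom f x u := by
  refine ringHom_ext' (ringHom_ext' ?_ ?_) ?_
  · ext r
    simp [serHom, evHom]
  · simp [serHom, evHom, constantCoeff_xSer]
  · simp [serHom, evHom]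

theorem lt_of_X_pow_dvd_biHom {R K : Type*} [CommRing R] [Field K] (f : R →+* K) {g₁ g₂ : R[X][X]}
    {x u g : K} (hg : 4 * g ≠ 0) {e₁ e₂ : PowerSeries K} (h₁ : e₁ * e₁ = serHom f x u g g₁)
    (h₂ : e₂ * e₂ = serHom f x u g g₂) {F : Biquad g₁ g₂} {w : ℕ}
    (h : PowerSeries.X ^ w ∣ biHom (serHom f x u g) e₁ e₂ h₁ h₂ F) :
    (X - C x) ^ w ∣ (biNorm F).eval₂ (mapRingHom f) (C u) := by
  refine X_sub_C_pow_dvd_of_X_pow_dvd hg ?_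
  rw [← serHom_eq_eval₂, ← biHom_biC (serHom f x u g) e₁ e₂ h₁ h₂]
  exact h.trans (map_dvd _ (dvd_biC_biNorm F))

theorem natCast_mul_pow_mul_pow_le {L n w D : ℕ} {M c : ℝ} (hL : 1 ≤ L) (hn : 1 ≤ n) (hM : 0 ≤ M)
    (hc : 1 ≤ c) (hw : w < n + D) :
    ((4 * (L * n) * L : ℕ) : ℝ) * M ^ n * c ^ (L * n + 10 + 21 * w) ≤
      (8 * L ^ 2 * M * c ^ (L + 31 + 21 * D)) ^ n := by
  rw [mul_pow, mul_pow, mul_pow, ← pow_mul, ← pow_mul]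
  have h₁ : ((4 * (L * n) * L : ℕ) : ℝ) ≤ 8 ^ n * (L : ℝ) ^ (2 * n) := by
    have h₂ : 4 * n ≤ 8 ^ n := by
      calc 4 * n ≤ 4 ^ n * 2 ^ n := Nat.mul_le_mul
              (by simpa using Nat.pow_le_pow_right (n := 4) (by norm_num) hn) n.lt_two_pow_self.le
        _ = 8 ^ n := by rw [← mul_pow]; norm_num
    have h₃ : L ^ 2 ≤ L ^ (2 * n) := Nat.pow_le_pow_right hL (by omega)
    have h₄ := Nat.mul_le_mul h₂ h₃
    calc ((4 * (L * n) * L : ℕ) : ℝ) = ((4 * n * L ^ 2 : ℕ) : ℝ) := by congr 1; ring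
      _ ≤ ((8 ^ n * L ^ (2 * n) : ℕ) : ℝ) := by exact_mod_cast h₄
      _ = _ := by push_cast; rfl
  have h₅ : L * n + 10 + 21 * w ≤ (L + 31 + 21 * D) * n := by nlinarith
  gcongr

theorem exists_mulHeight_le {K : Type*} [Field K] [NumberField K] {α₁ β₁ α₂ β₂ : 𝓞 K} (hβ₁ : β₁ ≠ 0)
    (hd₁ : α₁ ^ 2 ≠ 4 * β₁) (hβ₂ : β₂ ≠ 0) (hd₂ : α₂ ^ 2 ≠ 4 * β₂) {a : 𝓞 K}
    (ha : Odd ((cubic α₁ β₁ * cubic α₂ β₂).rootMultiplicity a)) {N : ℕ} (hN : 1000 ≤ N) :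
    ∃ C : ℝ, 1 ≤ C ∧ ∃ D : ℕ, ∀ k, 1 ≤ k → ∀ x u y₁ y₂ z₁ z₂ r₁ r₂ : K,
      y₁ ^ 2 = x ^ 3 + α₁ * x ^ 2 + β₁ * x → y₂ ^ 2 = x ^ 3 + α₂ * x ^ 2 + β₂ * x →
      z₁ ^ 2 = u ^ 3 + α₁ * u ^ 2 + β₁ * u → z₂ ^ 2 = u ^ 3 + α₂ * u ^ 2 + β₂ * u →
      y₁ ≠ 0 → y₂ ≠ 0 →
      IsAuxRatio (evHom (algebraMap (𝓞 K) K) x u) α₁ β₁ k (y₁ * z₁) r₁ →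
      IsAuxRatio (evHom (algebraMap (𝓞 K) K) x u) α₂ β₂ k (y₂ * z₂) r₂ →
      C ^ 4 ^ k < mulHeight₁ u → C < mulHeight₁ x →
      mulHeight₁ r₁ ^ N * mulHeight₁ r₂ ^ N ≤ C ^ 4 ^ k *
        (mulHeight₁ x ^ ((4 * N - 10) * 4 ^ k + 4 + 6 * (4 ^ k + D)) * mulHeight₁ u ^
          (4 * N - 6)) := by
  obtain ⟨M, hM, hform⟩ := exists_auxForm α₁ β₁ α₂ β₂ hN
  set L := 4 * N - 10 with hL
  have hL1 : 1 ≤ L := by omega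
  obtain ⟨C₀, hC₀, hord⟩ := exists_order_lt α₁ β₁ α₂ β₂ a ha L (by linarith : 1 ≤ M)
  obtain ⟨c, hc1, hc⟩ := exists_forall_infinitePlace_le (K := K) fun v =>
    max (max (v (α₁ : K)) (v (β₁ : K))) (max (max (v (α₂ : K)) (v (β₂ : K))) 3)
  set D := 4 * L + 13 with hD
  set C₁ : ℝ := 8 * L ^ 2 * M * c ^ (L + 31 + 21 * D) with hC₁
  have hC₁1 : 1 ≤ C₁ := by
    have : (1 : ℝ) ≤ (L : ℝ) ^ 2 := one_le_pow₀ (by exact_mod_cast hL1)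
    have := one_le_pow₀ hc1 (n := L + 31 + 21 * D)
    calc (1 : ℝ) = 1 * 1 * 1 * 1 := by norm_num
      _ ≤ _ := by
        rw [hC₁]
        gcongr
        · norm_num
        · linarith
  refine ⟨max C₀ (C₁ ^ Module.finrank ℚ K), hC₀.trans (le_max_left _ _), D, ?_⟩
  intro k hk x u y₁ y₂ z₁ z₂ r₁ r₂ hy₁ hy₂ hz₁ hz₂ hy₁0 hy₂0 hr₁ hr₂ hu hx
  obtain ⟨cf, ⟨a₀, ha₀, hcf⟩, hF⟩ := hform k
  set n := 4 ^ k with hn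
  have hn1 : 1 ≤ n := Nat.one_le_pow _ _ (by norm_num)
  set f := algebraMap (𝓞 K) K with hf
  set g := (x ^ 3 + f α₁ * x ^ 2 + f β₁ * x) * (x ^ 3 + f α₂ * x ^ 2 + f β₂ * x) with hg
  have hg0 : 4 * g ≠ 0 := by
    refine mul_ne_zero (by norm_num : (4 : K) ≠ 0) (mul_ne_zero ?_ ?_)
    · exact hy₁ ▸ pow_ne_zero 2 hy₁0
    · exact hy₂ ▸ pow_ne_zero 2 hy₂0
  obtain ⟨h₁, he₁, hh₁, hs₁⟩ := exists_sqrt_cubic_xSer hg hy₁ hz₁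
  obtain ⟨h₂, he₂, hh₂, hs₂⟩ := exists_sqrt_cubic_xSer (hg.trans (mul_comm _ _)) hy₂ hz₂
  rw [← serHom_cubicProd f x u g α₁ β₁] at he₁
  rw [← serHom_cubicProd f x u g α₂ β₂] at he₂
  set F : Bool → Bool → Biquad (cubicProd α₁ β₁) (cubicProd α₂ β₂) := fun s t =>
    auxForm biC α₁ β₁ α₂ β₂ k N eta₁ eta₂ cf s t with hFdef
  set ev := biHom (serHom f x u g) _ _ he₁ he₂ with hev
  have hmap (s t : Bool) : ev (F s t) =
      auxForm (serHom f x u g) α₁ β₁ α₂ β₂ k N (PowerSeries.C (y₁ * z₁) * (1 + 2 * h₁))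
        (PowerSeries.C (y₂ * z₂) * (1 + 2 * h₂)) cf s t := by
    rw [hFdef, map_auxForm, hev, biHom_comp_biC, biHom_eta₁, biHom_eta₂]
  have hF0 : F false false ≠ 0 := auxForm_ne_zero hβ₁ hd₁ hβ₂ hd₂
    (fun p q h => eq_zero_of_sq_eq_of_odd_rootMultiplicity ha h) hk ha₀ hcf
  have hlt (w : ℕ) (h : PowerSeries.X ^ w ∣ ev (F false false)) : w < n + D :=
    hord n hn1 _ hF0 (hF false false) x u
      ((pow_le_pow_left₀ (by linarith) (le_max_left _ _) n).trans_lt hu)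
      ((le_max_left _ _).trans_lt hx) w (lt_of_X_pow_dvd_biHom f hg0 he₁ he₂ h)
  have hev0 : ev (F false false) ≠ 0 := fun h =>
    absurd (hlt (n + D) (h ▸ dvd_zero _)) (lt_irrefl _)
  obtain ⟨w, hw, hw0⟩ : ∃ w, PowerSeries.X ^ w ∣ ev (F false false) ∧
      PowerSeries.coeff w (ev (F false false)) ≠ 0 :=
    ⟨_, PowerSeries.X_pow_order_dvd, PowerSeries.coeff_order hev0⟩
  have hwlt := hlt w hw
  have hcoef (s t : Bool) : PowerSeries.coeff w (ev (F s t)) =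
      (bif s then r₁ ^ N else 1) * (bif t then r₂ ^ N else 1) *
        PowerSeries.coeff w (ev (F false false)) := by
    rw [hmap] at hw
    rw [hmap, hmap]
    refine coeff_auxForm_eq _ _ _ _ _ _ _ _ he₁ he₂ ?_ ?_ hw s t
    · simpa [constantCoeff_comp_serHom, hh₁] using hr₁
    · simpa [constantCoeff_comp_serHom, hh₂] using hr₂
  have hZ : mulHeight (fun p : Bool × Bool => PowerSeries.coeff w (ev (F p.1 p.2))) =
      mulHeight₁ r₁ ^ N * mulHeight₁ r₂ ^ N := by
    have e : (fun p : Bool × Bool => PowerSeries.coeff w (ev (F p.1 p.2))) =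
        PowerSeries.coeff w (ev (F false false)) • fun p : Bool × Bool =>
          (fun s : Bool => bif s then r₁ ^ N else 1) p.1 *
            (fun t : Bool => bif t then r₂ ^ N else 1) p.2 := by
      ext p
      rw [hcoef, Pi.smul_apply, smul_eq_mul, mul_comm]
    have hne (r : K) : (fun s : Bool => bif s then r else 1) ≠ 0 :=
      fun h => one_ne_zero (congrFun h false)
    have h := mulHeight_fun_mul_eq (hne (r₁ ^ N)) (hne (r₂ ^ N))
    rw [mulHeight_cond_one, mulHeight_cond_one, mulHeight₁_pow, mulHeight₁_pow] at h
    rw [e, mulHeight_smul_eq_mulHeight _ hw0]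
    exact h
  have hdeg (s t y z i j) (h : biCoeff y z i j (F s t) ≠ 0) : i < L * n ∧ j < L :=
    (hF s t y z i j).1 h
  have hbd := mulHeight_le_of_local
    (x := fun p : Bool × Bool => PowerSeries.coeff w (ev (F p.1 p.2)))
    (fun h => hw0 (congrFun h (false, false))) x u (L * n + 4 + 6 * w) (L + 4)
    (M := C₁ ^ n) (by positivity) ?_ ?_
  · rw [hZ] at hbd
    refine hbd.trans ?_
    rw [← pow_mul, mul_comm n, pow_mul, show 4 * N - 6 = L + 4 by omega]
    gcongr
    · exact le_max_right _ _
    · exact one_le_mulHeight₁ x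
  · intro v p
    have h := coeff_biHom_le f (hasSeriesNorms_of_isNonarchimedean (v := v.1) fun a b =>
      map_add_le_max v a b)
      le_rfl (fun a b => (map_add_le_max v a b).trans_eq (one_mul _).symm)
      ((map_ofNat f 2) ▸ finitePlace_le_one v 2) ((map_ofNat f 3) ▸ finitePlace_le_one v 3)
      (finitePlace_le_one v α₁) (finitePlace_le_one v β₁) (finitePlace_le_one v α₂)
      (finitePlace_le_one v β₂) hg hy₁ hy₂ hz₁ hz₂ hs₁ hs₂ he₁ he₂ (hdeg p.1 p.2)
      (fun y z i j => finitePlace_le_one v _) w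
    rw [one_pow, mul_one, mul_one, one_mul] at h
    exact h
  · intro v p
    have hcv := hc v
    simp only [max_le_iff] at hcv
    have h := coeff_biHom_le f (hasSeriesNorms v.1 (c := c) (by linarith))
      (by linarith) (fun a b => ?_) ?_ ?_ hcv.1.1 hcv.1.2 hcv.2.1.1 hcv.2.1.2 hg hy₁ hy₂ hz₁ hz₂
        hs₁ hs₂
      he₁ he₂ (hdeg p.1 p.2) (fun y z i j => (hF p.1 p.2 y z i j).2 v) w
    · refine h.trans (mul_le_mul_of_nonneg_right ?_ (by positivity))
      exact natCast_mul_pow_mul_pow_le hL1 hn1 (by linarith) hc1 hwlt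
    · refine (v.1.add_le a b).trans ?_
      have h1 := le_max_left (v.1 a) (v.1 b)
      have h2 := le_max_right (v.1 a) (v.1 b)
      have h3 : 0 ≤ max (v.1 a) (v.1 b) := (v.1.nonneg a).trans h1
      nlinarith [hcv.2.2]
    · have h := v.1.add_le 1 1
      rw [map_one, one_add_one_eq_two, one_add_one_eq_two] at h
      linarith [hcv.2.2]
    · exact (by
        have h := v.1.add_le 1 1
        have h' := v.1.add_le 2 1
        rw [map_one] at h h'
        norm_num at h h'
        linarith [hcv.2.2])

end Main

end VojtaCurve

namespace VojtaCurve

open Polynomial WeierstrassCurve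

section Ratio

theorem dupl_map {R S : Type*} [CommRing R] [CommRing S] (f : R →+* S) (α β : R) (k : ℕ) :
    (duplA α β k).map f = duplA (f α) (f β) k ∧ (duplB α β k).map f = duplB (f α) (f β) k ∧
      (duplG α β k).map f = duplG (f α) (f β) k := by
  induction k with
  | zero => simp
  | succ k ih =>
    obtain ⟨h1, h2, h3⟩ := ih
    simp only [duplA, duplB, duplG] at h1 h2 h3
    simp [duplA, duplB, duplG, dupl, Polynomial.map_ofNat, h1, h2, h3]

variable {R K : Type*} [CommRing R] [Field K] [CharZero K] [DecidableEq K] (f : R →+* K) {α β : R}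

theorem exists_isAuxRatio {x y u z : K} (hP : (ell (f α) (f β)).Nonsingular x y)
    (hQ : (ell (f α) (f β)).Nonsingular u z) (hz : z ≠ 0) {k : ℕ}
    (h0 : 2 ^ k • Affine.Point.some x y hP ≠ 0)
    (hne : 2 ^ k • Affine.Point.some x y hP + .some u z hQ ≠ 0) :
    ∃ r s hr, 2 ^ k • Affine.Point.some x y hP + .some u z hQ = .some r s hr ∧
      IsAuxRatio (evHom f x u) α β k (y * z) r := by
  obtain ⟨hA, hB, hG⟩ := dupl_map f α β k
  obtain ⟨hb, hsome⟩ := ell_two_pow_nsmul hP k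
  have hb0 : (duplB (f α) (f β) k).eval x ≠ 0 := fun h => h0 (hb h)
  obtain ⟨hR, hk⟩ := hsome hb0
  have ea : (duplA α β k).eval₂ f x = (duplA (f α) (f β) k).eval x := by rw [← hA, eval_map]
  have eb : (duplB α β k).eval₂ f x = (duplB (f α) (f β) k).eval x := by rw [← hB, eval_map]
  have eg : (duplG α β k).eval₂ f x = (duplG (f α) (f β) k).eval x := by rw [← hG, eval_map]
  have hc := ell_nonsingular_equation hR
  have hx := ell_nonsingular_equation hP
  have hu := ell_nonsingular_equation hQ
  set a := (duplA (f α) (f β) k).eval x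
  set b := (duplB (f α) (f β) k).eval x
  set g := (duplG (f α) (f β) k).eval x
  have evC (p : R[X]) : evHom f x u (C p) = p.eval₂ f x := by simp [evHom]
  have evX : evHom f x u X = u := by simp [evHom]
  have eD : evHom f x u (auxD α β k) = (a - u * b) ^ 2 := by
    simp [evC, evX, auxD, ea, eb, mul_comm u]
  have eS : evHom f x u (auxS α β k) = (a + u * b) * (a * u + f β * b) + 2 * f α * a * b * u := by
    simp [evC, evX, auxS, ea, eb, map_ofNat (evHom f x u) 2, mul_comm u]
  have eW : evHom f x u (auxW α β k) = (a * u - f β * b) ^ 2 := by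
    simp [evC, evX, auxW, ea, eb]
  have eG : evHom f x u (C (duplG α β k)) = g := by
    rw [evC, eg]
  have eC : y * z * (y * z) = evHom f x u (cubicProd α β) := by
    have ev' (t : K) : (cubic α β).eval₂ f t = t ^ 3 + f α * t ^ 2 + f β * t := by simp [cubic]
    have evM : evHom f x u ((cubic α β).map C) = (cubic α β).eval₂ f u := by
      simp [evHom, eval₂_map]
    rw [cubicProd, map_mul, evC, evM, ev', ev']
    linear_combination y ^ 2 * hu + (u ^ 3 + f α * u ^ 2 + f β * u) * hx
  have hpm := auxNum_mul_auxDen (evHom f x u) α β k eC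
  unfold IsAuxRatio
  simp only [auxNum, auxDen, cond_true, cond_false, eD, eS, eW, eG] at hpm ⊢
  by_cases hau : a = u * b
  · have hab : a / b = u := by rw [hau, mul_div_cancel_right₀ _ hb0]
    have hsq : (y * g / b ^ 2 - z) * (y * g / b ^ 2 + z) = 0 := by
      rw [hab] at hc
      linear_combination hc - hu
    have hkQ : ∃ h, 2 ^ k • Affine.Point.some x y hP = .some u (y * g / b ^ 2) h :=
      exists_some_congr ⟨hR, hk⟩ hab rfl
    rcases mul_eq_zero.mp hsq with h | h
    · have hy : y * g / b ^ 2 = z := sub_eq_zero.mp h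
      have hyg : y * g = z * b ^ 2 := by rw [← hy]; field_simp
      obtain ⟨h1, h2⟩ := exists_some_congr hkQ rfl hy
      obtain ⟨h3, h4⟩ := ell_double (h := hQ) hz
      refine ⟨_, _, h3, by rw [h2]; exact h4, ?_, ?_, Or.inr ?_⟩
      · rw [hau]
        linear_combination -2 * z * hyg - 2 * b ^ 2 * hu
      · rw [hau]
        field_simp
        linear_combination (-2 * z * (u ^ 2 - f β) ^ 2) * hyg + (2 * b ^ 2 * (u ^ 2 - f β) ^ 2) * hu
      · have : (a + u * b) * (a * u + f β * b) + 2 * f α * a * b * u + 2 * g * (y * z) =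
            4 * (b * z) ^ 2 := by
          rw [hau]
          linear_combination 2 * z * hyg - 2 * b ^ 2 * hu
        rw [this]
        exact mul_ne_zero (by norm_num) (pow_ne_zero _ (mul_ne_zero hb0 hz))
    · refine absurd ?_ hne
      obtain ⟨h1, h2⟩ := exists_some_congr hkQ rfl (eq_neg_of_add_eq_zero_left h)
      obtain ⟨h3, h4⟩ := ell_neg_some hQ
      rw [h2, ← h4, neg_add_cancel]
  · have hab : a / b ≠ u := fun h => hau (by rw [← h, div_mul_cancel₀ _ hb0])
    obtain ⟨h1, h2⟩ := ell_add_of_X_ne (h₁ := hR) (h₂ := hQ) hab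
    have hs := sub_ne_zero.mpr hau
    have hs' := sub_ne_zero.mpr hab
    have e1 : (a - u * b) = b * (a / b - u) := by field_simp
    set X := a / b with hX
    set Y := y * g / b ^ 2 with hY
    have ha : a = X * b := by rw [hX]; field_simp
    have hyg : y * g = Y * b ^ 2 := by rw [hY]; field_simp
    have key : (a + u * b) * (a * u + f β * b) + 2 * f α * a * b * u - 2 * g * (y * z) =
        (((Y - z) / (X - u)) ^ 2 - f α - X - u) * (a - u * b) ^ 2 := by
      have hl := div_mul_cancel₀ (Y - z) hs'
      rw [e1, ha]
      linear_combination (-2 * z) * hyg - b ^ 2 * hc - b ^ 2 * hu -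
        b ^ 2 * ((Y - z) / (X - u) * (X - u) + (Y - z)) * hl
    refine ⟨_, _, h1, by rw [hk, h2], key, ?_, Or.inl (pow_ne_zero 2 hs)⟩
    refine mul_right_cancel₀ (pow_ne_zero 2 hs) ?_
    rw [← hpm, key]
    ring

end Ratio

end VojtaCurve

namespace VojtaCurve

open Polynomial NumberField Height WeierstrassCurve

section Core

theorem cubic_neg_add_mul {R : Type*} [CommRing R] (b c : R) :
    cubic (-(b + c)) (b * c) = X * (X - C b) * (X - C c) := by
  simp [cubic]
  ring

theorem odd_rootMultiplicity {R : Type*} [CommRing R] [IsDomain R] {b c d : R} (hc : c ≠ 0)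
    (hbc : b ≠ c) (hcd : c ≠ d) :
    Odd ((cubic (-(b + c)) (b * c) * cubic (-(b + d)) (b * d)).rootMultiplicity c) := by
  have h : ¬ (X * (X - C b) * (X * (X - C b) * (X - C d))).IsRoot c := by
    simp [IsRoot, hc, sub_eq_zero, hbc.symm, hcd]
  have h0 : X * (X - C b) * (X * (X - C b) * (X - C d)) ≠ 0 := fun h' => h (by simp [h'])
  have e : cubic (-(b + c)) (b * c) * cubic (-(b + d)) (b * d) =
      X * (X - C b) * (X * (X - C b) * (X - C d)) * (X - C c) ^ 1 := by
    rw [cubic_neg_add_mul, cubic_neg_add_mul]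
    ring
  rw [e, rootMultiplicity_mul_X_sub_C_pow h0, rootMultiplicity_eq_zero h]
  exact odd_one

variable {K : Type*} [Field K] [NumberField K] [DecidableEq K]

omit [DecidableEq K] in
theorem logHeight_xRep_some {α β x y : K} (h : (ell α β).Nonsingular x y) :
    logHeight (Affine.Point.some x y h).xRep = logHeight₁ x := by
  rw [logHeight₁_eq_logHeight]
  rfl

theorem finite_setOf_isSquare_and_isSquare {b c d : 𝓞 K} (hb : b ≠ 0) (hc : c ≠ 0) (hd : d ≠ 0)
    (hbc : b ≠ c) (hbd : b ≠ d) (hcd : c ≠ d) :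
    {x : K | IsSquare (x * (x - b) * (x - c)) ∧ IsSquare (x * (x - b) * (x - d))}.Finite := by
  set α₁ : 𝓞 K := -(b + c) with hα₁
  set β₁ : 𝓞 K := b * c with hβ₁
  set α₂ : 𝓞 K := -(b + d) with hα₂
  set β₂ : 𝓞 K := b * d with hβ₂
  set f := algebraMap (𝓞 K) K with hf
  have finj : Function.Injective f := FaithfulSMul.algebraMap_injective _ _
  have hβ₁0 : β₁ ≠ 0 := mul_ne_zero hb hc
  have hβ₂0 : β₂ ≠ 0 := mul_ne_zero hb hd
  have hd₁ : α₁ ^ 2 ≠ 4 * β₁ := fun h => pow_ne_zero 2 (sub_ne_zero.mpr hbc) (by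
    rw [hα₁, hβ₁] at h
    linear_combination h)
  have hd₂ : α₂ ^ 2 ≠ 4 * β₂ := fun h => pow_ne_zero 2 (sub_ne_zero.mpr hbd) (by
    rw [hα₂, hβ₂] at h
    linear_combination h)
  have fne {a : 𝓞 K} (h : a ≠ 0) : f a ≠ 0 := (map_ne_zero_iff f finj).mpr h
  have fdisc {a b : 𝓞 K} (h : a ^ 2 ≠ 4 * b) : f a ^ 2 ≠ 4 * f b := fun h' => h (finj (by
    rw [map_pow, map_mul, map_ofNat f 4, h']))
  have hrep₁ : ∃ R : Set (ell (f α₁) (f β₁)).Point, R.Finite ∧ ∀ P, ∃ P', P - 2 • P' ∈ R := by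
    rw [show f α₁ = -(f b + f c) by simp [hα₁], show f β₁ = f b * f c by simp [hβ₁]]
    exact exists_finite_sub_two_nsmul_mem (fne hb) (fne hc) (finj.ne hbc)
  have hrep₂ : ∃ R : Set (ell (f α₂) (f β₂)).Point, R.Finite ∧ ∀ P, ∃ P', P - 2 • P' ∈ R := by
    rw [show f α₂ = -(f b + f d) by simp [hα₂], show f β₂ = f b * f d by simp [hβ₂]]
    exact exists_finite_sub_two_nsmul_mem (fne hb) (fne hd) (finj.ne hbd)
  have hodd := odd_rootMultiplicity hc hbc hcd
  have hcube₁ (x : K) : x * (x - b) * (x - c) = x ^ 3 + f α₁ * x ^ 2 + f β₁ * x := by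
    rw [hα₁, hβ₁, map_neg, map_add, map_mul]
    ring
  have hcube₂ (x : K) : x * (x - b) * (x - d) = x ^ 3 + f α₂ * x ^ 2 + f β₂ * x := by
    rw [hα₂, hβ₂, map_neg, map_add, map_mul]
    ring
  have hne₁ {x : K} (h : x ∉ ({0, f b, f c, f d} : Set K)) : x * (x - b) * (x - c) ≠ 0 := by
    simp only [Set.mem_insert_iff, Set.mem_singleton_iff, not_or] at h
    exact mul_ne_zero (mul_ne_zero h.1 (sub_ne_zero.mpr h.2.1)) (sub_ne_zero.mpr h.2.2.1)
  have hne₂ {x : K} (h : x ∉ ({0, f b, f c, f d} : Set K)) : x * (x - b) * (x - d) ≠ 0 := by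
    simp only [Set.mem_insert_iff, Set.mem_singleton_iff, not_or] at h
    exact mul_ne_zero (mul_ne_zero h.1 (sub_ne_zero.mpr h.2.1)) (sub_ne_zero.mpr h.2.2.2)
  rw [← hα₁, ← hα₂, ← hβ₁, ← hβ₂] at hodd
  simp only [hcube₁, hcube₂] at hne₁ hne₂ ⊢
  clear_value α₁ α₂ β₁ β₂
  obtain ⟨q₁, hq₁, hpar₁, H₁, hH₁⟩ := exists_ell_height (fne hβ₁0) (fdisc hd₁)
  obtain ⟨q₂, hq₂, hpar₂, H₂, hH₂⟩ := exists_ell_height (fne hβ₂0) (fdisc hd₂)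
  obtain ⟨C, hC, D, hmain⟩ := exists_mulHeight_le hβ₁0 hd₁ hβ₂0 hd₂ hodd (le_refl 1000)
  obtain ⟨R₁, hR₁, hR₁'⟩ := hrep₁
  obtain ⟨R₂, hR₂, hR₂'⟩ := hrep₂
  set H := max (max H₁ H₂) 0 with hH
  have hH0 : 0 ≤ H := le_max_right _ _
  have hqH₁ (P) : |q₁ P - logHeight P.xRep| ≤ H :=
    (hH₁ P).trans ((le_max_left _ _).trans (le_max_left _ _))
  have hqH₂ (P) : |q₂ P - logHeight P.xRep| ≤ H :=
    (hH₂ P).trans ((le_max_right _ _).trans (le_max_left _ _))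
  set c₀ := Real.log C with hc₀
  have hc₀0 : 0 ≤ c₀ := Real.log_nonneg hC
  set q : (ell (f α₁) (f β₁)).Point × (ell (f α₂) (f β₂)).Point → ℝ := fun P => q₁ P.1 + q₂ P.2
    with hq
  have hpar (P Q) : q (P + Q) + q (P - Q) = 2 * (q P + q Q) := by
    have h1 := hpar₁ P.1 Q.1
    have h2 := hpar₂ P.2 Q.2
    simp only [hq, Prod.fst_add, Prod.snd_add, Prod.fst_sub, Prod.snd_sub]
    linarith
  have hfin (B : ℝ) : {P | q P ≤ B}.Finite := by
    refine ((finite_ell_logHeight_le (B + H)).prod (finite_ell_logHeight_le (B + H))).subset ?_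
    intro P hP
    have h1 := abs_le.mp (hqH₁ P.1)
    have h2 := abs_le.mp (hqH₂ P.2)
    have h3 := hq₁ P.1
    have h4 := hq₂ P.2
    change q₁ P.1 + q₂ P.2 ≤ B at hP
    constructor
    · change logHeight _ ≤ _
      linarith
    · change logHeight _ ≤ _
      linarith
  set Z : Set ((ell (f α₁) (f β₁)).Point × (ell (f α₂) (f β₂)).Point) :=
    {P | ∃ x y₁ y₂ h₁ h₂, P = (.some x y₁ h₁, .some x y₂ h₂) ∧ y₁ ≠ 0 ∧ y₂ ≠ 0} with hZ
  by_contra hinf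
  have hZinf : Z.Infinite := by
    intro hfinZ
    refine hinf (((Set.toFinite {0, f b, f c, f d}).union
      (hfinZ.image fun P => P.1.xRep 0)).subset ?_)
    rintro x ⟨⟨y₁, h₁⟩, y₂, h₂⟩
    by_cases hx : x ∈ ({0, f b, f c, f d} : Set K)
    · exact Or.inl hx
    right
    refine ⟨(.some x y₁ (ell_nonsingular (fne hβ₁0) (fdisc hd₁) ((pow_two _).trans h₁.symm)),
      .some x y₂ (ell_nonsingular (fne hβ₂0) (fdisc hd₂) ((pow_two _).trans h₂.symm))),
      ⟨x, y₁, y₂, _, _, rfl, ?_, ?_⟩, rfl⟩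
    · rintro rfl
      exact hne₁ hx (by simpa using h₁)
    · rintro rfl
      exact hne₂ hx (by simpa using h₂)
  obtain ⟨P, ⟨x, y₁, y₂, hP₁, hP₂, rfl, hy₁, hy₂⟩, Q, ⟨u, z₁, z₂, hQ₁, hQ₂, rfl, hz₁, hz₂⟩, k, hk,
    hB, hε⟩ :=
    exists_sub_two_pow_nsmul_le hpar (fun P => add_nonneg (hq₁ _) (hq₂ _)) hfin (R₁ ×ˢ R₂)
      (hR₁.prod hR₂) (fun P => by
        obtain ⟨P₁, h₁⟩ := hR₁' P.1
        obtain ⟨P₂, h₂⟩ := hR₂' P.2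
        exact ⟨(P₁, P₂), h₁, h₂⟩) Z hZinf (1 / 1000) (2 * (3 * c₀ + 13000 * H + 2)) (by norm_num)
          (4 + 6 * D)
  set p₁ := Affine.Point.some x y₁ hP₁ with hp₁
  set p₂ := Affine.Point.some x y₂ hP₂ with hp₂
  set s₁ := Affine.Point.some u z₁ hQ₁ with hs₁
  set s₂ := Affine.Point.some u z₂ hQ₂ with hs₂
  set U := logHeight₁ u with hU
  set X' := logHeight₁ x with hX'
  set n : ℕ := 4 ^ k with hn
  have hnD : ((4 + 6 * D : ℕ) : ℝ) ≤ n := by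
    exact_mod_cast hk.trans (Nat.lt_pow_self (by norm_num)).le
  push_cast at hnD
  have hn1 : (1 : ℝ) ≤ n := by exact_mod_cast Nat.one_le_pow _ _ (by norm_num)
  have hpX₁ := abs_le.mp (hqH₁ p₁)
  have hpX₂ := abs_le.mp (hqH₂ p₂)
  have hsU₁ := abs_le.mp (hqH₁ s₁)
  have hsU₂ := abs_le.mp (hqH₂ s₂)
  rw [logHeight_xRep_some] at hpX₁ hpX₂ hsU₁ hsU₂
  have hpow₁ : q₁ (2 ^ k • p₁) = n * q₁ p₁ := by
    rw [parallelogram_nsmul hpar₁, hn]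
    push_cast
    rw [← pow_mul, mul_comm k, pow_mul]
    norm_num
  have hpow₂ : q₂ (2 ^ k • p₂) = n * q₂ p₂ := by
    rw [parallelogram_nsmul hpar₂, hn]
    push_cast
    rw [← pow_mul, mul_comm k, pow_mul]
    norm_num
  change q₁ (s₁ - 2 ^ k • p₁) + q₂ (s₂ - 2 ^ k • p₂) ≤ 1 / 1000 * (q₁ s₁ + q₂ s₂) at hε
  change _ ≤ q₁ p₁ + q₂ p₂ at hB
  have hadd₁ := hpar₁ s₁ (2 ^ k • p₁)
  have hadd₂ := hpar₂ s₂ (2 ^ k • p₂)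
  have hsub₁ := hpar₁ s₁ (s₁ - 2 ^ k • p₁)
  have hsub₂ := hpar₂ s₂ (s₂ - 2 ^ k • p₂)
  rw [sub_sub_cancel] at hsub₁ hsub₂
  rw [add_comm s₁] at hadd₁
  rw [add_comm s₂] at hadd₂
  have hd₁0 := hq₁ (s₁ - 2 ^ k • p₁)
  have hd₂0 := hq₂ (s₂ - 2 ^ k • p₂)
  have ht₁0 := hq₁ (s₁ + (s₁ - 2 ^ k • p₁))
  have ht₂0 := hq₂ (s₂ + (s₂ - 2 ^ k • p₂))
  rw [hpow₁] at hadd₁ hsub₁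
  rw [hpow₂] at hadd₂ hsub₂
  have hXbig : 3 * c₀ + 12000 * H + 1 ≤ X' := by linarith
  have hnX := mul_le_mul_of_nonneg_left hXbig (by linarith : (0 : ℝ) ≤ n)
  have hnH := mul_le_mul_of_nonneg_right hn1 hH0
  have hnc := mul_nonneg (by linarith : (0 : ℝ) ≤ n) hc₀0
  have hnp₁ := mul_le_mul_of_nonneg_left (by linarith : X' - H ≤ q₁ p₁) (by linarith : (0 : ℝ) ≤ n)
  have hnp₂ := mul_le_mul_of_nonneg_left (by linarith : X' - H ≤ q₂ p₂) (by linarith : (0 : ℝ) ≤ n)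
  rw [mul_sub] at hnp₁ hnp₂
  have hDX := mul_le_mul_of_nonneg_right hnD (by linarith : 0 ≤ X')
  have hU0 : 0 ≤ U := zero_le_logHeight₁ u
  have hUbig : n * c₀ < U := by linarith
  obtain ⟨r₁, _, hr₁, hsum₁, haux₁⟩ := exists_isAuxRatio f (k := k) hP₁ hQ₁ hz₁
    (fun h => by rw [← hp₁] at h; rw [h, parallelogram_zero hpar₁] at hpow₁; linarith)
    (fun h => by rw [← hp₁, ← hs₁] at h; rw [h, parallelogram_zero hpar₁] at hadd₁; linarith)
  obtain ⟨r₂, _, hr₂, hsum₂, haux₂⟩ := exists_isAuxRatio f (k := k) hP₂ hQ₂ hz₂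
    (fun h => by rw [← hp₂] at h; rw [h, parallelogram_zero hpar₂] at hpow₂; linarith)
    (fun h => by rw [← hp₂, ← hs₂] at h; rw [h, parallelogram_zero hpar₂] at hadd₂; linarith)
  have hrH₁ := abs_le.mp (hqH₁ (.some r₁ _ hr₁))
  have hrH₂ := abs_le.mp (hqH₂ (.some r₂ _ hr₂))
  rw [logHeight_xRep_some, ← hsum₁] at hrH₁
  rw [logHeight_xRep_some, ← hsum₂] at hrH₂
  have hC0 : 0 < C := by linarith
  have hmx := one_le_mulHeight₁ x
  have hmu := one_le_mulHeight₁ u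
  have hm₁ := one_le_mulHeight₁ r₁
  have hm₂ := one_le_mulHeight₁ r₂
  have hfinal := hmain k (by omega) x u y₁ y₂ z₁ z₂ r₁ r₂ (ell_nonsingular_equation hP₁)
    (ell_nonsingular_equation hP₂) (ell_nonsingular_equation hQ₁) (ell_nonsingular_equation hQ₂)
    hy₁ hy₂ haux₁ haux₂
    ((Real.log_lt_log_iff (by positivity) (by linarith)).mp (by rw [Real.log_pow]; exact hUbig))
    ((Real.log_lt_log_iff hC0 (by linarith)).mp (by change c₀ < X'; linarith))
  have hlog := Real.log_le_log (by positivity) hfinal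
  rw [Real.log_mul (by positivity) (by positivity), Real.log_mul (by positivity) (by positivity),
    Real.log_mul (by positivity) (by positivity), Real.log_pow, Real.log_pow, Real.log_pow,
    Real.log_pow, Real.log_pow] at hlog
  change _ * logHeight₁ r₁ + _ * logHeight₁ r₂ ≤ (n : ℝ) * c₀ + (_ * X' + _ * U) at hlog
  rw [← hn] at hlog
  push_cast at hlog
  linarith

end Core

end VojtaCurve

namespace VojtaCurve

open Polynomial NumberField IsDedekindDomain

section Valuation

variable {K Γ : Type*} [Field K] [LinearOrderedCommGroupWithZero Γ]

theorem exists_eq_pow_of_coprime {a b : Γ} {n q : ℕ} (hq : q ≠ 0) (h : n.Coprime q)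
    (hab : a ^ n = b ^ q) :
    ∃ γ, a = γ ^ q := by
  rcases eq_or_ne a 0 with rfl | ha
  · exact ⟨0, (zero_pow hq).symm⟩
  refine ⟨b ^ (n.gcdA q) * a ^ (n.gcdB q), ?_⟩
  have hb := Nat.gcd_eq_gcd_ab n q
  rw [h.gcd_eq_one] at hb
  rw [mul_pow, ← zpow_natCast, ← zpow_natCast, ← zpow_mul, ← zpow_mul, mul_comm _ (q : ℤ), zpow_mul,
    zpow_natCast, ← hab, ← zpow_natCast, ← zpow_mul, ← zpow_add₀ ha, mul_comm _ (q : ℤ), ← hb,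
    Nat.cast_one, zpow_one]

theorem valuation_eval_sub_lt (v : Valuation K Γ) {h : K[X]} (hh : ∀ i, v (h.coeff i) ≤ 1) {x e : K}
    (he : v e ≤ 1) (hx : v (x - e) < 1) : v (h.eval x - h.eval e) < 1 := by
  have hx1 : v x ≤ 1 := by
    rw [← sub_add_cancel x e]
    exact v.map_add_le hx.le he
  rw [eval_eq_sum_range, eval_eq_sum_range, ← Finset.sum_sub_distrib]
  refine v.map_sum_lt one_ne_zero fun i _ => ?_
  rw [← mul_sub, ← (Commute.all x e).mul_geom_sum₂, map_mul, map_mul]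
  have h1 : v (∑ j ∈ Finset.range i, x ^ j * e ^ (i - 1 - j)) ≤ 1 := by
    refine v.map_sum_le fun j _ => ?_
    rw [map_mul, map_pow, map_pow]
    exact mul_le_one' (pow_le_one' hx1 _) (pow_le_one' he _)
  calc _ ≤ 1 * (v (x - e) * 1) := by gcongr; exact hh i
    _ < 1 := by simpa using hx

theorem valuation_eval_eq_pow (v : Valuation K Γ) {g : K[X]} (hg : ∀ i, v (g.coeff i) ≤ 1)
    (hl : v g.leadingCoeff = 1) {x : K} (hx : 1 < v x) : v (g.eval x) = v x ^ g.natDegree := by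
  rw [eval_eq_sum_range, Finset.sum_range_succ, Valuation.map_add_eq_of_lt_right _ ?_]
  · rw [map_mul, map_pow, coeff_natDegree, hl, one_mul]
  · rw [map_mul, map_pow, coeff_natDegree, hl, one_mul]
    refine v.map_sum_lt (pow_ne_zero _ (zero_lt_one.trans hx).ne') fun i hi => ?_
    rw [map_mul, map_pow]
    calc _ ≤ 1 * v x ^ i := by gcongr; exact hg i
      _ < _ := by
        rw [one_mul]
        exact pow_lt_pow_right₀ hx (Finset.mem_range.mp hi)

end Valuation

section Descent

variable {K : Type*} [Field K] [NumberField K]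

theorem finite_not_valuation_coeff_le (h : K[X]) :
    {v : HeightOneSpectrum (𝓞 K) | ¬ ∀ i, v.valuation K (h.coeff i) ≤ 1}.Finite := by
  refine (h.support.finite_toSet.biUnion fun i hi =>
    finite_valuation_ne_one (K := K) (mem_support_iff.mp hi)).subset fun v hv => ?_
  simp only [Set.mem_ofPred_eq, not_forall, not_le] at hv
  obtain ⟨i, hi⟩ := hv
  refine Set.mem_biUnion (x := i) ?_ hi.ne'
  refine mem_support_iff.mpr fun h0 => ?_
  simp [h0] at hi

theorem finite_not_valuation_le (e : K) :
    {v : HeightOneSpectrum (𝓞 K) | ¬ v.valuation K e ≤ 1}.Finite := by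
  refine (finite_not_valuation_coeff_le (C e)).subset fun v hv h => hv ?_
  simpa using h 0

theorem finite_not_exists_valuation_eq_pow {q : ℕ} (hq : q ≠ 0) {g : K[X]} (hg : g ≠ 0) {e : K}
    (he : (g.rootMultiplicity e).Coprime q) : {v : HeightOneSpectrum (𝓞 K) | ¬ ∀ x y : K,
      y ^ q = g.eval x → v.valuation K x ≤ 1 → ∃ γ, v.valuation K (x - e) = γ ^ q}.Finite := by
  obtain ⟨h, hgh, hh⟩ := exists_eq_pow_rootMultiplicity_mul_and_not_dvd g hg e
  have hhe : h.eval e ≠ 0 := fun h0 => hh (dvd_iff_isRoot.mpr h0)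
  refine ((finite_not_valuation_coeff_le h).union ((finite_not_valuation_le e).union
    (finite_valuation_ne_one hhe))).subset fun v hv => ?_
  by_contra hS
  simp only [Set.mem_union, not_or, Set.mem_ofPred_eq, not_not] at hS
  obtain ⟨h1, h2, h3⟩ := hS
  refine hv fun x y hxy hx => ?_
  have h4 : v.valuation K (x - e) ≤ 1 := (v.valuation K).map_sub_le hx h2
  rcases h4.eq_or_lt with h4 | h4
  · exact ⟨1, by simpa using h4⟩
  have h5 : v.valuation K (h.eval x) = 1 := by
    rw [← sub_add_cancel (h.eval x) (h.eval e), Valuation.map_add_eq_of_lt_right, h3]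
    rw [h3]
    exact valuation_eval_sub_lt _ h1 h2 h4
  refine exists_eq_pow_of_coprime hq he (b := v.valuation K y) ?_
  rw [← map_pow, ← map_pow, hxy, hgh, eval_mul, map_mul, ← hgh, h5, mul_one]
  simp

theorem exists_finite_div_classes {q : ℕ} (hq : q ≠ 0) {g : K[X]} (hg : g ≠ 0) {e e' : K}
    (he : (g.rootMultiplicity e).Coprime q) (he' : (g.rootMultiplicity e').Coprime q) :
    ∃ R : Set K, R.Finite ∧ (∀ r ∈ R, r ≠ 0) ∧ ∀ x, x ≠ e → x ≠ e' → (∃ y, y ^ q = g.eval x) →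
      ∃ r ∈ R, ∃ t ≠ 0, (x - e) / (x - e') = r * t ^ q := by
  obtain ⟨R, hR, hR0, hRc⟩ := exists_finite_pow_classes hq
    ((finite_not_exists_valuation_eq_pow hq hg he).union
      ((finite_not_exists_valuation_eq_pow hq hg he').union
        ((finite_not_valuation_le e).union (finite_not_valuation_le e'))))
  refine ⟨R, hR, hR0, fun x hx hx' ⟨y, hy⟩ => hRc _
    (div_ne_zero (sub_ne_zero.mpr hx) (sub_ne_zero.mpr hx')) fun v hv => ?_⟩
  simp only [Set.mem_union, not_or, Set.mem_ofPred_eq, not_not] at hv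
  obtain ⟨h1, h2, h3, h4⟩ := hv
  rw [map_div₀]
  rcases le_or_gt (v.valuation K x) 1 with h | h
  · obtain ⟨γ, hγ⟩ := h1 x y hy h
    obtain ⟨γ', hγ'⟩ := h2 x y hy h
    exact ⟨γ / γ', by rw [hγ, hγ', div_pow]⟩
  · rw [Valuation.map_sub_eq_of_lt_left _ (h3.trans_lt h), Valuation.map_sub_eq_of_lt_left _
      (h4.trans_lt h),
      div_self (zero_lt_one.trans h).ne']
    exact ⟨1, (one_pow q).symm⟩

theorem exists_finite_sub_classes {q : ℕ} (hq : q ≠ 0) {g : K[X]} (hg : g ≠ 0) {e : K}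
    (he : (g.rootMultiplicity e).Coprime q) (hd : g.natDegree.Coprime q) :
    ∃ R : Set K, R.Finite ∧ (∀ r ∈ R, r ≠ 0) ∧ ∀ x, x ≠ e → (∃ y, y ^ q = g.eval x) →
      ∃ r ∈ R, ∃ t ≠ 0, x - e = r * t ^ q := by
  obtain ⟨R, hR, hR0, hRc⟩ := exists_finite_pow_classes hq
    ((finite_not_exists_valuation_eq_pow hq hg he).union ((finite_not_valuation_coeff_le g).union
      ((finite_not_valuation_le e).union (finite_valuation_ne_one (leadingCoeff_ne_zero.mpr hg)))))
  refine ⟨R, hR, hR0, fun x hx ⟨y, hy⟩ => hRc _ (sub_ne_zero.mpr hx) fun v hv => ?_⟩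
  simp only [Set.mem_union, not_or, Set.mem_ofPred_eq, not_not] at hv
  obtain ⟨h1, h2, h3, h4⟩ := hv
  rcases le_or_gt (v.valuation K x) 1 with h | h
  · exact h1 x y hy h
  · rw [Valuation.map_sub_eq_of_lt_left _ (h3.trans_lt h)]
    refine exists_eq_pow_of_coprime hq hd (b := v.valuation K y) ?_
    rw [← map_pow _ y, hy, valuation_eval_eq_pow _ h2 h4 h]

end Descent

end VojtaCurve

namespace VojtaCurve

open Polynomial NumberField

section Quadratic

theorem exists_numberField_subset {K Ω : Type*} [Field K] [NumberField K] [Field Ω] [Algebra K Ω]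
    {s : Set Ω} (hs : s.Finite) (h : ∀ a ∈ s, IsAlgebraic K a) :
    ∃ L : IntermediateField K Ω, NumberField L ∧ s ⊆ L := by
  have : Finite s := hs
  have : FiniteDimensional K (IntermediateField.adjoin K s) :=
    IntermediateField.finiteDimensional_adjoin fun a ha => (h a ha).isIntegral
  exact ⟨_, NumberField.of_module_finite K _, IntermediateField.subset_adjoin K s⟩

theorem exists_numberField_isSquare {K : Type*} [Field K] [NumberField K] {s : Set K}
    (hs : s.Finite) :
    ∃ L : IntermediateField K (AlgebraicClosure K), NumberField L ∧
      ∀ a ∈ s, IsSquare (algebraMap K L a) := by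
  choose r hr using fun a : K =>
    IsAlgClosed.exists_pow_nat_eq (algebraMap K (AlgebraicClosure K) a) two_pos
  obtain ⟨L, hL, hsL⟩ := exists_numberField_subset (hs.image r)
    fun a _ => (Algebra.IsAlgebraic.isAlgebraic a : IsAlgebraic K a)
  refine ⟨L, hL, fun a ha => ⟨⟨r a, hsL (Set.mem_image_of_mem r ha)⟩, Subtype.ext ?_⟩⟩
  exact (hr a).symm.trans (pow_two _)

variable {K : Type*} [Field K] [NumberField K]

theorem finite_setOf_sq_eq_eval {g : K[X]} {e : Fin 4 → K} {e' : K} (he : Function.Injective e)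
    (he' : ∀ i, e' ≠ e i) (h : ∀ i, (g.rootMultiplicity (e i)).Coprime 2)
    (h' : (g.rootMultiplicity e').Coprime 2) : {x : K | ∃ y, y ^ 2 = g.eval x}.Finite := by
  classical
  have hg : g ≠ 0 := by
    rintro rfl
    simp at h'
  choose R hR hR0 hRc using fun i => exists_finite_div_classes two_ne_zero hg (h i) h'
  have ha (i) : e' - e i ≠ 0 := sub_ne_zero.mpr (he' i)
  obtain ⟨L, hL, hsq⟩ := exists_numberField_isSquare (K := K)
    (s := ⋃ i, (fun r => r / (e' - e i)) '' R i) (Set.finite_iUnion fun i => (hR i).image _)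
  set f := algebraMap K L
  obtain ⟨⟨m, hm⟩, hmi⟩ := IsLocalization.exist_integer_multiples_of_finite (nonZeroDivisors (𝓞 L))
    fun i => f (1 / (e' - e 0) - 1 / (e' - e i))
  choose z hz using hmi
  set ι := algebraMap (𝓞 L) L with hι
  have hm0 : ι m ≠ 0 := by simpa [hι] using nonZeroDivisors.ne_zero hm
  have hz' (i) : ι (m * z i) = ι m ^ 2 * f (1 / (e' - e 0) - 1 / (e' - e i)) := by
    have := hz i
    rw [Algebra.smul_def] at this
    rw [map_mul, this, pow_two, mul_assoc]
  have hne {i j} (hij : i ≠ j) : m * z i ≠ m * z j := fun heq => by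
    have h1 := congrArg ι heq
    rw [hz', hz'] at h1
    have h2 := f.injective (mul_left_cancel₀ (pow_ne_zero 2 hm0) h1)
    have h3 := sub_right_injective h2
    rw [one_div, one_div, inv_inj] at h3
    exact hij (he (sub_right_injective h3))
  have hz0 : m * z 0 = 0 := by
    apply RingOfIntegers.coe_injective
    rw [hz']
    simp
  have hfin := finite_setOf_isSquare_and_isSquare (hz0 ▸ hne (by decide : (1 : Fin 4) ≠ 0))
    (hz0 ▸ hne (by decide : (2 : Fin 4) ≠ 0)) (hz0 ▸ hne (by decide : (3 : Fin 4) ≠ 0))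
    (hne (by decide : (1 : Fin 4) ≠ 2)) (hne (by decide : (1 : Fin 4) ≠ 3))
    (hne (by decide : (2 : Fin 4) ≠ 3))
  set φ : K → L := fun x => ι m ^ 2 * f (1 / (x - e') + 1 / (e' - e 0)) with hφ
  have hφ_inj : Function.Injective φ := fun x x' hx => by
    have h2 := f.injective (mul_left_cancel₀ (pow_ne_zero 2 hm0) hx)
    have h3 := add_left_injective _ h2
    rw [one_div, one_div, inv_inj] at h3
    exact sub_left_injective h3
  refine (((Set.finite_range e).union (Set.finite_singleton e')).union
    (hfin.preimage hφ_inj.injOn)).subset fun x hx => ?_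
  by_cases hxe : x ∈ Set.range e ∪ {e'}
  · exact Or.inl hxe
  right
  simp only [Set.mem_union, Set.mem_range, not_or, not_exists, Set.mem_singleton_iff] at hxe
  have hx' : x - e' ≠ 0 := sub_ne_zero.mpr hxe.2
  have key (i) : IsSquare (φ x - ι (m * z i)) := by
    obtain ⟨r, hr, t, -, ht⟩ := hRc i x (fun h => hxe.1 i h.symm) hxe.2 hx
    have e1 : φ x - ι (m * z i) = ι m ^ 2 * f (r / (e' - e i)) * f t ^ 2 := by
      rw [hz', hφ, ← mul_sub, ← map_sub, mul_assoc, ← map_pow f, ← map_mul f]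
      congr 2
      have e2 : 1 / (x - e') + 1 / (e' - e 0) - (1 / (e' - e 0) - 1 / (e' - e i)) =
          (x - e i) / (x - e') / (e' - e i) := by
        have := ha i
        have := ha 0
        field_simp
        ring
      rw [e2, ht]
      ring
    rw [e1]
    exact ((IsSquare.sq _).mul (hsq _ (Set.mem_iUnion.mpr ⟨i, r, hr, rfl⟩))).mul (IsSquare.sq _)
  have key0 : IsSquare (φ x) := by simpa [hz0] using key 0
  exact ⟨(key0.mul (key 1)).mul (key 2), (key0.mul (key 1)).mul (key 3)⟩

end Quadratic

end VojtaCurve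

namespace VojtaCurve

open Polynomial NumberField

section Descent

theorem finite_setOf_pow_eq_eval_of_map {K L : Type*} [Field K] [Field L] (f : K →+* L) {q : ℕ}
    {g : K[X]}
    (h : {x : L | ∃ y, y ^ q = (g.map f).eval x}.Finite) :
      {x : K | ∃ y, y ^ q = g.eval x}.Finite := by
  refine (h.preimage f.injective.injOn).subset ?_
  rintro x ⟨y, hy⟩
  exact ⟨f y, by rw [eval_map_apply, ← hy, map_pow]⟩

variable {K Ω : Type*} [Field K] [NumberField K] [Field Ω] [Algebra K Ω]

theorem exists_numberField_rootMultiplicity {ι : Type*} [Finite ι] {g : K[X]} (e : ι → Ω)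
    (he : ∀ i, (g.map (algebraMap K Ω)).rootMultiplicity (e i) ≠ 0) :
    ∃ (L : IntermediateField K Ω) (_ : NumberField L) (e' : ι → L), (∀ i, (e' i : Ω) = e i) ∧
      ∀ i, (g.map (algebraMap K L)).rootMultiplicity (e' i) =
        (g.map (algebraMap K Ω)).rootMultiplicity (e i) := by
  obtain ⟨L, hL, hs⟩ := exists_numberField_subset (K := K) (Set.finite_range e) (by
    rintro _ ⟨i, rfl⟩
    refine ⟨g, fun h0 => he i (by rw [h0, Polynomial.map_zero, rootMultiplicity_zero]), ?_⟩
    rw [← eval_map_algebraMap]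
    by_contra h
    exact he i (rootMultiplicity_eq_zero h))
  refine ⟨L, hL, fun i => ⟨e i, hs ⟨i, rfl⟩⟩, fun i => rfl, fun i => ?_⟩
  rw [eq_rootMultiplicity_map (algebraMap L Ω).injective, Polynomial.map_map,
    ← IsScalarTower.algebraMap_eq]
  rfl

theorem finite_setOf_sq_eq_eval_of_five_le_card {g : K[X]} (s : Finset Ω) (hs : 5 ≤ s.card)
    (h : ∀ a ∈ s, ((g.map (algebraMap K Ω)).rootMultiplicity a).Coprime 2) :
    {x : K | ∃ y, y ^ 2 = g.eval x}.Finite := by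
  obtain ⟨e⟩ : Nonempty (Fin 5 ↪ s) := Function.Embedding.nonempty_of_card_le (by simpa using hs)
  obtain ⟨L, hL, e', he', hm⟩ := exists_numberField_rootMultiplicity (g := g)
    (fun i => (e i : Ω)) fun i h0 => by simpa [h0] using h _ (e i).2
  have hinj : Function.Injective e' := fun i j hij => e.injective (Subtype.ext (by
    rw [← he', ← he', hij]))
  refine finite_setOf_pow_eq_eval_of_map (algebraMap K L) (finite_setOf_sq_eq_eval
    (e := fun i : Fin 4 => e' i.castSucc) (e' := e' (Fin.last 4))
    (hinj.comp (Fin.castSucc_injective 4)) (fun i hi => ?_) (fun i => ?_) ?_)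
  · exact (Fin.castSucc_lt_last i).ne' (hinj hi)
  · rw [hm]
    exact h _ (e _).2
  · rw [hm]
    exact h _ (e _).2

end Descent

section Superelliptic

theorem finite_setOf_eval_eq_mul_eval {K : Type*} [Field K] {p s : K[X]} (hps : ∀ T, p ≠ C T * s)
    {S : Set K}
    (hS : S.Finite) : {x : K | ∃ T ∈ S, p.eval x = T * s.eval x}.Finite := by
  refine (hS.biUnion fun T _ => (p - C T * s).rootSet_finite K).subset ?_
  rintro x ⟨T, hT, hx⟩
  refine Set.mem_biUnion hT ((mem_rootSet_of_ne (sub_ne_zero.mpr (hps T))).mpr ?_)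
  simp [hx]

variable {K : Type*} [Field K] [NumberField K]

theorem finite_setOf_sq_eq_eval_of_separable {g : K[X]} (hg : g.Separable) (hd : 5 ≤ g.natDegree) :
    {x : K | ∃ y, y ^ 2 = g.eval x}.Finite := by
  classical
  refine finite_setOf_sq_eq_eval_of_five_le_card (g.aroots (AlgebraicClosure K)).toFinset ?_
    fun a ha => ?_
  · rw [Multiset.toFinset_card_of_nodup (nodup_aroots_iff_of_splits hg.ne_zero
      (IsAlgClosed.splits _) |>.mpr hg), aroots, ← (IsAlgClosed.splits _).natDegree_eq_card_roots,
      natDegree_map]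
    exact hd
  · have h1 := rootMultiplicity_le_one_of_separable
      (hg.map (f := algebraMap K (AlgebraicClosure K))) a
    have h2 : 0 < (g.map (algebraMap K (AlgebraicClosure K))).rootMultiplicity a := by
      rw [← count_roots]
      exact Multiset.count_pos.mpr (Multiset.mem_toFinset.mp ha)
    rw [show (g.map (algebraMap K (AlgebraicClosure K))).rootMultiplicity a = 1 by omega]
    exact Nat.coprime_one_left 2

theorem separable_mul_X_pow_add_C {q : ℕ} (hq : q ≠ 0) (a : K) {b : K} (hb : b ≠ 0) :
    (C a * X ^ q + C b).Separable := by
  obtain ⟨n, rfl⟩ := Nat.exists_eq_succ_of_ne_zero hq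
  have h0 : ((n + 1 : ℕ) : K) ≠ 0 := Nat.cast_ne_zero.mpr n.succ_ne_zero
  refine ⟨C b⁻¹, -(C (b⁻¹ * ((n + 1 : ℕ) : K)⁻¹) * X), ?_⟩
  have h1 : C b⁻¹ * C b = 1 := by rw [← C_mul, inv_mul_cancel₀ hb, C_1]
  have h2 : C ((n + 1 : ℕ) : K)⁻¹ * C ((n + 1 : ℕ) : K) = 1 := by
    rw [← C_mul, inv_mul_cancel₀ h0, C_1]
  simp only [derivative_add, derivative_mul, derivative_C, derivative_X_pow, C_mul, zero_mul,
    zero_add, add_zero, Nat.succ_eq_add_one, Nat.add_sub_cancel]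
  linear_combination h1 - C b⁻¹ * C a * X ^ (n + 1) * h2

theorem finite_setOf_sq_eq_mul_pow_add {q : ℕ} (hq : 5 ≤ q) {a b : K} (ha : a ≠ 0) (hb : b ≠ 0) :
    {t : K | ∃ w, w ^ 2 = a * t ^ q + b}.Finite := by
  have h := finite_setOf_sq_eq_eval_of_separable
    (separable_mul_X_pow_add_C (q := q) (by omega) a hb) (by
      rw [natDegree_add_C, natDegree_C_mul_X_pow q a ha]; exact hq)
  simpa using h

theorem finite_setOf_sq_eq_quadratic {r a b c : K} (hr : r ≠ 0) (ha : a ≠ 0) (hc : c ≠ 0)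
    (hd : b ^ 2 - 4 * a * c ≠ 0) :
    {t : K | ∃ w, w ^ 2 = a * (r * t ^ 3) ^ 2 + b * (r * t ^ 3) + c}.Finite := by
  set g : K[X] := C (a * r ^ 2) * X ^ 6 + C (b * r) * X ^ 3 + C c with hg
  have hdeg : g.natDegree = 6 := by
    rw [hg]
    compute_degree!
  have hder : g.derivative * X = C 3 * (X ^ 3 * (C (2 * a * r ^ 2) * X ^ 3 + C (b * r))) := by
    rw [hg]
    simp only [derivative_add, derivative_mul, derivative_C, derivative_X_pow]
    simp only [C_mul, C_pow, map_ofNat, Nat.cast_ofNat]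
    ring
  have hC {u : K} (hu : u ≠ 0) : C u⁻¹ * C u = 1 := by rw [← C_mul, inv_mul_cancel₀ hu, C_1]
  have h1 : IsCoprime g (X ^ 3) := ⟨C c⁻¹, -C c⁻¹ * (C (a * r ^ 2) * X ^ 3 + C (b * r)), by
    rw [hg]
    linear_combination hC hc⟩
  have h2 : IsCoprime g (C (2 * a * r ^ 2) * X ^ 3 + C (b * r)) := by
    have hu : (b ^ 2 - 4 * a * c) * r ^ 2 ≠ 0 := mul_ne_zero hd (pow_ne_zero 2 hr)
    refine ⟨C ((b ^ 2 - 4 * a * c) * r ^ 2)⁻¹ * -C (4 * a * r ^ 2),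
      C ((b ^ 2 - 4 * a * c) * r ^ 2)⁻¹ * (C (2 * a * r ^ 2) * X ^ 3 + C (b * r)), ?_⟩
    have h4 : -C (4 * a * r ^ 2) * g + (C (2 * a * r ^ 2) * X ^ 3 + C (b * r)) *
        (C (2 * a * r ^ 2) * X ^ 3 + C (b * r)) = C ((b ^ 2 - 4 * a * c) * r ^ 2) := by
      rw [hg]
      simp only [C_mul, C_pow, C_sub, map_ofNat]
      ring
    linear_combination C ((b ^ 2 - 4 * a * c) * r ^ 2)⁻¹ * h4 + hC hu
  have h3 : IsCoprime g (C (3 : K)) :=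
    (isCoprime_one_right (x := g)).of_isCoprime_of_dvd_right (Dvd.intro_left _ (hC three_ne_zero))
  have hsep : g.Separable := by
    have := h3.mul_right (h1.mul_right h2)
    rw [← hder] at this
    exact this.of_mul_right_left
  have h := finite_setOf_sq_eq_eval_of_separable hsep (by omega)
  refine h.subset ?_
  rintro t ⟨w, hw⟩
  refine ⟨w, hw.trans ?_⟩
  simp only [hg, eval_add, eval_mul, eval_C, eval_pow, eval_X]
  ring

end Superelliptic

end VojtaCurve

namespace VojtaCurve

open Polynomial NumberField

section Superelliptic

theorem finite_of_forall_exists_class {K : Type*} [Field K] {R A E : Set K} {P : K → K → Prop}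
    {p s : K[X]} (q : ℕ) (hR : R.Finite) (hE : E.Finite) (hps : ∀ T, p ≠ C T * s)
    (hP : ∀ r ∈ R, {t | P r t}.Finite)
    (h : ∀ x ∈ A, x ∉ E → ∃ r ∈ R, ∃ t, P r t ∧ p.eval x = r * t ^ q * s.eval x) : A.Finite := by
  refine (hE.union (hR.biUnion fun r hr => finite_setOf_eval_eq_mul_eval hps
    ((hP r hr).image fun t => r * t ^ q))).subset fun x hx => ?_
  by_cases hxE : x ∈ E
  · exact Or.inl hxE
  · obtain ⟨r, hr, t, ht, hxt⟩ := h x hx hxE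
    exact Or.inr (Set.mem_biUnion hr ⟨_, ⟨t, ht, rfl⟩, hxt⟩)

variable {K : Type*} [Field K] [NumberField K]

theorem finite_setOf_pow_eq_eval_of_coprime_natDegree {q : ℕ} (hq : 5 ≤ q) {g : K[X]} {a b : K}
    (hab : a ≠ b) (ha : (g.rootMultiplicity a).Coprime q) (hb : (g.rootMultiplicity b).Coprime q)
    (hd : g.natDegree.Coprime q) : {x : K | ∃ y, y ^ q = g.eval x}.Finite := by
  have hq0 : q ≠ 0 := by omega
  have hg : g ≠ 0 := by
    rintro rfl
    simp only [rootMultiplicity_zero, Nat.coprime_zero_left] at ha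
    omega
  obtain ⟨R, hR, hR0, hRc⟩ := exists_finite_sub_classes hq0 hg ha hd
  obtain ⟨S, hS, hS0, hSc⟩ := exists_finite_sub_classes hq0 hg hb hd
  refine finite_of_forall_exists_class (E := {a, b}) (p := (X - C a) * (X - C b)) (s := 1)
    (P := fun r t => ∃ w, w ^ 2 = 4 * r * t ^ q + (a - b) ^ 2) q (hR.image2 (· * ·) hS)
    (Set.toFinite _) (fun T hT => ?_) ?_ fun x hx hxE => ?_
  · have := congrArg natDegree hT
    rw [natDegree_mul (X_sub_C_ne_zero a) (X_sub_C_ne_zero b), natDegree_X_sub_C,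
      natDegree_X_sub_C, mul_one, natDegree_C] at this
    omega
  · rintro _ ⟨r, hr, s, hs, rfl⟩
    exact finite_setOf_sq_eq_mul_pow_add hq
      (mul_ne_zero (by norm_num : (4 : K) ≠ 0) (mul_ne_zero (hR0 r hr) (hS0 s hs)))
      (pow_ne_zero 2 (sub_ne_zero.mpr hab))
  · simp only [Set.mem_insert_iff, Set.mem_singleton_iff, not_or] at hxE
    obtain ⟨r, hr, t, -, ht⟩ := hRc x hxE.1 hx
    obtain ⟨s, hs, u, -, hu⟩ := hSc x hxE.2 hx
    have h : (x - a) * (x - b) = r * s * (t * u) ^ q := by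
      rw [ht, hu]
      ring
    refine ⟨_, ⟨r, hr, s, hs, rfl⟩, t * u, ⟨2 * x - a - b, ?_⟩, ?_⟩
    · linear_combination 4 * h
    · simp [h]

theorem finite_setOf_pow_eq_eval_of_three {q : ℕ} (hq : 5 ≤ q) {g : K[X]} {a b c : K}
    (hab : a ≠ b) (hac : a ≠ c) (hbc : b ≠ c) (ha : (g.rootMultiplicity a).Coprime q)
    (hb : (g.rootMultiplicity b).Coprime q) (hc : (g.rootMultiplicity c).Coprime q) :
    {x : K | ∃ y, y ^ q = g.eval x}.Finite := by
  have hq0 : q ≠ 0 := by omega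
  have hg : g ≠ 0 := by
    rintro rfl
    simp only [rootMultiplicity_zero, Nat.coprime_zero_left] at ha
    omega
  have hca : c - a ≠ 0 := sub_ne_zero.mpr hac.symm
  have hcb : c - b ≠ 0 := sub_ne_zero.mpr hbc.symm
  obtain ⟨R, hR, hR0, hRc⟩ := exists_finite_div_classes hq0 hg ha hc
  obtain ⟨S, hS, hS0, hSc⟩ := exists_finite_div_classes hq0 hg hb hc
  refine finite_of_forall_exists_class (E := {a, b, c}) (p := (X - C a) * (X - C b))
    (s := (X - C c) ^ 2)
    (P := fun r t => ∃ w, w ^ 2 = 4 * (c - a) * (c - b) * r * t ^ q + (a - b) ^ 2) q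
    (hR.image2 (· * ·) hS) (Set.toFinite _) (fun T hT => ?_) ?_ fun x hx hxE => ?_
  · have := congrArg (eval c) hT
    simp [hca, hcb] at this
  · rintro _ ⟨r, hr, s, hs, rfl⟩
    exact finite_setOf_sq_eq_mul_pow_add hq (mul_ne_zero
      (mul_ne_zero (mul_ne_zero (by norm_num : (4 : K) ≠ 0) hca)
      hcb) (mul_ne_zero (hR0 r hr) (hS0 s hs))) (pow_ne_zero 2 (sub_ne_zero.mpr hab))
  · simp only [Set.mem_insert_iff, Set.mem_singleton_iff, not_or] at hxE
    have hxc : x - c ≠ 0 := sub_ne_zero.mpr hxE.2.2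
    obtain ⟨r, hr, t, -, ht⟩ := hRc x hxE.1 hxE.2.2 hx
    obtain ⟨s, hs, u, -, hu⟩ := hSc x hxE.2.1 hxE.2.2 hx
    have h : (x - a) * (x - b) / (x - c) ^ 2 = r * s * (t * u) ^ q := by
      rw [pow_two, mul_div_mul_comm, ht, hu]
      ring
    refine ⟨_, ⟨r, hr, s, hs, rfl⟩, t * u,
      ⟨2 * (c - a) * (c - b) / (x - c) + (c - a) + (c - b), ?_⟩, ?_⟩
    · rw [mul_assoc _ (r * s), ← h]
      field_simp
      ring
    · rw [← h]
      simp [hxc]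

theorem finite_setOf_cube_eq_eval_of_four {g : K[X]} {a b c d : K}
    (hab : a ≠ b) (hac : a ≠ c) (had : a ≠ d) (hbc : b ≠ c) (hbd : b ≠ d) (hcd : c ≠ d)
    (ha : (g.rootMultiplicity a).Coprime 3) (hb : (g.rootMultiplicity b).Coprime 3)
    (hc : (g.rootMultiplicity c).Coprime 3) (hd : (g.rootMultiplicity d).Coprime 3) :
    {x : K | ∃ y, y ^ 3 = g.eval x}.Finite := by
  have hg : g ≠ 0 := by
    rintro rfl
    simp at ha
  have hac' : a - c ≠ 0 := sub_ne_zero.mpr hac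
  have had' : a - d ≠ 0 := sub_ne_zero.mpr had
  have hbc' : b - c ≠ 0 := sub_ne_zero.mpr hbc
  have hbd' : b - d ≠ 0 := sub_ne_zero.mpr hbd
  have hca' : c - a ≠ 0 := sub_ne_zero.mpr hac.symm
  have hcb' : c - b ≠ 0 := sub_ne_zero.mpr hbc.symm
  obtain ⟨R, hR, hR0, hRc⟩ := exists_finite_div_classes three_ne_zero hg ha hc
  obtain ⟨S, hS, hS0, hSc⟩ := exists_finite_div_classes three_ne_zero hg hb hd
  refine finite_of_forall_exists_class (E := {a, b, c, d}) (p := (X - C a) * (X - C b))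
    (s := (X - C c) * (X - C d))
    (P := fun r t => ∃ w, w ^ 2 = (c - d) ^ 2 * (r * t ^ 3) ^ 2 +
      (4 * a * b + 4 * c * d - 2 * (a + b) * (c + d)) * (r * t ^ 3) + (a - b) ^ 2) 3
    (hR.image2 (· * ·) hS) (Set.toFinite _) (fun T hT => ?_) ?_ fun x hx hxE => ?_
  · have := congrArg (eval c) hT
    simp [hca', hcb'] at this
  · rintro _ ⟨r, hr, s, hs, rfl⟩
    refine finite_setOf_sq_eq_quadratic (mul_ne_zero (hR0 r hr) (hS0 s hs))
      (pow_ne_zero 2 (sub_ne_zero.mpr hcd)) (pow_ne_zero 2 (sub_ne_zero.mpr hab)) ?_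
    have : (4 * a * b + 4 * c * d - 2 * (a + b) * (c + d)) ^ 2 - 4 * (c - d) ^ 2 * (a - b) ^ 2 =
        16 * ((a - c) * (a - d) * (b - c) * (b - d)) := by ring
    rw [this]
    simp [hac', had', hbc', hbd']
  · simp only [Set.mem_insert_iff, Set.mem_singleton_iff, not_or] at hxE
    have hxc : x - c ≠ 0 := sub_ne_zero.mpr hxE.2.2.1
    have hxd : x - d ≠ 0 := sub_ne_zero.mpr hxE.2.2.2
    obtain ⟨r, hr, t, -, ht⟩ := hRc x hxE.1 hxE.2.2.1 hx
    obtain ⟨s, hs, u, -, hu⟩ := hSc x hxE.2.1 hxE.2.2.2 hx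
    have h : (x - a) * (x - b) = r * s * (t * u) ^ 3 * ((x - c) * (x - d)) := by
      rw [← div_eq_iff (mul_ne_zero hxc hxd), mul_div_mul_comm, ht, hu]
      ring
    refine ⟨_, ⟨r, hr, s, hs, rfl⟩, t * u, ?_, by simp [h]⟩
    generalize r * s * (t * u) ^ 3 = T at h
    refine ⟨2 * (T - 1) * x - (T * (c + d) - (a + b)), ?_⟩
    linear_combination 4 * (1 - T) * h

end Superelliptic

section AlgebraicallyClosed

variable {K Ω : Type*} [Field K] [NumberField K] [Field Ω] [Algebra K Ω]

theorem finite_setOf_cube_eq_eval_of_four_le_card {g : K[X]} (s : Finset Ω) (hs : 4 ≤ s.card)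
    (h : ∀ a ∈ s, ((g.map (algebraMap K Ω)).rootMultiplicity a).Coprime 3) :
    {x : K | ∃ y, y ^ 3 = g.eval x}.Finite := by
  obtain ⟨e⟩ : Nonempty (Fin 4 ↪ s) := Function.Embedding.nonempty_of_card_le (by simpa using hs)
  obtain ⟨L, hL, e', he', hm⟩ := exists_numberField_rootMultiplicity (g := g)
    (fun i => (e i : Ω)) fun i h0 => by simpa [h0] using h _ (e i).2
  have hinj {i j} (hij : i ≠ j) : e' i ≠ e' j := fun heq => hij (e.injective (Subtype.ext (by
    rw [← he', ← he', heq])))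
  have hcop (i) : ((g.map (algebraMap K L)).rootMultiplicity (e' i)).Coprime 3 := by
    rw [hm]
    exact h _ (e i).2
  exact finite_setOf_pow_eq_eval_of_map (algebraMap K L) (finite_setOf_cube_eq_eval_of_four
    (hinj (by decide : (0 : Fin 4) ≠ 1)) (hinj (by decide : (0 : Fin 4) ≠ 2))
    (hinj (by decide : (0 : Fin 4) ≠ 3)) (hinj (by decide : (1 : Fin 4) ≠ 2))
    (hinj (by decide : (1 : Fin 4) ≠ 3)) (hinj (by decide : (2 : Fin 4) ≠ 3))
    (hcop 0) (hcop 1) (hcop 2) (hcop 3))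

theorem exists_not_dvd_rootMultiplicity {q : ℕ} (hq : 3 ≤ q) [IsAlgClosed Ω] {g : Polynomial Ω}
    {a b : Ω}
    (hab : a ≠ b) (ha : g.rootMultiplicity a = 1) (hb : g.rootMultiplicity b = 1)
    (hd : q ∣ g.natDegree) : ∃ c, a ≠ c ∧ b ≠ c ∧ ¬ q ∣ g.rootMultiplicity c := by
  classical
  by_contra! hcon
  have hsub : {a, b} ⊆ g.roots.toFinset := by
    intro c hc
    rw [Multiset.mem_toFinset, ← Multiset.count_pos, count_roots]
    rcases Finset.mem_insert.mp hc with rfl | hc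
    · omega
    · rw [Finset.mem_singleton.mp hc]
      omega
  have hsum := Multiset.toFinset_sum_count_eq g.roots
  rw [← (IsAlgClosed.splits g).natDegree_eq_card_roots, ← Finset.sum_sdiff hsub,
    Finset.sum_pair hab, count_roots, count_roots, ha, hb] at hsum
  have hdvd : q ∣ ∑ c ∈ g.roots.toFinset \ {a, b}, g.roots.count c := by
    refine Finset.dvd_sum fun c hc => ?_
    simp only [Finset.mem_sdiff, Finset.mem_insert, Finset.mem_singleton, not_or] at hc
    rw [count_roots]
    exact hcon c (Ne.symm hc.2.1) (Ne.symm hc.2.2)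
  have h2 := (Nat.dvd_add_right hdvd).mp (hsum ▸ hd)
  exact absurd (Nat.le_of_dvd two_pos h2) (by omega)

theorem finite_setOf_pow_eq_eval_of_two_simple [IsAlgClosed Ω] {q : ℕ} (hq : q.Prime) (hq5 : 5 ≤ q)
    {g : K[X]} {a b : Ω} (hab : a ≠ b) (ha : (g.map (algebraMap K Ω)).rootMultiplicity a = 1)
    (hb : (g.map (algebraMap K Ω)).rootMultiplicity b = 1) :
    {x : K | ∃ y, y ^ q = g.eval x}.Finite := by
  by_cases hd : q ∣ g.natDegree
  · obtain ⟨c, hac, hbc, hc⟩ := exists_not_dvd_rootMultiplicity (by omega) hab ha hb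
      ((natDegree_map (algebraMap K Ω)).symm ▸ hd)
    obtain ⟨L, hL, e', he', hm⟩ := exists_numberField_rootMultiplicity (g := g) ![a, b, c] (by
      intro i
      fin_cases i
      · simp [ha]
      · simp [hb]
      · intro h0
        simp only [Fin.reduceFinMk, Matrix.cons_val] at h0
        exact hc (h0 ▸ dvd_zero q))
    have hinj {i j} (hij : ![a, b, c] i ≠ ![a, b, c] j) : e' i ≠ e' j := fun heq => hij (by
      rw [← he', ← he', heq])
    refine finite_setOf_pow_eq_eval_of_map (algebraMap K L) (finite_setOf_pow_eq_eval_of_three hq5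
      (hinj (i := 0) (j := 1) hab) (hinj (i := 0) (j := 2) hac) (hinj (i := 1) (j := 2) hbc)
      ?_ ?_ ?_)
    · rw [hm]
      simp [ha]
    · rw [hm]
      simp [hb]
    · rw [hm]
      exact ((hq.coprime_iff_not_dvd).mpr hc).symm
  · obtain ⟨L, hL, e', he', hm⟩ := exists_numberField_rootMultiplicity (g := g) ![a, b] (by
      intro i
      fin_cases i
      · simp [ha]
      · simp [hb])
    have hinj : e' 0 ≠ e' 1 := fun heq => hab ((he' 0).symm.trans ((congrArg _ heq).trans (he' 1)))
    refine finite_setOf_pow_eq_eval_of_map (algebraMap K L)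
      (finite_setOf_pow_eq_eval_of_coprime_natDegree hq5 hinj ?_ ?_ ?_)
    · rw [hm]
      simp [ha]
    · rw [hm]
      simp [hb]
    · rw [natDegree_map]
      exact ((hq.coprime_iff_not_dvd).mpr hd).symm

theorem finite_setOf_prime_pow_eq_eval [IsAlgClosed Ω] {q : ℕ} (hq : q.Prime) {g : K[X]}
    (s : Finset Ω) (hs : (if q = 2 then 5 else if q = 3 then 4 else 2) ≤ s.card)
    (h : ∀ a ∈ s, (g.map (algebraMap K Ω)).rootMultiplicity a = 1) :
    {x : K | ∃ y, y ^ q = g.eval x}.Finite := by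
  have h1 (a) (ha : a ∈ s) : ((g.map (algebraMap K Ω)).rootMultiplicity a).Coprime q := by
    rw [h a ha]
    exact Nat.coprime_one_left q
  split_ifs at hs with h2 h3
  · subst h2
    exact finite_setOf_sq_eq_eval_of_five_le_card s hs h1
  · subst h3
    exact finite_setOf_cube_eq_eval_of_four_le_card s hs h1
  · obtain ⟨a, ha, b, hb, hab⟩ := Finset.one_lt_card.mp hs
    have h4 : q ≠ 4 := fun h4 => by
      subst h4
      exact absurd hq (by norm_num)
    have := hq.two_le
    exact finite_setOf_pow_eq_eval_of_two_simple hq (by omega) hab (h a ha) (h b hb)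

end AlgebraicallyClosed

end VojtaCurve

open Polynomial

/-- Let `m > 1` with smallest prime divisor `p`, and let `Q ∈ ℚ[X]` have at least
`k` simple roots in `ℚ̄`, where `k = 5` if `p = 2`, `k = 4` if `p = 3`, and `k = 2`
if `p ≥ 5`. Then for all but finitely many rational `α`, the polynomial
`X^m - Q(α)` is irreducible over `ℚ`. -/
theorem binomial_irreducible_cofinitely (m : ℕ) (hm : 1 < m)
    (Q : Polynomial ℚ)
    (hsimple : (if m.minFac = 2 then 5 else if m.minFac = 3 then 4 else 2) ≤
      ((Q.aroots ℂ).toFinset.filter fun r => (Q.aroots ℂ).count r = 1).card) :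
    {α : ℚ | ¬ Irreducible (X ^ m - C (Q.eval α))}.Finite := by
  have hs (r) (hr : r ∈ (Q.aroots ℂ).toFinset.filter fun r => (Q.aroots ℂ).count r = 1) :
      (Q.map (algebraMap ℚ ℂ)).rootMultiplicity r = 1 :=
    (count_roots _).symm.trans (Finset.mem_filter.mp hr).2
  have hcard {q : ℕ} (hq : q.Prime) (hqm : q ∣ m) := by
    have h2 := Nat.minFac_le_of_dvd hq.two_le hqm
    have h3 := (Nat.minFac_prime hm.ne').two_le
    refine (show (if q = 2 then 5 else if q = 3 then 4 else 2) ≤ _ by split_ifs <;> omega).trans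
      hsimple
  have hpos : (⋃ q ∈ m.primeFactors, {α : ℚ | ∃ y, y ^ q = Q.eval α}).Finite :=
    m.primeFactors.finite_toSet.biUnion fun q hq =>
      VojtaCurve.finite_setOf_prime_pow_eq_eval (Nat.prime_of_mem_primeFactors hq) _
        (hcard (Nat.prime_of_mem_primeFactors hq) (Nat.dvd_of_mem_primeFactors hq)) hs
  have hneg : {α : ℚ | 2 ∣ m ∧ ∃ y, y ^ 2 = (-Q).eval α}.Finite := by
    by_cases h2 : 2 ∣ m
    · refine (VojtaCurve.finite_setOf_prime_pow_eq_eval (Ω := ℂ) Nat.prime_two _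
        (hcard Nat.prime_two h2) fun r hr => ?_).subset fun α hα => hα.2
      rw [Polynomial.map_neg, ← count_roots, roots_neg, count_roots]
      exact hs r hr
    · simp [h2]
  refine (hpos.union hneg).subset fun α hα => ?_
  by_contra hcon
  simp only [Set.mem_union, Set.mem_iUnion, Set.mem_ofPred_eq, not_or, not_exists, not_and] at hcon
  refine hα (VojtaCurve.X_pow_sub_C_irreducible_of_forall_prime (by omega) (fun q hq hqm b hb => ?_)
    fun h2 b hb => ?_)
  · exact hcon.1 q (Nat.mem_primeFactors.mpr ⟨hq, hqm, by omega⟩) b hb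
  · exact hcon.2 h2 b (by rw [hb, eval_neg])
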